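/- An even hyperbolic 2-elementary lattice M is determined up to isometry by the triple (r, l, δ), where r = rank M, l = l(A_M) is the minimal number of generators of the discriminant group, and δ ∈ {0,1} is the parity of the discriminant quadratic form (δ = 0 iff q_M takes values in ℤ/2ℤ ⊂ ℚ/2ℤ on all of A_M). -/

import Mathlib

open Matrix

/-- The minimal number of generators of an (additive) abelian group. -/
noncomputable def minGen (A : Type) [AddCommGroup A] : ℕ :=
  sInf {n | ∃ s : Finset A, s.card = n ∧ AddSubgroup.closure (s : Set A) = ⊤}

/-- The integral symmetric matrix `G` has real signature `(p, q)`: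
over `ℝ` it is congruent to `diag(1,…,1,−1,…,−1)` with `p` ones. -/
def SignatureIs {r : ℕ} (G : Matrix (Fin r) (Fin r) ℤ) (p : ℕ) : Prop :=
  ∃ P : Matrix (Fin r) (Fin r) ℝ, IsUnit P.det ∧
    P.transpose * (G.map (fun a : ℤ => (a : ℝ))) * P =
      Matrix.diagonal (fun i : Fin r => if (i : ℕ) < p then (1 : ℝ) else -1)

/-- The lattice with Gram matrix `G` is 2-elementary: its discriminant group
(the cokernel of `G`) is killed by 2. -/
def TwoElem {r : ℕ} (G : Matrix (Fin r) (Fin r) ℤ) : Prop :=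
  ∀ v : Fin r → ℤ, ∃ w : Fin r → ℤ, G.mulVec w = 2 • v

/-- The parity `δ` of the lattice with Gram matrix `G` is `0`: the discriminant
quadratic form takes values in `ℤ/2ℤ ⊂ ℚ/2ℤ`, i.e. every dual vector has
integral square. -/
def ParityZero {r : ℕ} (G : Matrix (Fin r) (Fin r) ℤ) : Prop :=
  ∀ y : Fin r → ℚ,
    (∀ i, ∃ n : ℤ, (G.map (fun a : ℤ => (a : ℚ))).mulVec y i = n) →
    ∃ n : ℤ, y ⬝ᵥ (G.map (fun a : ℤ => (a : ℚ))).mulVec y = n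

/-- The rational number `q` is an integer. -/
def IsInt (q : ℚ) : Prop := ∃ n : ℤ, q = n

namespace IsInt

theorem intCast (n : ℤ) : IsInt n := ⟨n, rfl⟩
theorem zero : IsInt 0 := ⟨0, by simp⟩
theorem add {a b : ℚ} (ha : IsInt a) (hb : IsInt b) : IsInt (a + b) := by
  obtain ⟨m, rfl⟩ := ha
  obtain ⟨n, rfl⟩ := hb
  exact ⟨m + n, by push_cast; ring⟩

theorem sub {a b : ℚ} (ha : IsInt a) (hb : IsInt b) : IsInt (a - b) := by
  obtain ⟨m, rfl⟩ := ha
  obtain ⟨n, rfl⟩ := hb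
  exact ⟨m - n, by push_cast; ring⟩

theorem mul {a b : ℚ} (ha : IsInt a) (hb : IsInt b) : IsInt (a * b) := by
  obtain ⟨m, rfl⟩ := ha
  obtain ⟨n, rfl⟩ := hb
  exact ⟨m * n, by push_cast; ring⟩

theorem neg {a : ℚ} (ha : IsInt a) : IsInt (-a) := by
  obtain ⟨m, rfl⟩ := ha
  exact ⟨-m, by push_cast; ring⟩

/-- A non-integer whose double is an integer is half an odd integer. -/
theorem exists_half {q : ℚ} (h2 : IsInt (2 * q)) (h : ¬ IsInt q) : ∃ n : ℤ, q = n + 1 / 2 := by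
  obtain ⟨m, hm⟩ := h2
  obtain ⟨k, hk⟩ := Int.even_or_odd' m
  rcases hk with rfl | rfl
  · exact absurd ⟨k, by push_cast at hm; linarith⟩ h
  · exact ⟨k, by push_cast at hm; linarith⟩

theorem not_half (n : ℤ) : ¬ IsInt ((n : ℚ) + 1 / 2) := by
  rintro ⟨m, hm⟩
  have : 2 * (n - m) + 1 = (0 : ℤ) := by
    have : (2 * (n - m) + 1 : ℚ) = 0 := by linarith
    exact_mod_cast this
  omega

theorem add_of_half {a b : ℚ} (ha2 : IsInt (2 * a)) (ha : ¬ IsInt a) (hb2 : IsInt (2 * b))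
    (hb : ¬ IsInt b) : IsInt (a + b) := by
  obtain ⟨m, rfl⟩ := exists_half ha2 ha
  obtain ⟨n, rfl⟩ := exists_half hb2 hb
  exact ⟨m + n + 1, by push_cast; ring⟩

end IsInt

section Lattice

variable {V : Type} [AddCommGroup V] [Module ℚ V]

/-- The dual of a subgroup of a rational quadratic space. -/
def dualLat (B : LinearMap.BilinForm ℚ V) (M : Submodule ℤ V) : Submodule ℤ V where
  carrier := {y | ∀ x ∈ M, IsInt (B x y)}
  zero_mem' := fun x _ => by simpa using IsInt.zero
  add_mem' := fun ha hb x hx => by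
    rw [map_add]
    exact (ha x hx).add (hb x hx)
  smul_mem' := fun n y hy x hx => by
    rw [map_zsmul, zsmul_eq_mul]
    exact (IsInt.intCast n).mul (hy x hx)

/-- The double of the dual lattice. -/
def twiceDual (B : LinearMap.BilinForm ℚ V) (M : Submodule ℤ V) : Submodule ℤ V where
  carrier := {y | ∀ x ∈ M, IsInt (B x y / 2)}
  zero_mem' := fun x _ => by simpa using IsInt.zero
  add_mem' := fun ha hb x hx => by
    rw [map_add, add_div]
    exact (ha x hx).add (hb x hx)
  smul_mem' := fun n y hy x hx => by
    rw [map_zsmul, zsmul_eq_mul, mul_div_assoc]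
    exact (IsInt.intCast n).mul (hy x hx)

/-- The vectors of `M` having even product with `w`. -/
def evenPart (B : LinearMap.BilinForm ℚ V) (M : Submodule ℤ V) (w : V) : Submodule ℤ V where
  carrier := {x | x ∈ M ∧ IsInt (B x w / 2)}
  zero_mem' := ⟨M.zero_mem, by simpa using IsInt.zero⟩
  add_mem' := fun ha hb => ⟨M.add_mem ha.1 hb.1, by
    rw [map_add, LinearMap.add_apply, add_div]
    exact ha.2.add hb.2⟩
  smul_mem' := fun n y hy => ⟨M.smul_mem n hy.1, by
    rw [map_zsmul, LinearMap.smul_apply, zsmul_eq_mul, mul_div_assoc]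
    exact (IsInt.intCast n).mul hy.2⟩

variable {B : LinearMap.BilinForm ℚ V} {M : Submodule ℤ V}

theorem mem_dualLat {y : V} : y ∈ dualLat B M ↔ ∀ x ∈ M, IsInt (B x y) := Iff.rfl
theorem mem_twiceDual {y : V} : y ∈ twiceDual B M ↔ ∀ x ∈ M, IsInt (B x y / 2) := Iff.rfl
theorem mem_evenPart {w x : V} : x ∈ evenPart B M w ↔ x ∈ M ∧ IsInt (B x w / 2) := Iff.rfl

theorem mem_twiceDual_iff {y : V} : y ∈ twiceDual B M ↔ (2⁻¹ : ℚ) • y ∈ dualLat B M := by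
  simp only [mem_twiceDual, mem_dualLat, map_smul, smul_eq_mul]
  refine forall₂_congr fun x _ => ?_
  rw [div_eq_inv_mul]

theorem add_self_mem_twiceDual {y : V} : y + y ∈ twiceDual B M ↔ y ∈ dualLat B M := by
  rw [mem_twiceDual_iff]
  have : (2⁻¹ : ℚ) • (y + y) = y := by rw [← two_smul ℚ y, smul_smul]; norm_num
  rw [this]

/-- `M` is an even 2-elementary lattice in the quadratic space `(V, B)`. -/
structure IsEvenTwoElem (B : LinearMap.BilinForm ℚ V) (M : Submodule ℤ V) : Prop where
  fg : M.FG
  span_eq : Submodule.span ℚ (M : Set V) = ⊤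
  symm : ∀ x y, B x y = B y x
  even : ∀ x ∈ M, IsInt (B x x / 2)
  add_self_mem : ∀ y ∈ dualLat B M, y + y ∈ M
  mem_of_dual : ∀ x, (∀ y ∈ dualLat B M, IsInt (B y x)) → x ∈ M

/-- Every vector of the dual lattice has integral square. -/
def DualIntegral (B : LinearMap.BilinForm ℚ V) (M : Submodule ℤ V) : Prop :=
  ∀ y ∈ dualLat B M, IsInt (B y y)

/-- The index of twice the dual lattice in the lattice. -/
noncomputable def coIndex (B : LinearMap.BilinForm ℚ V) (M : Submodule ℤ V) : ℕ :=
  (twiceDual B M).toAddSubgroup.relIndex M.toAddSubgroup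

namespace IsEvenTwoElem

theorem isInt (h : IsEvenTwoElem B M) {x y : V} (hx : x ∈ M) (hy : y ∈ M) : IsInt (B x y) := by
  have h1 := ((h.even _ (M.add_mem hx hy)).sub (h.even _ hx)).sub (h.even _ hy)
  simp only [map_add, LinearMap.add_apply, h.symm y x] at h1
  convert h1 using 1
  ring

theorem le_dual (h : IsEvenTwoElem B M) : M ≤ dualLat B M := fun _ hy _ hx => h.isInt hx hy

theorem isInt_dual_left (h : IsEvenTwoElem B M) {x y : V} (hx : x ∈ M) (hy : y ∈ dualLat B M) :
    IsInt (B y x) := by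
  rw [h.symm]
  exact hy x hx

theorem isInt_two_mul (h : IsEvenTwoElem B M) {x y : V} (hx : x ∈ dualLat B M)
    (hy : y ∈ dualLat B M) : IsInt (2 * B x y) := by
  have := hy _ (h.add_self_mem x hx)
  rwa [map_add, LinearMap.add_apply, ← two_mul] at this

theorem twiceDual_le (h : IsEvenTwoElem B M) : twiceDual B M ≤ M := by
  intro y hy
  have h1 := h.add_self_mem _ (mem_twiceDual_iff.1 hy)
  rwa [← add_smul, show (2⁻¹ + 2⁻¹ : ℚ) = 1 by norm_num, one_smul] at h1

theorem exists_notMem_twiceDual (h1 : coIndex B M ≠ 1) :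
    ∃ w ∈ M, w ∉ twiceDual B M := by
  by_contra! hc
  exact h1 (AddSubgroup.relIndex_eq_one.2 hc)

section EvenPart

variable {w : V}

theorem evenPart_le : evenPart B M w ≤ M := fun _ h => h.1

theorem half_mem_dual_evenPart : (2⁻¹ : ℚ) • w ∈ dualLat B (evenPart B M w) := by
  intro x hx
  rw [map_smul, smul_eq_mul, ← div_eq_inv_mul]
  exact hx.2

theorem dual_le_dual_evenPart : dualLat B M ≤ dualLat B (evenPart B M w) :=
  fun _ hy x hx => hy x hx.1

/-- The dual of an even part is generated by the dual and half of the vector. -/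
theorem mem_or_of_mem_dual_evenPart (h : IsEvenTwoElem B M) (hw : w ∈ M)
    (hw' : w ∉ twiceDual B M) {y : V} (hy : y ∈ dualLat B (evenPart B M w)) :
    y ∈ dualLat B M ∨ y + (2⁻¹ : ℚ) • w ∈ dualLat B M := by
  obtain ⟨x₀, hx₀, hodd⟩ : ∃ x₀ ∈ M, ¬ IsInt (B x₀ w / 2) := by
    by_contra! hc
    exact hw' hc
  have key : ∀ z ∈ dualLat B (evenPart B M w), IsInt (B x₀ z) → z ∈ dualLat B M := by
    intro z hz hz0 x hx
    by_cases hxw : IsInt (B x w / 2)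
    · exact hz x ⟨hx, hxw⟩
    · have h1 : x - x₀ ∈ evenPart B M w := by
        refine ⟨M.sub_mem hx hx₀, ?_⟩
        rw [map_sub, LinearMap.sub_apply]
        have e : (B x w - B x₀ w) / 2 = (B x w / 2 + B x₀ w / 2) - B x₀ w := by ring
        rw [e]
        refine (IsInt.add_of_half ?_ hxw ?_ hodd).sub (h.isInt hx₀ hw)
        · rw [mul_div_cancel₀ _ (by norm_num)]; exact h.isInt hx hw
        · rw [mul_div_cancel₀ _ (by norm_num)]; exact h.isInt hx₀ hw
      have h2 := (hz _ h1).add hz0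
      rwa [map_sub, LinearMap.sub_apply, sub_add_cancel] at h2
  by_cases hy0 : IsInt (B x₀ y)
  · exact Or.inl (key y hy hy0)
  · refine Or.inr (key _ (Submodule.add_mem _ hy half_mem_dual_evenPart) ?_)
    rw [map_add, map_smul, smul_eq_mul, ← div_eq_inv_mul]
    refine IsInt.add_of_half ?_ hy0 ?_ hodd
    · have h2 : x₀ + x₀ ∈ evenPart B M w := by
        refine ⟨M.add_mem hx₀ hx₀, ?_⟩
        rw [map_add, LinearMap.add_apply, ← two_mul, mul_div_assoc, mul_div_cancel₀ _ (by norm_num)]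
        exact h.isInt hx₀ hw
      have := hy _ h2
      rwa [map_add, LinearMap.add_apply, ← two_mul] at this
    · rw [mul_div_cancel₀ _ (by norm_num)]; exact h.isInt hx₀ hw

theorem add_self_mem_evenPart (h : IsEvenTwoElem B M) (hw : w ∈ M) {x : V} (hx : x ∈ M) :
    x + x ∈ evenPart B M w := by
  refine ⟨M.add_mem hx hx, ?_⟩
  rw [map_add, LinearMap.add_apply, add_self_div_two]
  exact h.isInt hx hw

theorem half_add_half (w : V) : (2⁻¹ : ℚ) • w + (2⁻¹ : ℚ) • w = w := by
  rw [← add_smul, show (2⁻¹ + 2⁻¹ : ℚ) = 1 by norm_num, one_smul]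

theorem evenPart_isEvenTwoElem (h : IsEvenTwoElem B M) (hw : w ∈ M)
    (hw' : w ∉ twiceDual B M) : IsEvenTwoElem B (evenPart B M w) where
  fg := by
    have := Module.Finite.iff_fg.2 h.fg
    have h1 := (inferInstance : IsNoetherian ℤ M)
    have h2 := (isNoetherian_submodule.1 h1) (evenPart B M w) evenPart_le
    exact h2
  span_eq := by
    rw [eq_top_iff, ← h.span_eq, Submodule.span_le]
    intro x hx
    have h1 : x + x ∈ Submodule.span ℚ (evenPart B M w : Set V) :=
      Submodule.subset_span (h.add_self_mem_evenPart hw hx)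
    have h2 := Submodule.smul_mem _ (2⁻¹ : ℚ) h1
    rwa [smul_add, half_add_half] at h2
  symm := h.symm
  even := fun x hx => h.even x hx.1
  add_self_mem := by
    have key : ∀ z ∈ dualLat B M, z + z ∈ evenPart B M w := by
      intro z hz
      refine ⟨h.add_self_mem z hz, ?_⟩
      rw [map_add, LinearMap.add_apply, add_self_div_two]
      exact h.isInt_dual_left hw hz
    intro y hy
    rcases h.mem_or_of_mem_dual_evenPart hw hw' hy with h1 | h1
    · exact key y h1
    · have h2 := key _ h1
      have h3 : w ∈ evenPart B M w := ⟨hw, h.even w hw⟩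
      have h4 := Submodule.sub_mem _ h2 h3
      rwa [add_add_add_comm, half_add_half, add_sub_cancel_right] at h4
  mem_of_dual := by
    intro x hx
    refine ⟨h.mem_of_dual x fun y hy => hx y (dual_le_dual_evenPart hy), ?_⟩
    have := hx _ half_mem_dual_evenPart
    rw [h.symm, map_smul, smul_eq_mul, ← div_eq_inv_mul] at this
    exact this

theorem not_dualIntegral_evenPart (hM : ¬ DualIntegral B M) :
    ¬ DualIntegral B (evenPart B M w) := fun h =>
  hM fun y hy => h y (dual_le_dual_evenPart hy)

theorem relIndex_eq_two {G : Type} [AddCommGroup G] {H K : AddSubgroup G} {a : G} (ha : a ∈ K)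
    (haH : a ∉ H) (hK : ∀ b ∈ K, b ∈ H ∨ b + a ∈ H) : H.relIndex K = 2 := by
  rw [AddSubgroup.relIndex, AddSubgroup.index_eq_two_iff_exists_notMem_and]
  refine ⟨⟨a, ha⟩, by simpa [AddSubgroup.mem_addSubgroupOf] using haH, ?_⟩
  rintro ⟨b, hb⟩
  simpa [AddSubgroup.mem_addSubgroupOf, or_comm] using hK b hb

theorem relIndex_evenPart (h : IsEvenTwoElem B M) (hw : w ∈ M) (hw' : w ∉ twiceDual B M) :
    (evenPart B M w).toAddSubgroup.relIndex M.toAddSubgroup = 2 := by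
  obtain ⟨x₀, hx₀, hodd⟩ : ∃ x₀ ∈ M, ¬ IsInt (B x₀ w / 2) := by
    by_contra! hc
    exact hw' hc
  refine relIndex_eq_two (a := x₀) hx₀ (fun hc => hodd hc.2) ?_
  intro b hb
  by_cases hbw : IsInt (B b w / 2)
  · exact Or.inl ⟨hb, hbw⟩
  · refine Or.inr ⟨M.add_mem hb hx₀, ?_⟩
    rw [map_add, LinearMap.add_apply, add_div]
    refine IsInt.add_of_half ?_ hbw ?_ hodd
    · rw [mul_div_cancel₀ _ (by norm_num)]; exact h.isInt hb hw
    · rw [mul_div_cancel₀ _ (by norm_num)]; exact h.isInt hx₀ hw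

theorem coIndex_eq_four_mul (h : IsEvenTwoElem B M) (hw : w ∈ M) (hw' : w ∉ twiceDual B M) :
    coIndex B M = 4 * coIndex B (evenPart B M w) := by
  have hN := h.evenPart_isEvenTwoElem hw hw'
  have h1 : twiceDual B M ≤ twiceDual B (evenPart B M w) := fun y hy x hx => hy x hx.1
  have h2 : (twiceDual B M).toAddSubgroup.relIndex (twiceDual B (evenPart B M w)).toAddSubgroup
      = 2 := by
    refine relIndex_eq_two (a := w) (fun x hx => hx.2) hw' ?_
    intro b hb
    have hb' := mem_twiceDual_iff.1 (show b ∈ twiceDual B (evenPart B M w) from hb)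
    rcases h.mem_or_of_mem_dual_evenPart hw hw' hb' with h3 | h3
    · exact Or.inl (mem_twiceDual_iff.2 h3)
    · exact Or.inr (mem_twiceDual_iff.2 (by rwa [smul_add]))
  have e1 := AddSubgroup.relIndex_mul_relIndex (twiceDual B M).toAddSubgroup
    (twiceDual B (evenPart B M w)).toAddSubgroup (evenPart B M w).toAddSubgroup h1 hN.twiceDual_le
  have e2 := AddSubgroup.relIndex_mul_relIndex (twiceDual B M).toAddSubgroup
    (evenPart B M w).toAddSubgroup M.toAddSubgroup (h1.trans hN.twiceDual_le) evenPart_le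
  rw [h.relIndex_evenPart hw hw', ← e1, h2] at e2
  rw [coIndex, coIndex, ← e2]
  ring

end EvenPart

end IsEvenTwoElem

end Lattice

section Isometry

variable {V : Type} [AddCommGroup V] [Module ℚ V] {V' : Type} [AddCommGroup V'] [Module ℚ V']
  {V'' : Type} [AddCommGroup V''] [Module ℚ V'']

/-- The lattices `M` and `M'` are isometric, through an isometry of the ambient spaces. -/
def LatIsom (B : LinearMap.BilinForm ℚ V) (M : Submodule ℤ V) (B' : LinearMap.BilinForm ℚ V')
    (M' : Submodule ℤ V') : Prop :=
  ∃ φ : V ≃ₗ[ℚ] V', (∀ x y, B' (φ x) (φ y) = B x y) ∧ ∀ x, φ x ∈ M' ↔ x ∈ M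

variable {B : LinearMap.BilinForm ℚ V} {M : Submodule ℤ V} {B' : LinearMap.BilinForm ℚ V'}
    {M' : Submodule ℤ V'} {B'' : LinearMap.BilinForm ℚ V''} {M'' : Submodule ℤ V''}

namespace LatIsom

theorem symm (h : LatIsom B M B' M') : LatIsom B' M' B M := by
  obtain ⟨φ, h1, h2⟩ := h
  refine ⟨φ.symm, fun x y => ?_, fun x => ?_⟩
  · rw [← h1]; simp
  · rw [← h2]; simp

theorem trans (h : LatIsom B M B' M') (h' : LatIsom B' M' B'' M'') : LatIsom B M B'' M'' := by
  obtain ⟨φ, h1, h2⟩ := h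
  obtain ⟨ψ, h3, h4⟩ := h'
  exact ⟨φ.trans ψ, fun x y => by simp [h1, h3], fun x => by simp [h2, h4]⟩

end LatIsom

/-- Transport of a lattice along an isometry of the ambient spaces. -/
theorem mem_dualLat_comap (φ : V ≃ₗ[ℚ] V') (hφ : ∀ x y, B' (φ x) (φ y) = B x y) (y : V) :
    y ∈ dualLat B (M'.comap (φ.toLinearMap.restrictScalars ℤ)) ↔ φ y ∈ dualLat B' M' := by
  constructor
  · intro hy x hx
    have := hy (φ.symm x) (by simpa using hx)
    rwa [← hφ, φ.apply_symm_apply] at this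
  · intro hy x hx
    rw [← hφ]
    exact hy _ hx

theorem IsEvenTwoElem.comap (h : IsEvenTwoElem B' M') (φ : V ≃ₗ[ℚ] V')
    (hφ : ∀ x y, B' (φ x) (φ y) = B x y) :
    IsEvenTwoElem B (M'.comap (φ.toLinearMap.restrictScalars ℤ)) where
  fg := by
    have h1 : M'.comap (φ.toLinearMap.restrictScalars ℤ)
        = M'.map (φ.symm.toLinearMap.restrictScalars ℤ) := by
      ext x
      simp only [Submodule.mem_comap, Submodule.mem_map]
      constructor
      · intro hx
        exact ⟨_, hx, by simp⟩
      · rintro ⟨y, hy, rfl⟩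
        simpa using hy
    rw [h1]
    exact h.fg.map _
  span_eq := by
    have h1 : φ.symm.toLinearMap '' (M' : Set V')
        = (M'.comap (φ.toLinearMap.restrictScalars ℤ) : Set V) := by
      ext x
      simp only [Set.mem_image, SetLike.mem_coe, Submodule.mem_comap]
      constructor
      · rintro ⟨y, hy, rfl⟩
        simpa using hy
      · intro hx
        exact ⟨_, hx, by simp⟩
    rw [← h1, Submodule.span_image, h.span_eq, Submodule.map_top]
    exact LinearEquiv.range _
  symm := fun x y => by rw [← hφ, ← hφ, h.symm]
  even := fun x hx => by
    rw [← hφ]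
    exact h.even _ hx
  add_self_mem := fun y hy => by
    have := h.add_self_mem _ ((mem_dualLat_comap φ hφ y).1 hy)
    simpa using this
  mem_of_dual := fun x hx => by
    refine h.mem_of_dual _ fun y hy => ?_
    have := hx (φ.symm y) ((mem_dualLat_comap φ hφ _).2 (by simpa using hy))
    rwa [← hφ, φ.apply_symm_apply] at this

theorem DualIntegral.comap_iff (φ : V ≃ₗ[ℚ] V')
    (hφ : ∀ x y, B' (φ x) (φ y) = B x y) :
    DualIntegral B (M'.comap (φ.toLinearMap.restrictScalars ℤ)) ↔ DualIntegral B' M' := by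
  constructor
  · intro h y hy
    have := h (φ.symm y) ((mem_dualLat_comap φ hφ _).2 (by simpa using hy))
    rwa [← hφ, φ.apply_symm_apply] at this
  · intro h y hy
    rw [← hφ]
    exact h _ ((mem_dualLat_comap φ hφ y).1 hy)

/-- Two lattices having isometric even parts are isometric to overlattices of the same lattice. -/
theorem exists_comap_evenPart {w : V} {w' : V'} (hw' : w' ∈ M') (hwd : w' ∉ twiceDual B' M')
    (hM' : IsEvenTwoElem B' M')
    (h : LatIsom B (evenPart B M w) B' (evenPart B' M' w')) :
    ∃ (M₂ : Submodule ℤ V) (w₂ : V), IsEvenTwoElem B M₂ ∧ w₂ ∈ M₂ ∧ w₂ ∉ twiceDual B M₂ ∧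
      evenPart B M₂ w₂ = evenPart B M w ∧ (DualIntegral B M₂ ↔ DualIntegral B' M') ∧
      LatIsom B M₂ B' M' ∧ B w₂ w₂ = B' w' w' := by
  obtain ⟨φ, hφ, hm⟩ := h
  refine ⟨M'.comap (φ.toLinearMap.restrictScalars ℤ), φ.symm w', hM'.comap φ hφ, by simpa,
    ?_, ?_, DualIntegral.comap_iff φ hφ, ⟨φ, hφ, fun x => Iff.rfl⟩, ?_⟩
  · rw [mem_twiceDual_iff, mem_dualLat_comap φ hφ, map_smul, φ.apply_symm_apply,
      ← mem_twiceDual_iff]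
    exact hwd
  · ext x
    rw [← hm, mem_evenPart, mem_evenPart, ← hφ, φ.apply_symm_apply]
    rfl
  · rw [← hφ, φ.apply_symm_apply]

end Isometry

section Transvection

variable {V : Type} [AddCommGroup V] [Module ℚ V] {B : LinearMap.BilinForm ℚ V}
  {N : Submodule ℤ V}

/-- Some isometry of the lattice `N` moves `z` into the coset of `z'`. -/
def Moves (B : LinearMap.BilinForm ℚ V) (N : Submodule ℤ V) (z z' : V) : Prop :=
  ∃ s : V ≃ₗ[ℚ] V, (∀ x y, B (s x) (s y) = B x y) ∧ (∀ x, s x ∈ N ↔ x ∈ N) ∧ s z - z' ∈ N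

theorem Moves.trans {z z' z'' : V} (h : Moves B N z z') (h' : Moves B N z' z'') :
    Moves B N z z'' := by
  obtain ⟨s, h1, h2, h3⟩ := h
  obtain ⟨t, h4, h5, h6⟩ := h'
  refine ⟨s.trans t, fun x y => by simp [h1, h4], fun x => by simp [h2, h5], ?_⟩
  have := N.add_mem ((h5 _).2 h3) h6
  simpa using this

theorem IsEvenTwoElem.moves_of_unit (hN : IsEvenTwoElem B N) {z z' w : V} (hz : z ∈ dualLat B N)
    (hzz : IsInt (B z z / 2)) (hz' : z' ∈ dualLat B N)
    (hzz' : ¬ IsInt (B z z')) (hw : w - (z' - z) ∈ N) (hww : B w w = 1) : Moves B N z z' := by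
  have hwd : w ∈ dualLat B N := by
    have := (dualLat B N).add_mem (hN.le_dual hw) ((dualLat B N).sub_mem hz' hz)
    rwa [sub_add_cancel] at this
  have hf : (2 • B w) w = 2 := by simp [hww]
  refine ⟨Module.reflection hf, fun x y => ?_, ?_, ?_⟩
  · simp only [Module.reflection_apply, map_sub, map_smul, LinearMap.sub_apply,
      LinearMap.smul_apply, hww, smul_eq_mul, hN.symm x w, nsmul_eq_mul]
    push_cast
    ring
  · have key : ∀ x ∈ N, Module.reflection hf x ∈ N := by
      intro x hx
      obtain ⟨n, hn⟩ := hN.isInt_dual_left hx hwd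
      rw [Module.reflection_apply]
      refine N.sub_mem hx ?_
      have : (2 • B w) x • w = n • (w + w) := by
        rw [LinearMap.smul_apply, hn, smul_add, ← add_smul, ← Int.cast_smul_eq_zsmul ℚ, two_smul]
        push_cast
        rfl
      rw [this]
      exact N.smul_mem n (hN.add_self_mem w hwd)
    intro x
    refine ⟨fun hx => ?_, key x⟩
    have := key _ hx
    rwa [Module.involutive_reflection hf x] at this
  · obtain ⟨m, hm⟩ : IsInt (B z z) := by
      obtain ⟨m, hm⟩ := hzz
      exact ⟨2 * m, by push_cast; linarith⟩
    obtain ⟨k, hk⟩ := IsInt.exists_half (hN.isInt_two_mul hz hz') hzz'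
    obtain ⟨l, hl⟩ := hN.isInt_dual_left hw hz
    have h1 : B w z = ((l + k - m : ℤ) : ℚ) + 1 / 2 := by
      rw [hN.symm]
      simp only [map_sub] at hl
      push_cast
      linarith
    have h2 : Module.reflection hf z - z' = -(w - (z' - z)) - (l + k - m) • (w + w)
        + ((z + z) - (z' + z')) := by
      rw [Module.reflection_apply, LinearMap.smul_apply, h1, ← Int.cast_smul_eq_zsmul ℚ]
      module
    rw [h2]
    exact N.add_mem (N.sub_mem (N.neg_mem hw) (N.smul_mem _ (hN.add_self_mem w hwd)))
      (N.sub_mem (hN.add_self_mem z hz) (hN.add_self_mem z' hz'))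

theorem IsEvenTwoElem.moves_of_isotropic (hN : IsEvenTwoElem B N) {z z' p q : V}
    (hz : z ∈ dualLat B N) (hzz : IsInt (B z z / 2)) (hz' : z' ∈ dualLat B N)
    (hzz2 : IsInt (B z' z' / 2)) (hzz' : ¬ IsInt (B z z')) (hp : p ∈ N) (hpp : B p p = 0)
    (hq : q ∈ N) (hqq : B q q = 0) (hpq : B p q = 2) (hodd : ¬ IsInt (B p (z' - z) / 2)) :
    Moves B N z z' := by
  have hw0 : z' - z ∈ dualLat B N := (dualLat B N).sub_mem hz' hz
  obtain ⟨k, hk⟩ := IsInt.exists_half (by rw [mul_div_cancel₀ _ two_ne_zero]; exact hw0 p hp) hodd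
  obtain ⟨a, ha⟩ := hzz
  obtain ⟨b, hb⟩ := hzz2
  obtain ⟨c, hc⟩ := IsInt.exists_half (hN.isInt_two_mul hz hz') hzz'
  obtain ⟨d, hd⟩ := hw0 q hq
  have hq' := hN.symm z q
  have hq'' := hN.symm z' q
  have hp' := hN.symm z p
  have hp'' := hN.symm z' p
  have hqp := hN.symm q p
  have hz'z := hN.symm z' z
  refine hN.moves_of_unit (w := (z' - z) - k • q - (a + b - c - 1 - k * d) • p) hz ⟨a, ha⟩ hz'
    hzz' ?_ ?_
  · have : (z' - z) - k • q - (a + b - c - 1 - k * d) • p - (z' - z)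
        = - (k • q) - (a + b - c - 1 - k * d) • p := by abel
    rw [this]
    exact N.sub_mem (N.neg_mem (N.smul_mem _ hq)) (N.smul_mem _ hp)
  · simp only [map_sub, LinearMap.sub_apply, map_zsmul, LinearMap.smul_apply, zsmul_eq_mul] at *
    rw [hqp, hq', hq'', hp', hp'', hz'z, hpp, hqq, hpq, hc]
    have e1 : B z z = 2 * a := by linarith
    have e2 : B z' z' = 2 * b := by linarith
    have e3 : B p z' = 2 * k + 1 + B p z := by linarith
    have e4 : B q z' = d + B q z := by linarith
    rw [e1, e2, e3, e4]
    push_cast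
    ring

theorem IsEvenTwoElem.moves_half (hN : IsEvenTwoElem B N) {p q z : V} (hp : p ∈ N)
    (hpp : B p p = 0) (hp2 : (2⁻¹ : ℚ) • p ∈ dualLat B N) (hq : q ∈ N) (hqq : B q q = 0)
    (hq2 : (2⁻¹ : ℚ) • q ∈ dualLat B N) (hpq : B p q = 2) (hz : z ∈ dualLat B N)
    (hzz : IsInt (B z z / 2)) (hzN : z ∉ N)
    (ht : ∃ t ∈ dualLat B N, IsInt (B t z) ∧ ¬ IsInt (B t t)) :
    Moves B N ((2⁻¹ : ℚ) • q) z := by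
  have hqp : B q p = 2 := by rw [hN.symm, hpq]
  have isotropic_half : ∀ x : V, B x x = 0 → IsInt (B ((2⁻¹ : ℚ) • x) ((2⁻¹ : ℚ) • x) / 2) := by
    intro x hx
    exact ⟨0, by simp [hx]⟩
  -- a coset that pairs to an odd number with `q`
  have hA : ∀ z ∈ dualLat B N, IsInt (B z z / 2) → ¬ IsInt (B q z / 2) →
      Moves B N ((2⁻¹ : ℚ) • q) z := by
    intro z hz hzz hodd
    refine hN.moves_of_isotropic hq2 (isotropic_half q hqq) hz hzz ?_ hq hqq hp hpp hqp ?_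
    · rwa [map_smul, LinearMap.smul_apply, smul_eq_mul, ← div_eq_inv_mul]
    · simpa [hqq] using hodd
  have hA' : ∀ z ∈ dualLat B N, IsInt (B z z / 2) → ¬ IsInt (B p z / 2) →
      Moves B N ((2⁻¹ : ℚ) • p) z := by
    intro z hz hzz hodd
    refine hN.moves_of_isotropic hp2 (isotropic_half p hpp) hz hzz ?_ hp hpp hq hqq hpq ?_
    · rwa [map_smul, LinearMap.smul_apply, smul_eq_mul, ← div_eq_inv_mul]
    · simpa [hpp] using hodd
  have hqp' : Moves B N ((2⁻¹ : ℚ) • q) ((2⁻¹ : ℚ) • p) := by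
    refine hA _ hp2 (isotropic_half p hpp) ?_
    have := IsInt.not_half 0
    simpa [hqp] using this
  have hB : ∀ z ∈ dualLat B N, IsInt (B z z / 2) → ¬ IsInt (B p z / 2) →
      Moves B N ((2⁻¹ : ℚ) • q) z := fun z h1 h2 h3 => hqp'.trans (hA' z h1 h2 h3)
  by_cases hqz : IsInt (B q z / 2)
  swap
  · exact hA z hz hzz hqz
  by_cases hpz : IsInt (B p z / 2)
  swap
  · exact hB z hz hzz hpz
  -- an auxiliary coset
  obtain ⟨κ, hκ, hκz, hκκ⟩ : ∃ κ ∈ dualLat B N, ¬ IsInt (B κ z) ∧ IsInt (B κ κ) := by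
    obtain ⟨g, hg, hgz⟩ : ∃ g ∈ dualLat B N, ¬ IsInt (B g z) := by
      by_contra! hc
      exact hzN (hN.mem_of_dual z hc)
    by_cases hgg : IsInt (B g g)
    · exact ⟨g, hg, hgz, hgg⟩
    obtain ⟨t, ht, htz, htt⟩ := ht
    refine ⟨g + t, (dualLat B N).add_mem hg ht, fun hc => hgz ?_, ?_⟩
    · have := hc.sub htz
      simpa using this
    · have h1 := (IsInt.add_of_half (hN.isInt_two_mul hg hg) hgg (hN.isInt_two_mul ht ht) htt).add
        (hN.isInt_two_mul hg ht)
      have h2 := hN.symm t g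
      convert h1 using 1
      simp only [map_add, LinearMap.add_apply, h2]
      ring
  obtain ⟨a, ha⟩ := hκ q hq
  obtain ⟨b, hb⟩ := hκ p hp
  obtain ⟨c, hc⟩ := hqz
  obtain ⟨d, hd⟩ := hpz
  have hκq := hN.symm κ q
  have hκp := hN.symm κ p
  obtain ⟨ρ, hρ, hρz, hρρ, hρp, hρq⟩ : ∃ ρ ∈ dualLat B N, ¬ IsInt (B ρ z) ∧ IsInt (B ρ ρ) ∧
      B p ρ = 0 ∧ B q ρ = 0 := by
    refine ⟨κ - a • ((2⁻¹ : ℚ) • p) - b • ((2⁻¹ : ℚ) • q), Submodule.sub_mem _ (Submodule.sub_mem _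
      hκ (Submodule.smul_mem _ _ hp2)) (Submodule.smul_mem _ _ hq2), ?_, ?_, ?_, ?_⟩
    · intro h
      refine hκz ?_
      have := h.add (IsInt.intCast (a * d + b * c))
      convert this using 1
      simp only [map_sub, LinearMap.sub_apply, map_zsmul, LinearMap.smul_apply, zsmul_eq_mul,
        map_smul, smul_eq_mul]
      push_cast
      linear_combination (a : ℚ) * hd + b * hc
    · convert hκκ.sub (IsInt.intCast (a * b)) using 1
      simp only [map_sub, LinearMap.sub_apply, map_zsmul, LinearMap.smul_apply, zsmul_eq_mul,
        map_smul, smul_eq_mul, hκq, hκp, hpp, hqq, hpq, hqp, ha, hb]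
      push_cast
      ring
    · simp only [map_sub, map_zsmul, zsmul_eq_mul, map_smul, smul_eq_mul, hpp, hpq, hb]
      ring
    · simp only [map_sub, map_zsmul, zsmul_eq_mul, map_smul, smul_eq_mul, hqq, hqp, ha]
      ring
  have hρp' : B ρ p = 0 := by rw [hN.symm, hρp]
  have hρq' : B ρ q = 0 := by rw [hN.symm, hρq]
  have finish : ∀ σ ∈ dualLat B N, IsInt (B σ σ / 2) → ¬ IsInt (B σ z) → ¬ IsInt (B q σ / 2) →
      Moves B N ((2⁻¹ : ℚ) • q) z := by
    intro σ hσ hσσ hσz hσq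
    refine (hA σ hσ hσσ hσq).trans ?_
    refine hN.moves_of_isotropic hσ hσσ hz hzz hσz hq hqq hp hpp hqp fun h => hσq ?_
    have := (IsInt.intCast c).sub h
    convert this using 1
    rw [map_sub, ← hc]
    ring
  have half1 : ¬ IsInt ((2 : ℚ)⁻¹) := by simpa using IsInt.not_half 0
  obtain ⟨m, hm⟩ := hρρ
  rcases Int.even_or_odd' m with ⟨k, rfl | rfl⟩
  · refine finish (ρ + (2⁻¹ : ℚ) • p) (Submodule.add_mem _ hρ hp2) ?_ ?_ ?_
    · refine ⟨k, ?_⟩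
      simp only [map_add, LinearMap.add_apply, map_smul, LinearMap.smul_apply, smul_eq_mul, hm,
        hρp, hρp', hpp]
      push_cast
      ring
    · intro h
      refine hρz ?_
      convert h.sub (IsInt.intCast d) using 1
      rw [map_add, LinearMap.add_apply, map_smul, LinearMap.smul_apply, smul_eq_mul, ← hd]
      ring
    · simpa [hρq, hqp] using half1
  · refine finish (ρ + (2⁻¹ : ℚ) • p + (2⁻¹ : ℚ) • q) (Submodule.add_mem _ (Submodule.add_mem _
      hρ hp2) hq2) ?_ ?_ ?_
    · refine ⟨k + 1, ?_⟩
      simp only [map_add, LinearMap.add_apply, map_smul, LinearMap.smul_apply, smul_eq_mul, hm,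
        hρp, hρp', hpp, hρq, hρq', hqq, hpq, hqp]
      push_cast
      ring
    · intro h
      refine hρz ?_
      convert (h.sub (IsInt.intCast d)).sub (IsInt.intCast c) using 1
      simp only [map_add, LinearMap.add_apply, map_smul, LinearMap.smul_apply, smul_eq_mul, ← hd,
        ← hc]
      ring
    · simpa [hρq, hqp, hqq] using half1

end Transvection

section Hyperbolic
variable {V : Type} [AddCommGroup V] [Module ℚ V]
/-- The form is hyperbolic: negative definite on the complement of some positive vector. -/
def Hyp (B : LinearMap.BilinForm ℚ V) : Prop :=
  ∃ h, 0 < B h h ∧ ∀ x, B x h = 0 → x ≠ 0 → B x x < 0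
end Hyperbolic

section Metabolic

variable {F : Type} [Field F] {V V' V'' : Type} [AddCommGroup V] [Module F V]
  [AddCommGroup V'] [Module F V'] [AddCommGroup V''] [Module F V'']

/-- The orthogonal sum of two bilinear forms. -/
def orthSum (B : LinearMap.BilinForm F V) (B' : LinearMap.BilinForm F V') :
    LinearMap.BilinForm F (V × V') :=
  B.compl₁₂ (LinearMap.fst F V V') (LinearMap.fst F V V') +
    B'.compl₁₂ (LinearMap.snd F V V') (LinearMap.snd F V V')

@[simp] theorem orthSum_apply (B : LinearMap.BilinForm F V) (B' : LinearMap.BilinForm F V')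
    (x y : V × V') : orthSum B B' x y = B x.1 y.1 + B' x.2 y.2 := rfl

/-- A form is metabolic if it has an isotropic subspace of at least half the dimension. -/
def Metab (B : LinearMap.BilinForm F V) : Prop :=
  ∃ W : Submodule F V, (∀ x ∈ W, ∀ y ∈ W, B x y = 0) ∧
    Module.finrank F V ≤ 2 * Module.finrank F W

/-- A form with trivial (right) radical. -/
def NonDeg (B : LinearMap.BilinForm F V) : Prop := ∀ x, (∀ y, B y x = 0) → x = 0

theorem NonDeg.nondegenerate {B : LinearMap.BilinForm F V} (h : NonDeg B)
    (hs : ∀ x y, B x y = B y x) : B.Nondegenerate :=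
  ⟨fun x hx => h x fun y => by rw [hs]; exact hx y, fun x hx => h x hx⟩

theorem NonDeg.finrank_orthogonal {B : LinearMap.BilinForm F V} [FiniteDimensional F V]
    (h : NonDeg B) (hs : ∀ x y, B x y = B y x) (W : Submodule F V) :
    Module.finrank F W + Module.finrank F (B.orthogonal W) = Module.finrank F V := by
  have := LinearMap.BilinForm.finrank_orthogonal (h.nondegenerate hs) W
  have := Submodule.finrank_le W
  omega

/-- An isotropic subspace of a nondegenerate space has at most half the dimension. -/
theorem NonDeg.two_mul_finrank_le {B : LinearMap.BilinForm F V} [FiniteDimensional F V]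
    (h : NonDeg B) (hs : ∀ x y, B x y = B y x) {W : Submodule F V}
    (hW : ∀ x ∈ W, ∀ y ∈ W, B x y = 0) : 2 * Module.finrank F W ≤ Module.finrank F V := by
  have h1 := h.finrank_orthogonal hs W
  have h2 : W ≤ B.orthogonal W := fun x hx y hy => hW y hy x hx
  have := Submodule.finrank_mono h2
  omega

theorem Metab.even_finrank {B : LinearMap.BilinForm F V} [FiniteDimensional F V]
    (hB : Metab B) (h : NonDeg B) (hs : ∀ x y, B x y = B y x) : Even (Module.finrank F V) := by
  obtain ⟨W, hW, hd⟩ := hB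
  exact ⟨Module.finrank F W, by have := h.two_mul_finrank_le hs hW; omega⟩

theorem finrank_map_add_finrank_inf_ker {U X : Type} [AddCommGroup U] [Module F U]
    [AddCommGroup X] [Module F X] [FiniteDimensional F U] (K : Submodule F U) (g : U →ₗ[F] X) :
    Module.finrank F (K.map g) + Module.finrank F (K ⊓ LinearMap.ker g : Submodule F U) =
      Module.finrank F K := by
  have e2 := LinearMap.finrank_range_add_finrank_ker (g.domRestrict K)
  rwa [LinearMap.range_domRestrict, LinearMap.ker_domRestrict,
    (Submodule.equivSubtypeMap _ _).finrank_eq, Submodule.map_comap_subtype] at e2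

theorem finrank_map_ker_add {U X : Type} [AddCommGroup U] [Module F U] [AddCommGroup X]
    [Module F X] [FiniteDimensional F U] (d : U →ₗ[F] V') (g : U →ₗ[F] X) :
    Module.finrank F ((LinearMap.ker d).map g) +
      Module.finrank F (LinearMap.ker d ⊓ LinearMap.ker g : Submodule F U) +
      Module.finrank F (LinearMap.range d) = Module.finrank F U := by
  have e1 := LinearMap.finrank_range_add_finrank_ker d
  have e2 := finrank_map_add_finrank_inf_ker (LinearMap.ker d) g
  omega

/-- Composition of Lagrangian correspondences. -/
theorem Metab.trans [FiniteDimensional F V] [FiniteDimensional F V'] [FiniteDimensional F V'']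
    {B : LinearMap.BilinForm F V} {B' : LinearMap.BilinForm F V'}
    {B'' : LinearMap.BilinForm F V''} (hs : ∀ x y, B' x y = B' y x) (hn : NonDeg B')
    (h1 : Metab (orthSum B (-B'))) (h2 : Metab (orthSum B' (-B''))) :
    Metab (orthSum B (-B'')) := by
  obtain ⟨W₁, hW₁, hd₁⟩ := h1
  obtain ⟨W₂, hW₂, hd₂⟩ := h2
  simp only [orthSum_apply, LinearMap.neg_apply] at hW₁ hW₂
  let d : W₁ × W₂ →ₗ[F] V' :=
    ((LinearMap.snd F V V').comp (W₁.subtype.comp (LinearMap.fst F W₁ W₂))) -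
      ((LinearMap.fst F V' V'').comp (W₂.subtype.comp (LinearMap.snd F W₁ W₂)))
  have hd : ∀ w, d w = (w.1 : V × V').2 - (w.2 : V' × V'').1 := fun w => rfl
  let g : W₁ × W₂ →ₗ[F] V × V'' :=
    ((LinearMap.fst F V V').comp (W₁.subtype.comp (LinearMap.fst F W₁ W₂))).prod
      ((LinearMap.snd F V' V'').comp (W₂.subtype.comp (LinearMap.snd F W₁ W₂)))
  have hg : ∀ w, g w = ((w.1 : V × V').1, (w.2 : V' × V'').2) := fun w => rfl
  have hK : ∀ w ∈ LinearMap.ker d, (w.1 : V × V').2 = (w.2 : V' × V'').1 := fun w hw =>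
    sub_eq_zero.mp ((hd w).symm.trans hw)
  let Z := LinearMap.ker d ⊓ LinearMap.ker g
  let e : W₁ × W₂ →ₗ[F] V' := (LinearMap.fst F V' V'').comp
    (W₂.subtype.comp (LinearMap.snd F W₁ W₂))
  have he : ∀ z, e z = (z.2 : V' × V'').1 := fun z => rfl
  have hz : ∀ z ∈ Z, (z.1 : V × V') = (0, e z) ∧ (z.2 : V' × V'') = (e z, 0) := by
    intro z hz
    have h3 : g z = 0 := hz.2
    rw [hg, Prod.mk_eq_zero] at h3
    have h4 := hK _ hz.1
    exact ⟨Prod.ext h3.1 h4, Prod.ext rfl h3.2⟩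
  have he_inj : Function.Injective (e.domRestrict Z) := by
    rintro ⟨x, hx⟩ ⟨y, hy⟩ h
    have h : e x = e y := h
    obtain ⟨ha, hb⟩ := hz x hx
    obtain ⟨ha', hb'⟩ := hz y hy
    rw [h] at ha hb
    exact Subtype.ext (Prod.ext (Subtype.ext (ha.trans ha'.symm))
      (Subtype.ext (hb.trans hb'.symm)))
  have horth : LinearMap.range d ≤ B'.orthogonal (LinearMap.range (e.domRestrict Z)) := by
    rintro _ ⟨w, rfl⟩ _ ⟨⟨z, hzZ⟩, rfl⟩
    obtain ⟨ha, hb⟩ := hz z hzZ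
    have h5 := hW₁ _ z.1.2 _ w.1.2
    have h6 := hW₂ _ z.2.2 _ w.2.2
    rw [ha] at h5
    rw [hb] at h6
    simp only [map_zero, LinearMap.zero_apply, neg_zero, add_zero, zero_add,
      neg_eq_zero] at h5 h6
    change B' (e z) (d w) = 0
    rw [hd, map_sub, h5, h6, sub_zero]
  refine ⟨(LinearMap.ker d).map g, ?_, ?_⟩
  · rintro _ ⟨x, hx, rfl⟩ _ ⟨y, hy, rfl⟩
    have h5 := hW₁ _ x.1.2 _ y.1.2
    have h6 := hW₂ _ x.2.2 _ y.2.2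
    rw [hK _ hx, hK _ hy] at h5
    rw [orthSum_apply, LinearMap.neg_apply, LinearMap.neg_apply, hg, hg]
    linear_combination h5 + h6
  · have e1 : _ + Module.finrank F Z + _ = _ := finrank_map_ker_add d g
    have e3 := hn.finrank_orthogonal hs (LinearMap.range (e.domRestrict Z))
    have e4 := Submodule.finrank_mono horth
    have e5 := LinearMap.finrank_range_of_inj he_inj
    simp only [Module.finrank_prod] at *
    omega

theorem Metab.of_isometry [FiniteDimensional F V] {B : LinearMap.BilinForm F V}
    {B' : LinearMap.BilinForm F V'} (φ : V ≃ₗ[F] V') (h : ∀ x y, B' (φ x) (φ y) = B x y) :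
    Metab (orthSum B (-B')) := by
  have hinj : Function.Injective (LinearMap.id.prod φ.toLinearMap : V →ₗ[F] V × V') :=
    fun x y h => (Prod.ext_iff.mp h).1
  refine ⟨LinearMap.range (LinearMap.id.prod φ.toLinearMap), ?_, ?_⟩
  · rintro _ ⟨x, rfl⟩ _ ⟨y, rfl⟩
    simp [h]
  · have : FiniteDimensional F V' := Module.Finite.equiv φ
    rw [LinearMap.finrank_range_of_inj hinj, Module.finrank_prod, φ.finrank_eq]
    omega

theorem Metab.map {B : LinearMap.BilinForm F V} {B' : LinearMap.BilinForm F V'}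
    (hB : Metab B) (φ : V ≃ₗ[F] V') (h : ∀ x y, B' (φ x) (φ y) = B x y) : Metab B' := by
  obtain ⟨W, hW, hd⟩ := hB
  refine ⟨W.map φ.toLinearMap, ?_, ?_⟩
  · rintro _ ⟨x, hx, rfl⟩ _ ⟨y, hy, rfl⟩
    exact (h x y).trans (hW x hx y hy)
  · rw [← φ.finrank_eq]
    exact hd.trans_eq (congrArg _ (LinearEquiv.finrank_map_eq φ W).symm)

theorem Metab.orthSum [FiniteDimensional F V] [FiniteDimensional F V']
    {B : LinearMap.BilinForm F V} {B' : LinearMap.BilinForm F V'}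
    (hB : Metab B) (hB' : Metab B') : Metab (orthSum B B') := by
  obtain ⟨W, hW, hd⟩ := hB
  obtain ⟨W', hW', hd'⟩ := hB'
  refine ⟨LinearMap.range (W.subtype.prodMap W'.subtype), ?_, ?_⟩
  · rintro _ ⟨x, rfl⟩ _ ⟨y, rfl⟩
    simp [hW _ x.1.2 _ y.1.2, hW' _ x.2.2 _ y.2.2]
  · rw [LinearMap.finrank_range_of_inj
      (Prod.map_injective.mpr ⟨W.injective_subtype, W'.injective_subtype⟩),
      Module.finrank_prod, Module.finrank_prod]
    omega

end Metabolic

section WittGroup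

variable {F : Type} [Field F]

theorem Metab.neg {V : Type} [AddCommGroup V] [Module F V] {B : LinearMap.BilinForm F V}
    (hB : Metab B) : Metab (-B) := by
  obtain ⟨W, hW, hd⟩ := hB
  exact ⟨W, fun x hx y hy => by simp [hW x hx y hy], hd⟩

variable (F) in
/-- A regular symmetric bilinear space. -/
structure QSpace where
  V : Type
  [grp : AddCommGroup V]
  [mod : Module F V]
  [fin : FiniteDimensional F V]
  form : LinearMap.BilinForm F V
  symm : ∀ x y, form x y = form y x
  nondeg : NonDeg form

attribute [instance] QSpace.grp QSpace.mod QSpace.fin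

namespace QSpace

/-- Witt equivalence. -/
instance setoid : Setoid (QSpace F) where
  r Q Q' := Metab (orthSum Q.form (-Q'.form))
  iseqv :=
    { refl := fun Q => Metab.of_isometry (LinearEquiv.refl F Q.V) fun _ _ => rfl
      symm := fun {Q Q'} h => (Metab.neg h).map (LinearEquiv.prodComm F Q.V Q'.V) fun x y => by
        simp only [orthSum_apply, LinearMap.neg_apply, LinearEquiv.prodComm_apply, Prod.fst_swap,
          Prod.snd_swap]
        ring
      trans := fun {_ Q' _} h h' => Metab.trans Q'.symm Q'.nondeg h h' }

theorem equiv_of_isometry {Q Q' : QSpace F} (φ : Q.V ≃ₗ[F] Q'.V)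
    (h : ∀ x y, Q'.form (φ x) (φ y) = Q.form x y) : Q ≈ Q' :=
  Metab.of_isometry φ h

/-- Orthogonal sum. -/
def sum (Q Q' : QSpace F) : QSpace F where
  V := Q.V × Q'.V
  form := orthSum Q.form Q'.form
  symm x y := by simp only [orthSum_apply, Q.symm x.1, Q'.symm x.2]
  nondeg x hx := Prod.ext (Q.nondeg _ fun y => by simpa using hx (y, 0))
    (Q'.nondeg _ fun y => by simpa using hx (0, y))

/-- The opposite space. -/
def opp (Q : QSpace F) : QSpace F where
  V := Q.V
  form := -Q.form
  symm x y := by simp only [LinearMap.neg_apply, Q.symm x]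
  nondeg x hx := Q.nondeg _ fun y => by simpa using hx y

/-- The zero space. -/
def triv : QSpace F where
  V := PUnit
  form := 0
  symm _ _ := rfl
  nondeg _ _ := rfl

/-- The line `⟨a⟩`. -/
def line (a : F) (ha : a ≠ 0) : QSpace F where
  V := F
  form := a • LinearMap.mul F F
  symm x y := by simp [mul_comm]
  nondeg x hx := by simpa [ha] using hx 1

theorem equiv_triv_iff {Q : QSpace F} : Q ≈ triv ↔ Metab Q.form := by
  refine ⟨fun h => Metab.map h (LinearEquiv.prodUnique (R := F) (M := Q.V) (M₂ := PUnit)) ?_,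
    fun h => Metab.map h (LinearEquiv.prodUnique (R := F) (M := Q.V) (M₂ := PUnit)).symm ?_⟩
  · intro x y
    change Q.form x.1 y.1 = Q.form x.1 y.1 + -0
    simp
  · intro x y
    change Q.form x y + -0 = Q.form x y
    simp

theorem sum_equiv {Q₁ Q₂ Q₁' Q₂' : QSpace F} (h : Q₁ ≈ Q₁') (h' : Q₂ ≈ Q₂') :
    sum Q₁ Q₂ ≈ sum Q₁' Q₂' := by
  refine (Metab.orthSum h h').map (LinearEquiv.prodProdProdComm F Q₁.V Q₁'.V Q₂.V Q₂'.V) ?_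
  rintro ⟨⟨a, b⟩, ⟨c, d⟩⟩ ⟨⟨a', b'⟩, ⟨c', d'⟩⟩
  change (Q₁.form a a' + Q₂.form c c') + -(Q₁'.form b b' + Q₂'.form d d') =
    (Q₁.form a a' + -Q₁'.form b b') + (Q₂.form c c' + -Q₂'.form d d')
  ring

theorem opp_equiv {Q Q' : QSpace F} (h : Q ≈ Q') : opp Q ≈ opp Q' :=
  (Metab.neg h).map (LinearEquiv.refl F _) fun x y => by
    change -Q.form x.1 y.1 + - -Q'.form x.2 y.2 = -(Q.form x.1 y.1 + -Q'.form x.2 y.2)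
    ring

end QSpace

variable (F) in
/-- The Witt group of `F`. -/
def WittGroup : Type 1 := Quotient (QSpace.setoid (F := F))

namespace WittGroup

instance : Add (WittGroup F) :=
  ⟨Quotient.map₂ QSpace.sum fun _ _ h _ _ h' => QSpace.sum_equiv h h'⟩

instance : Neg (WittGroup F) := ⟨Quotient.map QSpace.opp fun _ _ h => QSpace.opp_equiv h⟩

instance : Zero (WittGroup F) := ⟨Quotient.mk _ QSpace.triv⟩

instance : AddCommGroup (WittGroup F) where
  nsmul := nsmulRec
  zsmul := zsmulRec
  add_assoc := by
    rintro ⟨a⟩ ⟨b⟩ ⟨c⟩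
    refine Quotient.sound (QSpace.equiv_of_isometry (LinearEquiv.prodAssoc F a.V b.V c.V) ?_)
    intro x y
    exact (add_assoc (a.form x.1.1 y.1.1) (b.form x.1.2 y.1.2) (c.form x.2 y.2)).symm
  zero_add := by
    rintro ⟨a⟩
    refine Quotient.sound (QSpace.equiv_of_isometry
      (LinearEquiv.uniqueProd (R := F) (M := a.V) (M₂ := PUnit)) ?_)
    intro x y
    exact (zero_add (a.form x.2 y.2)).symm
  add_zero := by
    rintro ⟨a⟩
    refine Quotient.sound (QSpace.equiv_of_isometry
      (LinearEquiv.prodUnique (R := F) (M := a.V) (M₂ := PUnit)) ?_)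
    intro x y
    exact (add_zero (a.form x.1 y.1)).symm
  add_comm := by
    rintro ⟨a⟩ ⟨b⟩
    refine Quotient.sound (QSpace.equiv_of_isometry (LinearEquiv.prodComm F a.V b.V) ?_)
    intro x y
    exact add_comm (b.form x.2 y.2) (a.form x.1 y.1)
  neg_add_cancel := by
    rintro ⟨a⟩
    refine Quotient.sound (QSpace.equiv_triv_iff.mpr ?_)
    have := Metab.neg (Metab.of_isometry (B := a.form) (LinearEquiv.refl F _) fun _ _ => rfl)
    exact this.map (LinearEquiv.refl F _) fun x y => by
      change -a.form x.1 y.1 + a.form x.2 y.2 = -(a.form x.1 y.1 + -a.form x.2 y.2)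
      ring

/-- The Witt class of a space. -/
def cls (Q : QSpace F) : WittGroup F := Quotient.mk _ Q

theorem cls_sum (Q Q' : QSpace F) : cls (Q.sum Q') = cls Q + cls Q' := rfl
theorem cls_opp (Q : QSpace F) : cls Q.opp = -cls Q := rfl
theorem cls_triv : cls (QSpace.triv (F := F)) = 0 := rfl

theorem cls_eq_zero_iff {Q : QSpace F} : cls Q = 0 ↔ Metab Q.form := by
  rw [← cls_triv, ← QSpace.equiv_triv_iff]
  exact Quotient.eq

theorem cls_eq_of_isometry {Q Q' : QSpace F} (φ : Q.V ≃ₗ[F] Q'.V)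
    (h : ∀ x y, Q'.form (φ x) (φ y) = Q.form x y) : cls Q = cls Q' :=
  Quotient.sound (QSpace.equiv_of_isometry φ h)

open Classical in
/-- The class of the line `⟨a⟩`, with value `0` at `a = 0`. -/
noncomputable def gen (a : F) : WittGroup F := if h : a ≠ 0 then cls (QSpace.line a h) else 0

theorem gen_of_ne {a : F} (h : a ≠ 0) : gen a = cls (QSpace.line a h) := dif_pos h

@[simp] theorem gen_zero : gen (0 : F) = 0 := dif_neg (by simp)

end WittGroup

/-- A function satisfying the defining relations of the Witt group. -/
structure IsWittFun {A : Type*} [AddCommGroup A] (g : F → A) : Prop where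
  zero : g 0 = 0
  mul_sq : ∀ a b, b ≠ 0 → g (a * b ^ 2) = g a
  neg : ∀ a, g (-a) = -g a
  add : ∀ a b, a ≠ 0 → b ≠ 0 → a + b ≠ 0 → g a + g b = g (a + b) + g (a * b * (a + b))

theorem WittGroup.isWittFun : IsWittFun (WittGroup.gen (F := F)) where
  zero := gen_zero
  mul_sq a b hb := by
    rcases eq_or_ne a 0 with rfl | ha
    · simp
    have hab : a * b ^ 2 ≠ 0 := by positivity
    rw [gen_of_ne ha, gen_of_ne hab]
    refine cls_eq_of_isometry (LinearEquiv.smulOfNeZero F F b hb) fun (x y : F) => ?_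
    change a * ((b * x) * (b * y)) = a * b ^ 2 * (x * y)
    ring
  neg a := by
    rcases eq_or_ne a 0 with rfl | ha
    · simp
    have hab : -a ≠ 0 := neg_ne_zero.mpr ha
    rw [gen_of_ne ha, gen_of_ne hab, ← cls_opp]
    refine cls_eq_of_isometry (LinearEquiv.refl F F) fun (x y : F) => ?_
    change -(a * (x * y)) = -a * (x * y)
    ring
  add a b ha hb hab := by
    have hc : a * b * (a + b) ≠ 0 := mul_ne_zero (mul_ne_zero ha hb) hab
    rw [gen_of_ne ha, gen_of_ne hb, gen_of_ne hab, gen_of_ne hc, ← cls_sum, ← cls_sum]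
    symm
    let f : F × F →ₗ[F] F × F :=
      { toFun := fun x => (x.1 - b * x.2, x.1 + a * x.2)
        map_add' := fun x y => Prod.ext (by simp; ring) (by simp; ring)
        map_smul' := fun c x => Prod.ext (by simp; ring) (by simp; ring) }
    let e : (F × F) ≃ₗ[F] F × F := LinearEquiv.ofInjectiveEndo f (by
      refine (injective_iff_map_eq_zero f).mpr fun x hx => ?_
      obtain ⟨h1, h2⟩ : x.1 - b * x.2 = 0 ∧ x.1 + a * x.2 = 0 := Prod.mk_eq_zero.mp hx
      have h3 : (a + b) * x.2 = 0 := by linear_combination h2 - h1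
      have h4 : x.2 = 0 := (mul_eq_zero.mp h3).resolve_left hab
      refine Prod.ext ?_ h4
      rw [h4] at h1
      simpa using h1)
    refine cls_eq_of_isometry e fun (x y : F × F) => ?_
    change a * ((x.1 - b * x.2) * (y.1 - b * y.2)) + b * ((x.1 + a * x.2) * (y.1 + a * y.2)) =
      (a + b) * (x.1 * y.1) + a * b * (a + b) * (x.2 * y.2)
    ring

end WittGroup

section FiniteField

variable {F : Type} [Field F]

theorem IsWittFun.sum_three [Fintype F] (hF : Fintype.card F % 2 = 1) {A : Type*}
    [AddCommGroup A] {g : F → A} (hg : IsWittFun g) {a b c : F} (ha : a ≠ 0) (hb : b ≠ 0)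
    (hc : c ≠ 0) : g a + g b + g c = g (-(a * b * c)) := by
  obtain ⟨x, y, hxy⟩ : ∃ x y : F, a * x ^ 2 + (b * y ^ 2 + c) = 0 := by
    have h1 : (Polynomial.C a * Polynomial.X ^ 2).degree = 2 := by
      rw [Polynomial.degree_C_mul_X_pow 2 ha]; rfl
    have h2 : (Polynomial.C b * Polynomial.X ^ 2 + Polynomial.C c).degree = 2 := by
      rw [Polynomial.degree_add_C] <;> rw [Polynomial.degree_C_mul_X_pow 2 hb]
      · rfl
      · norm_num
    obtain ⟨x, y, h⟩ := FiniteField.exists_root_sum_quadratic h1 h2 hF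
    exact ⟨x, y, by simpa using h⟩
  have key : g a + g b = g (-c) + g (-(a * b * c)) := by
    rcases eq_or_ne x 0 with rfl | hx
    · have hy : y ≠ 0 := by
        rintro rfl
        exact hc (by simpa using hxy)
      have e1 : -c = b * y ^ 2 := by linear_combination -hxy
      have e2 : -(a * b * c) = a * (b * y) ^ 2 := by linear_combination (a * b) * e1
      rw [e1, e2, hg.mul_sq _ _ hy, hg.mul_sq _ _ (mul_ne_zero hb hy), add_comm]
    rcases eq_or_ne y 0 with rfl | hy
    · have e1 : -c = a * x ^ 2 := by linear_combination -hxy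
      have e2 : -(a * b * c) = b * (a * x) ^ 2 := by linear_combination (a * b) * e1
      rw [e1, e2, hg.mul_sq _ _ hx, hg.mul_sq _ _ (mul_ne_zero ha hx)]
    · have e1 : a * x ^ 2 + b * y ^ 2 = -c := by linear_combination hxy
      have h := hg.add (a * x ^ 2) (b * y ^ 2) (mul_ne_zero ha (pow_ne_zero 2 hx))
        (mul_ne_zero hb (pow_ne_zero 2 hy)) (e1 ▸ neg_ne_zero.mpr hc)
      rw [e1, hg.mul_sq _ _ hx, hg.mul_sq _ _ hy,
        show a * x ^ 2 * (b * y ^ 2) * -c = -(a * b * c) * (x * y) ^ 2 by ring,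
        hg.mul_sq _ _ (mul_ne_zero hx hy)] at h
      exact h
  rw [key, hg.neg c]
  abel

theorem IsWittFun.exists_short_list [Fintype F] (hF : Fintype.card F % 2 = 1) (l : List F) :
    (∀ c ∈ l, c ≠ 0) → ∃ l' : List F, (∀ c ∈ l', c ≠ 0) ∧ l'.length ≤ 2 ∧
      ∀ (A : Type 1) [AddCommGroup A] (g : F → A), IsWittFun g →
        (l.map g).sum = (l'.map g).sum := by
  induction l with
  | nil => exact fun h => ⟨[], h, by simp, fun A _ g _ => rfl⟩
  | cons c l ih =>
    intro hl
    obtain ⟨l', h1, h2, h3⟩ := ih fun x hx => hl x (List.mem_cons_of_mem _ hx)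
    have hc := hl c List.mem_cons_self
    rcases Nat.lt_or_ge l'.length 2 with h4 | h4
    · refine ⟨c :: l', ?_, by simp; omega, fun A _ g hg => by simp [h3 A g hg]⟩
      simpa using ⟨hc, h1⟩
    · obtain ⟨a, b, rfl⟩ := List.length_eq_two.mp (le_antisymm h2 h4)
      have ha := h1 a (by simp)
      have hb := h1 b (by simp)
      refine ⟨[-(a * b * c)], by simp [ha, hb, hc], by simp, fun A _ g hg => ?_⟩
      rw [List.map_cons, List.sum_cons, h3 A g hg]
      simp only [List.map_cons, List.map_nil, List.sum_cons, List.sum_nil, add_zero]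
      rw [← hg.sum_three hF ha hb hc]
      abel

/-- A relation between one-dimensional classes over a finite field of odd order is
a consequence of the defining relations of the Witt group. -/
theorem IsWittFun.sum_eq_zero [Fintype F] (hF : Fintype.card F % 2 = 1) {A : Type 1}
    [AddCommGroup A] {g : F → A} (hg : IsWittFun g) {l : List F} (hl : ∀ c ∈ l, c ≠ 0)
    (h0 : (l.map WittGroup.gen).sum = 0) : (l.map g).sum = 0 := by
  obtain ⟨l', h1, h2, h3⟩ := exists_short_list hF l hl
  rw [h3 _ _ WittGroup.isWittFun] at h0
  rw [h3 _ _ hg]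
  rcases l' with _ | ⟨a, _ | ⟨b, _ | ⟨c, l⟩⟩⟩
  · rfl
  · exfalso
    have ha := h1 a (by simp)
    rw [List.map_singleton, List.sum_singleton, WittGroup.gen_of_ne ha,
      WittGroup.cls_eq_zero_iff] at h0
    have := h0.even_finrank (QSpace.line a ha).nondeg (QSpace.line a ha).symm
    change Even (Module.finrank F F) at this
    simp at this
  · have ha := h1 a (by simp)
    have hb := h1 b (by simp)
    rw [List.map_cons, List.map_singleton, List.sum_cons, List.sum_singleton,
      WittGroup.gen_of_ne ha, WittGroup.gen_of_ne hb, ← WittGroup.cls_sum,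
      WittGroup.cls_eq_zero_iff] at h0
    obtain ⟨W, hW, hd⟩ := h0
    change ∀ x : F × F, x ∈ W → ∀ y : F × F, y ∈ W → a * (x.1 * y.1) + b * (x.2 * y.2) = 0 at hW
    change Module.finrank F (F × F) ≤ _ at hd
    have hpos : 0 < Module.finrank F W := by
      simp only [Module.finrank_prod, Module.finrank_self] at hd
      omega
    obtain ⟨⟨w, hw⟩, hw0⟩ := Module.finrank_pos_iff_exists_ne_zero.mp hpos
    obtain ⟨x, y, hxy, h4⟩ : ∃ x y : F, ¬(x = 0 ∧ y = 0) ∧ a * (x * x) + b * (y * y) = 0 :=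
      ⟨w.1, w.2, fun h => hw0 (Subtype.ext (Prod.ext h.1 h.2)), hW _ hw _ hw⟩
    have hx : x ≠ 0 := by
      rintro rfl
      exact hxy ⟨rfl, by simpa [hb] using h4⟩
    have hy : y ≠ 0 := by
      rintro rfl
      exact hxy ⟨by simpa [ha] using h4, rfl⟩
    have h5 : b * y ^ 2 = -a * x ^ 2 := by linear_combination h4
    have h6 : g b = -g a := by
      rw [← hg.mul_sq b y hy, h5, hg.mul_sq _ x hx, hg.neg]
    simp [h6]
  · simp at h2

end FiniteField

section Residue

/-- The nonzero integer `n` has only prime factors less than `p`. -/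
def IsSmooth (p : ℕ) (n : ℤ) : Prop := n ≠ 0 ∧ ∀ q : ℕ, q.Prime → (q : ℤ) ∣ n → q < p

namespace IsSmooth

variable {p : ℕ} {m n : ℤ}

theorem mul (hm : IsSmooth p m) (hn : IsSmooth p n) : IsSmooth p (m * n) :=
  ⟨mul_ne_zero hm.1 hn.1, fun q hq h =>
    ((Nat.prime_iff_prime_int.mp hq).dvd_or_dvd h).elim (hm.2 q hq) (hn.2 q hq)⟩

theorem of_mul_right (h : IsSmooth p (m * n)) : IsSmooth p n :=
  ⟨right_ne_zero_of_mul h.1, fun q hq hd => h.2 q hq (hd.mul_left m)⟩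

theorem of_mul_left (h : IsSmooth p (m * n)) : IsSmooth p m :=
  ⟨left_ne_zero_of_mul h.1, fun q hq hd => h.2 q hq (hd.mul_right n)⟩

theorem of_natAbs_lt (h0 : n ≠ 0) (h : n.natAbs < p) : IsSmooth p n :=
  ⟨h0, fun _ _ hd => (Nat.le_of_dvd (Int.natAbs_pos.mpr h0) (Int.natCast_dvd.mp hd)).trans_lt h⟩

theorem one : IsSmooth p 1 :=
  ⟨one_ne_zero, fun _ hq h => absurd (Int.natCast_dvd.mp h) hq.not_dvd_one⟩

theorem neg_one : IsSmooth p (-1) :=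
  ⟨by norm_num, fun _ hq h => absurd (Int.natCast_dvd.mp h) hq.not_dvd_one⟩

theorem neg (hn : IsSmooth p n) : IsSmooth p (-n) := by
  simpa using neg_one.mul hn

theorem not_dvd [hp : Fact p.Prime] (hn : IsSmooth p n) : ¬ (p : ℤ) ∣ n := fun h =>
  lt_irrefl _ (hn.2 p hp.out h)

theorem cast_ne_zero [hp : Fact p.Prime] (hn : IsSmooth p n) : (n : ZMod p) ≠ 0 := fun h =>
  hn.not_dvd ((ZMod.intCast_zmod_eq_zero_iff_dvd n p).mp h)

end IsSmooth

/-- The subgroup of the Witt group of `ℚ` generated by the classes of smooth integers. -/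
def smoothPart (p : ℕ) : AddSubgroup (WittGroup ℚ) :=
  AddSubgroup.closure {x | ∃ n : ℤ, IsSmooth p n ∧ x = WittGroup.gen (n : ℚ)}

theorem gen_mem_smoothPart {p : ℕ} {n : ℤ} (h : IsSmooth p n) :
    WittGroup.gen (n : ℚ) ∈ smoothPart p :=
  AddSubgroup.subset_closure ⟨n, h, rfl⟩

/-- The class of `⟨p n⟩` modulo smooth classes. -/
noncomputable def resGen (p : ℕ) (n : ℤ) : WittGroup ℚ ⧸ smoothPart p :=
  QuotientAddGroup.mk (WittGroup.gen ((p * n : ℤ) : ℚ))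

theorem resGen_neg (p : ℕ) (n : ℤ) : resGen p (-n) = -resGen p n := by
  unfold resGen
  rw [mul_neg, Int.cast_neg, WittGroup.isWittFun.neg]
  rfl

theorem mk_gen_eq_zero {p : ℕ} {n : ℤ} (h : IsSmooth p n) :
    (QuotientAddGroup.mk (WittGroup.gen (n : ℚ)) : WittGroup ℚ ⧸ smoothPart p) = 0 :=
  (QuotientAddGroup.eq_zero_iff _).mpr (gen_mem_smoothPart h)

section
variable {p : ℕ} [hp : Fact p.Prime]

theorem resGen_mul_mul {n₁ n₂ n s : ℤ} (h₁ : n₁ ≠ 0) (h₂ : n₂ ≠ 0) (h : n ≠ 0)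
    (l₁ : n₁.natAbs < p) (l₂ : n₂.natAbs < p) (l : n.natAbs < p) (hs : IsSmooth p s)
    (hd : (p : ℤ) ∣ n₁ * n₂ - n) : resGen p (n₁ * n₂ * s) = resGen p (n * s) := by
  obtain ⟨m, hm⟩ := hd
  have hp0 : (p : ℚ) ≠ 0 := Nat.cast_ne_zero.mpr hp.out.ne_zero
  rcases eq_or_ne m 0 with rfl | hm0
  · have : n₁ * n₂ = n := by linarith
    rw [this]
  have lm : m.natAbs < p := by
    have e1 : (p * m : ℤ).natAbs ≤ n₁.natAbs * n₂.natAbs + n.natAbs := by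
      rw [← hm, ← Int.natAbs_mul]
      exact Int.natAbs_sub_le _ _
    rw [Int.natAbs_mul, Int.natAbs_natCast] at e1
    have e2 : n₁.natAbs * n₂.natAbs ≤ (p - 1) * (p - 1) :=
      Nat.mul_le_mul (by omega) (by omega)
    obtain ⟨k, rfl⟩ : ∃ k, p = k + 1 := ⟨p - 1, by omega⟩
    simp only [Nat.add_sub_cancel] at e2
    have e3 : n.natAbs ≤ k := by omega
    by_contra! hcon
    have e4 : (k + 1) * (k + 1) ≤ (k + 1) * m.natAbs := Nat.mul_le_mul_left _ hcon
    nlinarith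
  have sm := IsSmooth.of_natAbs_lt hm0 lm
  have hs0 : (s : ℚ) ≠ 0 := Int.cast_ne_zero.mpr hs.1
  have hn0 : (n : ℚ) ≠ 0 := Int.cast_ne_zero.mpr h
  have hm0' : (m : ℚ) ≠ 0 := Int.cast_ne_zero.mpr hm0
  have h₁' : (n₁ : ℚ) ≠ 0 := Int.cast_ne_zero.mpr h₁
  have h₂' : (n₂ : ℚ) ≠ 0 := Int.cast_ne_zero.mpr h₂
  have hmQ : (n₁ : ℚ) * n₂ = n + p * m := by
    have : n₁ * n₂ = n + p * m := by linarith
    exact_mod_cast this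
  have hsum : (p * (n * s) + s * m * p ^ 2 : ℚ) = p * (n₁ * n₂ * s) := by
    rw [hmQ]; ring
  have key := (WittGroup.isWittFun (F := ℚ)).add (p * (n * s)) (s * m * p ^ 2)
    (by positivity) (by positivity) (by rw [hsum]; positivity)
  rw [hsum, WittGroup.isWittFun.mul_sq _ _ hp0,
    show (p * (n * s) * (s * m * p ^ 2) * (p * (n₁ * n₂ * s)) : ℚ) =
      (s * n * m * n₁ * n₂) * (s * p ^ 2) ^ 2 by ring,
    WittGroup.isWittFun.mul_sq _ _ (by positivity)] at key
  have k1 := mk_gen_eq_zero (hs.mul sm)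
  have k2 := mk_gen_eq_zero ((((hs.mul (.of_natAbs_lt h l)).mul sm).mul (.of_natAbs_lt h₁ l₁)).mul
    (.of_natAbs_lt h₂ l₂))
  have k3 := congrArg (QuotientAddGroup.mk (s := smoothPart p)) key
  push_cast at k1 k2
  rw [QuotientAddGroup.mk_add, QuotientAddGroup.mk_add, k1, k2, add_zero, add_zero] at k3
  unfold resGen
  push_cast
  exact k3.symm

theorem resGen_mul_congr (m : ℤ) : ∀ {n s : ℤ}, IsSmooth p m → IsSmooth p s → n.natAbs < p →
    (p : ℤ) ∣ m - n → resGen p (m * s) = resGen p (n * s) := by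
  induction h : m.natAbs using Nat.strong_induction_on generalizing m with
  | _ k ih =>
    intro n s hm hs hn hd
    have hn0 : n ≠ 0 := by
      rintro rfl
      exact hm.not_dvd (by simpa using hd)
    rcases Nat.lt_or_ge m.natAbs p with hlt | hge
    · simpa using resGen_mul_mul hm.1 one_ne_zero hn0 hlt (by simpa using hp.out.one_lt) hn hs
        (by simpa using hd)
    · obtain ⟨q, hq, hqm⟩ := Nat.exists_prime_and_dvd (n := m.natAbs)
        (by have := hp.out.one_lt; omega)
      obtain ⟨m₁, rfl⟩ := Int.natCast_dvd.mpr hqm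
      have hm₁ := hm.of_mul_right
      have hq' := hm.of_mul_left
      have hlt : m₁.natAbs < k := by
        rw [← h, Int.natAbs_mul, Int.natAbs_natCast]
        have := hq.one_lt
        have := Int.natAbs_pos.mpr hm₁.1
        nlinarith
      have hp0 : (0 : ℤ) < p := by exact_mod_cast hp.out.pos
      set n₁ := m₁ % p with hn₁
      have b1 := Int.emod_nonneg m₁ hp0.ne'
      have b2 := Int.emod_lt_of_pos m₁ hp0
      have d1 : (p : ℤ) ∣ m₁ - n₁ := Int.dvd_self_sub_emod
      have hn₁0 : n₁ ≠ 0 := fun h0 => hm₁.not_dvd (by simpa [h0] using d1)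
      have e1 := ih _ hlt m₁ rfl (n := n₁) (s := q * s) hm₁ (hq'.mul hs) (by omega) d1
      have e2 := resGen_mul_mul (n₁ := n₁) (n₂ := q) (n := n) (s := s) hn₁0 hq'.1 hn0 (by omega)
        (by simpa using hq'.2 q hq dvd_rfl) hn hs (by
          have : n₁ * q - n = (q * m₁ - n) - q * (m₁ - n₁) := by ring
          rw [this]
          exact dvd_sub hd (d1.mul_left _))
      rw [show (q : ℤ) * m₁ * s = m₁ * (q * s) by ring, e1, ← e2]
      ring_nf

variable (p) in
/-- The map sending a residue class to the class of `⟨p n⟩`, for any smooth lift `n`. -/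
noncomputable def resFun (c : ZMod p) : WittGroup ℚ ⧸ smoothPart p := resGen p c.val

theorem resFun_intCast {n : ℤ} (hn : IsSmooth p n) : resFun p (n : ZMod p) = resGen p n := by
  have h := resGen_mul_congr n (n := (n : ZMod p).val) (s := 1) hn .one
    (by rw [Int.natAbs_natCast]; exact ZMod.val_lt _)
    ((ZMod.intCast_zmod_eq_zero_iff_dvd _ p).mp (by simp))
  rw [mul_one, mul_one] at h
  exact h.symm

theorem isSmooth_val {c : ZMod p} (hc : c ≠ 0) : IsSmooth p c.val :=
  .of_natAbs_lt (Nat.cast_ne_zero.mpr ((ZMod.val_ne_zero c).mpr hc))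
    (by rw [Int.natAbs_natCast]; exact ZMod.val_lt c)

theorem isWittFun_resFun : IsWittFun (resFun p) where
  zero := by simp [resFun, resGen]
  mul_sq a b hb := by
    rcases eq_or_ne a 0 with rfl | ha
    · simp
    have h := resFun_intCast (((isSmooth_val ha).mul (isSmooth_val hb)).mul (isSmooth_val hb))
    have e : ((a.val * b.val * b.val : ℤ) : ZMod p) = a * b ^ 2 := by
      push_cast
      simp
      ring
    rw [e] at h
    rw [h]
    unfold resFun resGen
    have hb' : (b.val : ℚ) ≠ 0 := Nat.cast_ne_zero.mpr ((ZMod.val_ne_zero b).mpr hb)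
    push_cast
    rw [← WittGroup.isWittFun.mul_sq (p * a.val : ℚ) _ hb',
      show (p * (a.val * b.val * b.val) : ℚ) = p * a.val * b.val ^ 2 by ring]
  neg a := by
    rcases eq_or_ne a 0 with rfl | ha
    · simp [resFun, resGen]
    have h := resFun_intCast (isSmooth_val ha).neg
    have e : ((-a.val : ℤ) : ZMod p) = -a := by simp
    rw [e, resGen_neg] at h
    exact h
  add a b ha hb hab := by
    have hX := isSmooth_val ha
    have hb1 := ZMod.val_lt b
    have ha1 := ZMod.val_lt a
    have hb0 : b.val ≠ 0 := by simpa using hb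
    have ha0 : a.val ≠ 0 := by simpa using ha
    have hY : IsSmooth p (b.val - p) := .of_natAbs_lt (by omega) (by omega)
    have eX : ((a.val : ℤ) : ZMod p) = a := by simp
    have eY : ((b.val - p : ℤ) : ZMod p) = b := by simp
    have eZ : ((a.val + (b.val - p) : ℤ) : ZMod p) = a + b := by simp
    have hZ : IsSmooth p (a.val + (b.val - p)) := .of_natAbs_lt (by
      intro h0
      rw [h0] at eZ
      exact hab (by simpa using eZ.symm)) (by omega)
    have e1 := resFun_intCast hX
    have e2 := resFun_intCast hY
    have e3 := resFun_intCast hZ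
    have e4 := resFun_intCast ((hX.mul hY).mul hZ)
    rw [Int.cast_mul, Int.cast_mul, eX, eY, eZ] at e4
    rw [eX] at e1
    rw [eY] at e2
    rw [eZ] at e3
    rw [e1, e2, e3, e4]
    have hp0 : (p : ℚ) ≠ 0 := Nat.cast_ne_zero.mpr hp.out.ne_zero
    have x0 : ((a.val : ℤ) : ℚ) ≠ 0 := Int.cast_ne_zero.mpr hX.1
    have y0 : ((b.val - p : ℤ) : ℚ) ≠ 0 := Int.cast_ne_zero.mpr hY.1
    have z0 : ((a.val + (b.val - p) : ℤ) : ℚ) ≠ 0 := Int.cast_ne_zero.mpr hZ.1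
    generalize (a.val : ℤ) = X at *
    generalize (b.val - p : ℤ) = Y at *
    rw [Int.cast_add] at z0
    have key := (WittGroup.isWittFun (F := ℚ)).add (p * X) (p * Y) (mul_ne_zero hp0 x0)
      (mul_ne_zero hp0 y0) (by rw [← mul_add]; exact mul_ne_zero hp0 z0)
    rw [← mul_add, show (p * X * (p * Y) * (p * (X + Y)) : ℚ) = p * (X * Y * (X + Y)) * p ^ 2 by
      ring, WittGroup.isWittFun.mul_sq _ _ hp0] at key
    have k3 := congrArg (QuotientAddGroup.mk (s := smoothPart p)) key
    unfold resGen
    push_cast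
    exact k3

theorem sum_gen_mem_smoothPart (hp2 : p ≠ 2) {l : List ℤ} (hl : ∀ u ∈ l, IsSmooth p u)
    (h0 : (l.map fun u : ℤ => WittGroup.gen (u : ZMod p)).sum = 0) :
    (l.map fun u : ℤ => WittGroup.gen ((p * u : ℤ) : ℚ)).sum ∈ smoothPart p := by
  have hF : Fintype.card (ZMod p) % 2 = 1 := by
    rw [ZMod.card]
    exact Nat.odd_iff.mp (hp.out.odd_of_ne_two hp2)
  have h := isWittFun_resFun.sum_eq_zero hF (l := l.map fun u : ℤ => (u : ZMod p)) (by
    simp only [List.mem_map]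
    rintro _ ⟨u, hu, rfl⟩
    exact (hl u hu).cast_ne_zero) (by simpa [Function.comp_def] using h0)
  have e : l.map (resFun p ∘ fun u : ℤ => (u : ZMod p)) = l.map (resGen p) :=
    List.map_congr_left fun u hu => resFun_intCast (hl u hu)
  rw [List.map_map, e] at h
  rw [← QuotientAddGroup.eq_zero_iff, ← h, ← QuotientAddGroup.mk'_apply, map_list_sum,
    List.map_map]
  rfl

end
end Residue

section IntegralForms

/-- An integral symmetric matrix. -/
structure IntForm where
  ι : Type
  [fintype : Fintype ι]
  [decEq : DecidableEq ι]
  gram : Matrix ι ι ℤ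
  symm : ∀ i j, gram i j = gram j i

namespace IntForm

attribute [instance] fintype decEq

/-- The bilinear form of the matrix, over any commutative ring. -/
def bilin (A : IntForm) (R : Type) [CommRing R] : LinearMap.BilinForm R (A.ι → R) :=
  Matrix.toBilin' (A.gram.map (Int.cast : ℤ → R))

theorem bilin_apply (A : IntForm) {R : Type} [CommRing R] (x y : A.ι → R) :
    A.bilin R x y = ∑ i, ∑ j, x i * A.gram i j * y j := by
  simp [bilin, Matrix.toBilin'_apply]

theorem bilin_symm (A : IntForm) {R : Type} [CommRing R] (x y : A.ι → R) :
    A.bilin R x y = A.bilin R y x := by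
  rw [bilin_apply, bilin_apply, Finset.sum_comm]
  refine Finset.sum_congr rfl fun i _ => Finset.sum_congr rfl fun j _ => ?_
  rw [A.symm j i]
  ring

theorem bilin_cast (A : IntForm) {R : Type} [CommRing R] (x y : A.ι → ℤ) :
    A.bilin R (fun i => (x i : R)) (fun i => (y i : R)) = (A.bilin ℤ x y : ℤ) := by
  simp [bilin_apply]

/-- Orthogonal sum. -/
def sum (A B : IntForm) : IntForm where
  ι := A.ι ⊕ B.ι
  gram := Matrix.fromBlocks A.gram 0 0 B.gram
  symm := by
    rintro (i | i) (j | j)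
    · exact A.symm i j
    · rfl
    · rfl
    · exact B.symm i j

/-- Multiplication of the form by an integer. -/
def scale (A : IntForm) (c : ℤ) : IntForm where
  ι := A.ι
  gram := c • A.gram
  symm i j := by simp [A.symm i j]

/-- The zero-dimensional form. -/
def triv : IntForm where
  ι := Empty
  gram := 0
  symm _ _ := rfl

/-- The one-dimensional form. -/
def line (a : ℤ) : IntForm where
  ι := Unit
  gram _ _ := a
  symm _ _ := rfl

/-- The diagonal form. -/
def diag : List ℤ → IntForm
  | [] => triv
  | a :: l => (line a).sum (diag l)

theorem bilin_sum (A B : IntForm) {R : Type} [CommRing R] (x y : A.ι ⊕ B.ι → R) :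
    (A.sum B).bilin R x y = A.bilin R (x ∘ Sum.inl) (y ∘ Sum.inl) +
      B.bilin R (x ∘ Sum.inr) (y ∘ Sum.inr) := by
  refine (bilin_apply (A.sum B) x y).trans ?_
  rw [bilin_apply, bilin_apply]
  change ∑ i : A.ι ⊕ B.ι, ∑ j : A.ι ⊕ B.ι,
    x i * (Matrix.fromBlocks A.gram 0 0 B.gram i j : ℤ) * y j = _
  simp

theorem bilin_scale (A : IntForm) (c : ℤ) {R : Type} [CommRing R] (x y : A.ι → R) :
    (A.scale c).bilin R x y = c * A.bilin R x y := by
  refine (bilin_apply (A.scale c) x y).trans ?_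
  rw [bilin_apply]
  change ∑ i : A.ι, ∑ j : A.ι, x i * ((c • A.gram) i j : ℤ) * y j = _
  simp only [Matrix.smul_apply, smul_eq_mul, Int.cast_mul, Finset.mul_sum]
  refine Finset.sum_congr rfl fun i _ => Finset.sum_congr rfl fun j _ => ?_
  ring

section Field

variable {F : Type} [Field F]

theorem nonDeg_sum {A B : IntForm} (hA : NonDeg (A.bilin F)) (hB : NonDeg (B.bilin F)) :
    NonDeg ((A.sum B).bilin F) := by
  intro (x : A.ι ⊕ B.ι → F) hx
  have h1 : x ∘ Sum.inl = 0 := hA _ fun y => by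
    have := hx (Sum.elim y 0)
    rw [bilin_sum] at this
    simpa using this
  have h2 : x ∘ Sum.inr = 0 := hB _ fun y => by
    have := hx (Sum.elim 0 y)
    rw [bilin_sum] at this
    simpa using this
  funext i
  rcases i with i | i
  · exact congrFun h1 i
  · exact congrFun h2 i

/-- The regular space over a field attached to a matrix. -/
def space (A : IntForm) (h : NonDeg (A.bilin F)) : QSpace F where
  V := A.ι → F
  form := A.bilin F
  symm := A.bilin_symm
  nondeg := h

/-- The Witt class of a matrix. -/
theorem cls_space_sum {A B : IntForm} (hA : NonDeg (A.bilin F)) (hB : NonDeg (B.bilin F))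
    (h : NonDeg ((A.sum B).bilin F)) : WittGroup.cls ((A.sum B).space h) =
      WittGroup.cls (A.space hA) + WittGroup.cls (B.space hB) := by
  rw [← WittGroup.cls_sum]
  exact WittGroup.cls_eq_of_isometry (LinearEquiv.sumArrowLequivProdArrow A.ι B.ι F F)
    fun x y => (bilin_sum A B x y).symm

theorem line_bilin (a : ℤ) (x y : Unit → F) : (line a).bilin F x y = a * (x () * y ()) := by
  refine (bilin_apply (line a) x y).trans ?_
  change ∑ i : Unit, ∑ j : Unit, x i * (a : F) * y j = _
  simp
  ring

theorem nonDeg_line {a : ℤ} (ha : (a : F) ≠ 0) : NonDeg ((line a).bilin F) := by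
  intro (x : Unit → F) hx
  have := (line_bilin a (fun _ => (1 : F)) x).symm.trans (hx _)
  have h0 : x () = 0 := by simpa [ha] using this
  exact funext fun _ => h0

theorem cls_line {a : ℤ} (ha : (a : F) ≠ 0) :
    WittGroup.cls ((line a).space (nonDeg_line ha)) = WittGroup.gen (a : F) := by
  rw [WittGroup.gen_of_ne ha]
  exact WittGroup.cls_eq_of_isometry (LinearEquiv.funUnique Unit F F)
    fun x y => (line_bilin a x y).symm

theorem nonDeg_triv : NonDeg (triv.bilin F) := fun _ _ => funext fun i => nomatch i

theorem nonDeg_diag {l : List ℤ} : (∀ a ∈ l, (a : F) ≠ 0) → NonDeg ((diag l).bilin F) := by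
  induction l with
  | nil => exact fun _ => nonDeg_triv
  | cons a l ih =>
    intro h
    exact nonDeg_sum (nonDeg_line (h a List.mem_cons_self))
      (ih fun b hb => h b (List.mem_cons_of_mem _ hb))

theorem cls_diag {l : List ℤ} (h : ∀ a ∈ l, (a : F) ≠ 0) :
    WittGroup.cls ((diag l).space (nonDeg_diag h)) =
      (l.map fun a : ℤ => WittGroup.gen (a : F)).sum := by
  induction l with
  | nil =>
    refine WittGroup.cls_eq_zero_iff.mpr ⟨⊤, fun x _ y _ => ?_, ?_⟩
    · exact (bilin_apply triv x y).trans (Finset.sum_of_isEmpty (ι := Empty) _)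
    · rw [finrank_top]
      omega
  | cons a l ih =>
    have ha := h a List.mem_cons_self
    have hl : ∀ b ∈ l, (b : F) ≠ 0 := fun b hb => h b (List.mem_cons_of_mem _ hb)
    rw [List.map_cons, List.sum_cons, ← ih hl, ← cls_line ha]
    exact cls_space_sum (nonDeg_line ha) (nonDeg_diag hl) _

end Field
end IntForm

section Reduction

variable {n : Type}

/-- The integer vectors of a rational subspace. -/
def intPoints (W : Submodule ℚ (n → ℚ)) : Submodule ℤ (n → ℤ) where
  carrier := {z | (fun i => (z i : ℚ)) ∈ W}
  zero_mem' := by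
    have : (fun i => (((0 : n → ℤ) i : ℤ) : ℚ)) = 0 := by ext; simp
    exact Set.mem_ofPred_eq ▸ this ▸ W.zero_mem
  add_mem' {a b} ha hb := by
    have : (fun i => (((a + b) i : ℤ) : ℚ)) = (fun i => (a i : ℚ)) + fun i => (b i : ℚ) := by
      ext; simp
    simp only [Set.mem_ofPred_eq, this]
    exact W.add_mem ha hb
  smul_mem' c a ha := by
    have : (fun i => (((c • a) i : ℤ) : ℚ)) = (c : ℚ) • fun i => (a i : ℚ) := by
      ext; simp
    simp only [Set.mem_ofPred_eq, this]
    exact W.smul_mem _ ha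

theorem mem_intPoints {W : Submodule ℚ (n → ℚ)} {z : n → ℤ} :
    z ∈ intPoints W ↔ (fun i => (z i : ℚ)) ∈ W := Iff.rfl

variable [Fintype n] (p : ℕ) [hp : Fact p.Prime]

theorem exists_intPoint (v : n → ℚ) : ∃ (c : ℚˣ) (z : n → ℤ), c • v = fun i => (z i : ℚ) := by
  classical
  have h0 : ((∏ i, (v i).den : ℕ) : ℚ) ≠ 0 :=
    Nat.cast_ne_zero.mpr (Finset.prod_ne_zero_iff.mpr fun i _ => (v i).den_nz)
  refine ⟨Units.mk0 _ h0, fun i => (∏ j ∈ Finset.univ.erase i, (v j).den : ℕ) * (v i).num, ?_⟩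
  funext i
  simp only [Units.smul_def, Units.val_mk0, Pi.smul_apply, smul_eq_mul]
  rw [← Finset.mul_prod_erase _ _ (Finset.mem_univ i)]
  push_cast
  rw [mul_right_comm, mul_comm ((v i).den : ℚ), Rat.mul_den_eq_num]
  ring

theorem finrank_le_finrank_intPoints (W : Submodule ℚ (n → ℚ)) :
    Module.finrank ℚ W ≤ Module.finrank ℤ (intPoints W) := by
  let b := Module.finBasis ℚ W
  choose c z hz using fun j => exists_intPoint (b j : n → ℚ)
  have hmem : ∀ j, z j ∈ intPoints W := fun j => by
    rw [mem_intPoints, ← hz]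
    exact W.smul_mem _ (b j).2
  have hli : LinearIndependent ℚ fun j => c j • b j := b.linearIndependent.units_smul c
  have hli2 : LinearIndependent ℤ fun j => (⟨z j, hmem j⟩ : intPoints W) := by
    rw [Fintype.linearIndependent_iff] at hli ⊢
    intro g hg j
    have h1 := hli (fun j => (g j : ℚ)) ?_ j
    · exact_mod_cast h1
    refine Subtype.ext (funext fun i => ?_)
    have h2 := congrFun (congrArg Subtype.val hg) i
    simp only [AddSubmonoidClass.coe_finsetSum, Submodule.coe_smul, Finset.sum_apply,
      Pi.smul_apply, smul_eq_mul, ZeroMemClass.coe_zero, Pi.zero_apply] at h2 ⊢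
    have h3 : ∀ j, (z j i : ℚ) = ((c j • b j : W) : n → ℚ) i := fun j =>
      (congrFun (hz j) i).symm
    simp only [← h3]
    exact_mod_cast h2
  simpa using hli2.fintype_card_le_finrank

/-- The reduction modulo `p` of a rational subspace. -/
def reduceSub (W : Submodule ℚ (n → ℚ)) : Submodule (ZMod p) (n → ZMod p) :=
  AddSubgroup.toZModSubmodule p ((intPoints W).toAddSubgroup.map
    ((Int.castAddHom (ZMod p)).compLeft n))

theorem finrank_le_finrank_reduceSub (W : Submodule ℚ (n → ℚ)) :
    Module.finrank ℚ W ≤ Module.finrank (ZMod p) (reduceSub p W) := by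
  refine (finrank_le_finrank_intPoints W).trans ?_
  let b := Module.finBasis ℤ (intPoints W)
  have hmem : ∀ j, (fun i => ((b j : n → ℤ) i : ZMod p)) ∈ reduceSub p W := fun j =>
    ⟨_, (b j).2, rfl⟩
  have hli : LinearIndependent (ZMod p) fun j => (⟨_, hmem j⟩ : reduceSub p W) := by
    rw [Fintype.linearIndependent_iff]
    intro g hg j
    choose c hc using fun j => ZMod.intCast_surjective (g j)
    have h2 : ∀ i, (p : ℤ) ∣ (∑ j, c j • (b j : n → ℤ)) i := fun i => by
      rw [← ZMod.intCast_zmod_eq_zero_iff_dvd]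
      have := congrFun (congrArg Subtype.val hg) i
      simp only [AddSubmonoidClass.coe_finsetSum, Submodule.coe_smul, Finset.sum_apply,
        Pi.smul_apply, smul_eq_mul, ZeroMemClass.coe_zero, Pi.zero_apply, ← hc] at this ⊢
      exact_mod_cast this
    choose z hz using h2
    have hz' : ∑ j, c j • (b j : n → ℤ) = (p : ℤ) • z := funext hz
    have hzW : z ∈ intPoints W := by
      have h3 : ∑ j, c j • (b j : n → ℤ) ∈ intPoints W :=
        sum_mem fun j _ => Submodule.smul_mem _ _ (b j).2
      rw [hz', mem_intPoints] at h3
      have h4 := W.smul_mem ((p : ℚ)⁻¹) h3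
      rw [mem_intPoints]
      convert h4 using 1
      have : (p : ℚ) ≠ 0 := Nat.cast_ne_zero.mpr hp.out.ne_zero
      funext i
      simp [this]
    have h5 : ∑ j, c j • b j = (p : ℤ) • (⟨z, hzW⟩ : intPoints W) :=
      Subtype.ext (by simpa using hz')
    have h6 := congrArg (fun v => b.repr v j) h5
    simp only [b.repr_sum_self, map_smul, Finsupp.smul_apply, smul_eq_mul] at h6
    rw [← hc, h6]
    simp
  simpa using hli.fintype_card_le_finrank

/-- The residue of a metabolic form at `p` is metabolic. -/
theorem Metab.residue {A A' : IntForm} (hA : NonDeg (A.bilin (ZMod p)))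
    (h : Metab ((A.sum (A'.scale p)).bilin ℚ)) : Metab (A'.bilin (ZMod p)) := by
  obtain ⟨W, hW, hd⟩ := h
  change Submodule ℚ (A.ι ⊕ A'.ι → ℚ) at W
  have hW' : ∀ z ∈ intPoints W, ∀ w ∈ intPoints W,
      A.bilin ℤ (z ∘ Sum.inl) (w ∘ Sum.inl) + p * A'.bilin ℤ (z ∘ Sum.inr) (w ∘ Sum.inr) = 0 := by
    intro z hz w hw
    have h1 := (IntForm.bilin_cast (A.sum (A'.scale p)) (R := ℚ) z w).symm.trans (hW _ hz _ hw)
    have h2 := IntForm.bilin_sum A (A'.scale p) z w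
    rw [Int.cast_eq_zero.mp h1] at h2
    rw [h2]
    exact congrArg _ (IntForm.bilin_scale A' p (z ∘ Sum.inr) (w ∘ Sum.inr)).symm
  let f : (A.ι ⊕ A'.ι → ZMod p) →ₗ[ZMod p] (A.ι → ZMod p) := LinearMap.funLeft _ _ Sum.inl
  let g : (A.ι ⊕ A'.ι → ZMod p) →ₗ[ZMod p] (A'.ι → ZMod p) := LinearMap.funLeft _ _ Sum.inr
  let I := reduceSub p W
  have e1 := finrank_map_add_finrank_inf_ker I f
  have e2 := finrank_map_add_finrank_inf_ker (I ⊓ LinearMap.ker f) g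
  have hbot : I ⊓ LinearMap.ker f ⊓ LinearMap.ker g = ⊥ := by
    refine eq_bot_iff.mpr fun u hu => funext fun i => ?_
    rcases i with i | i
    · exact congrFun (hu.1.2 : f u = 0) i
    · exact congrFun (hu.2 : g u = 0) i
  rw [hbot, finrank_bot, add_zero] at e2
  have hI : _ ≤ Module.finrank (ZMod p) I := finrank_le_finrank_reduceSub p W
  have e3 : 2 * Module.finrank (ZMod p) (I.map f) ≤
      Module.finrank (ZMod p) (A.ι → ZMod p) := by
    refine hA.two_mul_finrank_le A.bilin_symm ?_
    rintro _ ⟨_, ⟨z, hz, rfl⟩, rfl⟩ _ ⟨_, ⟨w, hw, rfl⟩, rfl⟩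
    have h1 := congrArg (Int.cast : ℤ → ZMod p) (hW' z hz w hw)
    rw [Int.cast_add, Int.cast_mul, Int.cast_natCast, ZMod.natCast_self, zero_mul, add_zero,
      Int.cast_zero, ← IntForm.bilin_cast] at h1
    exact h1
  refine ⟨(I ⊓ LinearMap.ker f).map g, ?_, ?_⟩
  · rintro _ ⟨_, ⟨⟨z, hz, rfl⟩, hz'⟩, rfl⟩ _ ⟨_, ⟨⟨w, hw, rfl⟩, hw'⟩, rfl⟩
    have h1 : ∀ i, (p : ℤ) ∣ z (Sum.inl i) := fun i =>
      (ZMod.intCast_zmod_eq_zero_iff_dvd _ p).mp (congrFun hz' i)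
    have h2 : ∀ i, (p : ℤ) ∣ w (Sum.inl i) := fun i =>
      (ZMod.intCast_zmod_eq_zero_iff_dvd _ p).mp (congrFun hw' i)
    have h3 : (p * p : ℤ) ∣ A.bilin ℤ (z ∘ Sum.inl) (w ∘ Sum.inl) := by
      rw [IntForm.bilin_apply]
      refine Finset.dvd_sum fun i _ => Finset.dvd_sum fun j _ => ?_
      exact mul_dvd_mul ((h1 i).mul_right _) (h2 j)
    have h4 := hW' z hz w hw
    have h5 : (p : ℤ) ∣ A'.bilin ℤ (z ∘ Sum.inr) (w ∘ Sum.inr) := by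
      have : (p * p : ℤ) ∣ p * A'.bilin ℤ (z ∘ Sum.inr) (w ∘ Sum.inr) := by
        rw [← Int.dvd_neg, show -((p : ℤ) * A'.bilin ℤ (z ∘ Sum.inr) (w ∘ Sum.inr)) =
          A.bilin ℤ (z ∘ Sum.inl) (w ∘ Sum.inl) by linarith]
        exact h3
      exact Int.dvd_of_mul_dvd_mul_left (by exact_mod_cast hp.out.ne_zero) this
    rw [← ZMod.intCast_zmod_eq_zero_iff_dvd, ← IntForm.bilin_cast] at h5
    exact h5
  · have e4 : Module.finrank ℚ (A.ι ⊕ A'.ι → ℚ) ≤ 2 * Module.finrank ℚ W := hd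
    simp only [Module.finrank_fintype_fun_eq_card, Fintype.card_sum] at e3 e4 ⊢
    omega

end Reduction
end IntegralForms

section Descent

open WittGroup

theorem exists_list_of_mem_smoothPart {p : ℕ} {x : WittGroup ℚ} (hx : x ∈ smoothPart p) :
    ∃ l : List ℤ, (∀ a ∈ l, IsSmooth p a) ∧ x = (l.map fun a : ℤ => gen (a : ℚ)).sum := by
  induction hx using AddSubgroup.closure_induction with
  | mem x h =>
    obtain ⟨n, hn, rfl⟩ := h
    exact ⟨[n], by simpa using hn, by simp⟩
  | zero => exact ⟨[], by simp, by simp⟩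
  | add x y _ _ ihx ihy =>
    obtain ⟨l, hl, rfl⟩ := ihx
    obtain ⟨l', hl', rfl⟩ := ihy
    refine ⟨l ++ l', fun a ha => ?_, by simp⟩
    exact (List.mem_append.mp ha).elim (hl a) (hl' a)
  | neg x hx ih =>
    clear hx
    obtain ⟨l, hl, rfl⟩ := ih
    refine ⟨l.map Neg.neg, ?_, ?_⟩
    · simp only [List.mem_map]
      rintro _ ⟨a, ha, rfl⟩
      exact (hl a ha).neg
    · clear hl
      induction l with
      | nil => simp
      | cons a l ih =>
        simp only [List.map_cons, List.sum_cons, neg_add, ih, Int.cast_neg, isWittFun.neg]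

theorem list_sum_mem_smoothPart {p : ℕ} {l : List ℤ} (hl : ∀ a ∈ l, IsSmooth p a) :
    (l.map fun a : ℤ => gen (a : ℚ)).sum ∈ smoothPart p := by
  refine AddSubgroup.list_sum_mem _ fun x hx => ?_
  obtain ⟨a, ha, rfl⟩ := List.mem_map.mp hx
  exact gen_mem_smoothPart (hl a ha)

theorem IsSmooth.of_succ_of_not_dvd {p : ℕ} {n : ℤ} (h : IsSmooth (p + 1) n)
    (hd : p.Prime → ¬ (p : ℤ) ∣ n) : IsSmooth p n :=
  ⟨h.1, fun q hq hqn => lt_of_le_of_ne (Nat.lt_succ_iff.mp (h.2 q hq hqn)) (by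
    rintro rfl
    exact hd hq hqn)⟩

theorem smoothPart_succ_le {p : ℕ} (hp : ¬ p.Prime) : smoothPart (p + 1) ≤ smoothPart p := by
  refine (AddSubgroup.closure_le _).mpr ?_
  rintro _ ⟨n, hn, rfl⟩
  exact gen_mem_smoothPart (hn.of_succ_of_not_dvd fun h => absurd h hp)

/-- The class of a `p`-smooth integer is that of `u` or `p u` with `u` prime to `p`. -/
theorem gen_eq_or {p : ℕ} (hp : p.Prime) (n : ℤ) : IsSmooth (p + 1) n →
    ∃ u, IsSmooth p u ∧ (gen (n : ℚ) = gen (u : ℚ) ∨ gen (n : ℚ) = gen ((p * u : ℤ) : ℚ)) := by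
  induction h : n.natAbs using Nat.strong_induction_on generalizing n with
  | _ k ih =>
    intro hn
    by_cases h1 : (p : ℤ) ∣ n
    · obtain ⟨m, rfl⟩ := h1
      by_cases h2 : (p : ℤ) ∣ m
      · obtain ⟨m, rfl⟩ := h2
        have hm := hn.of_mul_right.of_mul_right
        have hp0 : (p : ℚ) ≠ 0 := Nat.cast_ne_zero.mpr hp.ne_zero
        obtain ⟨u, hu, hu'⟩ := ih m.natAbs (by
          rw [← h, Int.natAbs_mul, Int.natAbs_mul, Int.natAbs_natCast]
          have := Int.natAbs_pos.mpr hm.1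
          have := Nat.mul_le_mul hp.two_le (Nat.mul_le_mul hp.two_le (le_refl m.natAbs))
          omega) m rfl hm
        refine ⟨u, hu, ?_⟩
        have e : gen (((p * (p * m) : ℤ)) : ℚ) = gen (m : ℚ) := by
          rw [← isWittFun.mul_sq (m : ℚ) _ hp0]
          congr 1
          push_cast
          ring
        rwa [e]
      · exact ⟨m, hn.of_mul_right.of_succ_of_not_dvd fun _ => h2, Or.inr rfl⟩
    · exact ⟨n, hn.of_succ_of_not_dvd fun _ => h1, Or.inl rfl⟩

theorem exists_lists_of_mem_smoothPart {p : ℕ} (hp : p.Prime) {x : WittGroup ℚ}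
    (hx : x ∈ smoothPart (p + 1)) : ∃ l₀ l₁ : List ℤ, (∀ a ∈ l₀, IsSmooth p a) ∧
      (∀ a ∈ l₁, IsSmooth p a) ∧ x + (l₀.map fun a : ℤ => gen (a : ℚ)).sum +
        (l₁.map fun a : ℤ => gen ((p * a : ℤ) : ℚ)).sum = 0 := by
  obtain ⟨l, hl, hxl⟩ := exists_list_of_mem_smoothPart (neg_mem hx)
  rw [← neg_neg x, hxl]
  clear hxl hx x
  induction l with
  | nil => exact ⟨[], [], by simp, by simp, by simp⟩
  | cons a l ih =>
    obtain ⟨l₀, l₁, h₀, h₁, e⟩ := ih fun b hb => hl b (List.mem_cons_of_mem _ hb)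
    obtain ⟨u, hu, h | h⟩ := gen_eq_or hp a (hl a List.mem_cons_self)
    · refine ⟨u :: l₀, l₁, by simpa using ⟨hu, h₀⟩, h₁, ?_⟩
      rw [← e, List.map_cons, List.sum_cons, List.map_cons, List.sum_cons, h]
      abel
    · refine ⟨l₀, u :: l₁, h₀, by simpa using ⟨hu, h₁⟩, ?_⟩
      rw [← e, List.map_cons, List.sum_cons, List.map_cons, List.sum_cons, h]
      abel

namespace IntForm

variable {F : Type} [Field F]

theorem nonDeg_scale {A : IntForm} {c : ℤ} (hc : (c : F) ≠ 0) (hA : NonDeg (A.bilin F)) :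
    NonDeg ((A.scale c).bilin F) := fun x hx => hA x fun y =>
  (mul_eq_zero.mp ((bilin_scale A c y x).symm.trans (hx y))).resolve_left hc

theorem cls_diag_scale {c : ℤ} (hc : (c : F) ≠ 0) {l : List ℤ} (h : ∀ a ∈ l, (a : F) ≠ 0) :
    cls (((diag l).scale c).space (nonDeg_scale hc (nonDeg_diag h))) =
      (l.map fun a : ℤ => gen ((c * a : ℤ) : F)).sum := by
  induction l with
  | nil =>
    refine cls_eq_zero_iff.mpr ⟨⊤, fun x _ y _ => ?_, ?_⟩
    · exact (bilin_apply (triv.scale c) x y).trans (Finset.sum_of_isEmpty (ι := Empty) _)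
    · rw [finrank_top]
      omega
  | cons a l ih =>
    have ha := h a List.mem_cons_self
    have hl : ∀ b ∈ l, (b : F) ≠ 0 := fun b hb => h b (List.mem_cons_of_mem _ hb)
    have hca : ((c * a : ℤ) : F) ≠ 0 := by
      push_cast
      exact mul_ne_zero hc ha
    rw [List.map_cons, List.sum_cons, ← ih hl, ← cls_line hca, ← cls_sum]
    refine cls_eq_of_isometry (LinearEquiv.sumArrowLequivProdArrow Unit (diag l).ι F F)
      fun (x y : Unit ⊕ (diag l).ι → F) => ?_
    refine Eq.trans ?_ (bilin_scale ((line a).sum (diag l)) c x y).symm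
    refine Eq.trans ?_ (congrArg ((c : F) * ·) (bilin_sum (line a) (diag l) x y)).symm
    refine Eq.trans ?_ (mul_add (c : F) _ _).symm
    refine congrArg₂ (fun s t : F => s + t) ((line_bilin (c * a) _ _).trans ?_)
      (bilin_scale (diag l) c _ _)
    refine Eq.trans ?_ (congrArg ((c : F) * ·) (line_bilin a _ _)).symm
    rw [Int.cast_mul, mul_assoc]
    rfl

theorem card_diag (l : List ℤ) : Fintype.card (diag l).ι = l.length := by
  induction l with
  | nil => rfl
  | cons a l ih =>
    rw [List.length_cons, ← ih, add_comm]
    exact Fintype.card_sum (α := Unit) (β := (diag l).ι)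

end IntForm

theorem sum_gen_two_mem_smoothPart {l : List ℤ} (hl : ∀ u ∈ l, IsSmooth 2 u)
    (h : Even l.length) :
    (l.map fun u : ℤ => gen ((2 * u : ℤ) : ℚ)).sum ∈ smoothPart 2 := by
  have h1 : gen (1 : ℚ) ∈ smoothPart 2 := by
    simpa using gen_mem_smoothPart (IsSmooth.one (p := 2))
  have h2 : gen (2 : ℚ) + gen 2 ∈ smoothPart 2 := by
    have := (isWittFun (F := ℚ)).add 1 1 (by norm_num) (by norm_num) (by norm_num)
    norm_num at this
    rw [← this]
    exact add_mem h1 h1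
  have h3 : ∀ u : ℤ, IsSmooth 2 u → (QuotientAddGroup.mk (gen ((2 * u : ℤ) : ℚ)) :
      WittGroup ℚ ⧸ smoothPart 2) = QuotientAddGroup.mk (gen 2) := by
    intro u hu
    have hu1 : u.natAbs = 1 := by
      by_contra hne
      obtain ⟨q, hq, hqu⟩ := Nat.exists_prime_and_dvd hne
      exact absurd (hu.2 q hq (Int.natCast_dvd.mpr hqu)) (not_lt.mpr hq.two_le)
    rcases Int.natAbs_eq u with h | h <;> rw [hu1] at h <;> subst h
    · norm_num
    · rw [QuotientAddGroup.eq, show ((2 * -((1 : ℕ) : ℤ) : ℤ) : ℚ) = -2 by norm_num,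
        isWittFun.neg, neg_neg]
      exact h2
  obtain ⟨k, hk⟩ := h
  have e : l.map (QuotientAddGroup.mk' (smoothPart 2) ∘ fun u : ℤ => gen ((2 * u : ℤ) : ℚ)) =
      l.map fun _ => (QuotientAddGroup.mk (gen 2) : WittGroup ℚ ⧸ smoothPart 2) :=
    List.map_congr_left fun u hu => h3 u (hl u hu)
  rw [← QuotientAddGroup.eq_zero_iff, ← QuotientAddGroup.mk'_apply, map_list_sum, List.map_map,
    e, List.map_const', List.sum_replicate, hk, ← two_mul, mul_nsmul, two_nsmul,
    ← QuotientAddGroup.mk_add,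
    (QuotientAddGroup.eq_zero_iff _).mpr h2, nsmul_zero]

/-- A form that is regular at `p` has no residue at `p`. -/
theorem mem_smoothPart_of_succ {A : IntForm} (hQ : NonDeg (A.bilin ℚ)) {p : ℕ}
    [hp : Fact p.Prime] (hA : NonDeg (A.bilin (ZMod p)))
    (h : cls (A.space hQ) ∈ smoothPart (p + 1)) : cls (A.space hQ) ∈ smoothPart p := by
  obtain ⟨l₀, l₁, h₀, h₁, e⟩ := exists_lists_of_mem_smoothPart hp.out h
  have hpQ : ((p : ℤ) : ℚ) ≠ 0 := by exact_mod_cast hp.out.ne_zero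
  have h₀Q : ∀ a ∈ l₀, (a : ℚ) ≠ 0 := fun a ha => Int.cast_ne_zero.mpr (h₀ a ha).1
  have h₁Q : ∀ a ∈ l₁, (a : ℚ) ≠ 0 := fun a ha => Int.cast_ne_zero.mpr (h₁ a ha).1
  have h₀p : ∀ a ∈ l₀, (a : ZMod p) ≠ 0 := fun a ha => (h₀ a ha).cast_ne_zero
  have h₁p : ∀ a ∈ l₁, (a : ZMod p) ≠ 0 := fun a ha => (h₁ a ha).cast_ne_zero
  have n₀ := IntForm.nonDeg_sum hQ (IntForm.nonDeg_diag h₀Q)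
  have n₁ := IntForm.nonDeg_scale hpQ (IntForm.nonDeg_diag h₁Q)
  have n := IntForm.nonDeg_sum n₀ n₁
  have hM : Metab (((A.sum (IntForm.diag l₀)).sum ((IntForm.diag l₁).scale p)).bilin ℚ) := by
    refine cls_eq_zero_iff.mp (?_ : cls (IntForm.space _ n) = 0)
    rw [IntForm.cls_space_sum n₀ n₁, IntForm.cls_space_sum hQ (IntForm.nonDeg_diag h₀Q),
      IntForm.cls_diag h₀Q, IntForm.cls_diag_scale hpQ h₁Q, e]
  have hres := hM.residue p (IntForm.nonDeg_sum hA (IntForm.nonDeg_diag h₀p))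
  have hmem : (l₁.map fun a : ℤ => gen ((p * a : ℤ) : ℚ)).sum ∈ smoothPart p := by
    by_cases hp2 : p = 2
    · subst hp2
      refine sum_gen_two_mem_smoothPart h₁ ?_
      have := hres.even_finrank (IntForm.nonDeg_diag h₁p) (IntForm.diag l₁).bilin_symm
      rwa [Module.finrank_fintype_fun_eq_card, IntForm.card_diag] at this
    · refine sum_gen_mem_smoothPart hp2 h₁ ?_
      rw [← IntForm.cls_diag h₁p]
      exact cls_eq_zero_iff.mpr hres
  have e' : cls (A.space hQ) = -((l₀.map fun a : ℤ => gen (a : ℚ)).sum +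
      (l₁.map fun a : ℤ => gen ((p * a : ℤ) : ℚ)).sum) := by
    rw [add_assoc] at e
    exact eq_neg_of_add_eq_zero_left e
  rw [e']
  exact neg_mem (add_mem (list_sum_mem_smoothPart h₀) hmem)

end Descent

section Indefinite

open WittGroup

/-- The space `⟨w₀, …, wₙ₋₁⟩`. -/
noncomputable def QSpace.diagonal {n : ℕ} (w : Fin n → ℚ) (hw : ∀ i, w i ≠ 0) : QSpace ℚ where
  V := Fin n → ℚ
  form := Matrix.toBilin' (Matrix.diagonal w)
  symm x y := by
    simp only [Matrix.toBilin'_apply', Matrix.mulVec_diagonal, dotProduct]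
    exact Finset.sum_congr rfl fun i _ => by ring
  nondeg x hx := by
    ext i
    have := hx (Pi.single i 1)
    rw [Matrix.toBilin'_apply', single_one_dotProduct, Matrix.mulVec_diagonal] at this
    exact (mul_eq_zero.mp this).resolve_left (hw i)

theorem QSpace.diagonal_form {n : ℕ} (w : Fin n → ℚ) (hw : ∀ i, w i ≠ 0) (x y : Fin n → ℚ) :
    (QSpace.diagonal w hw).form x y = ∑ i, w i * (x i * y i) := by
  change Matrix.toBilin' (Matrix.diagonal w) x y = _
  simp only [Matrix.toBilin'_apply', Matrix.mulVec_diagonal, dotProduct]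
  exact Finset.sum_congr rfl fun i _ => by ring

theorem WittGroup.cls_diagonal {n : ℕ} (w : Fin n → ℚ) (hw : ∀ i, w i ≠ 0) :
    cls (QSpace.diagonal w hw) = ∑ i, gen (w i) := by
  induction n with
  | zero =>
    refine cls_eq_zero_iff.mpr ⟨⊤, fun x _ y _ => QSpace.diagonal_form w hw x y, ?_⟩
    rw [finrank_top]
    omega
  | succ n ih =>
    rw [Fin.sum_univ_succ, ← ih (fun i => w i.succ) fun i => hw i.succ, gen_of_ne (hw 0),
      ← cls_sum]
    refine (cls_eq_of_isometry (Fin.consLinearEquiv ℚ (fun _ : Fin (n + 1) => ℚ))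
      fun (x y : ℚ × (Fin n → ℚ)) => ?_).symm
    refine (QSpace.diagonal_form w hw _ _).trans ?_
    rw [Fin.sum_univ_succ]
    exact congrArg (fun s : ℚ => w 0 * (x.1 * y.1) + s)
      (QSpace.diagonal_form _ (fun i : Fin n => hw i.succ) x.2 y.2).symm

theorem gen_eq_gen_int {a : ℚ} (ha : a ≠ 0) :
    ∃ n : ℤ, n ≠ 0 ∧ (gen a : WittGroup ℚ) = gen (n : ℚ) := by
  have hd : (a.den : ℚ) ≠ 0 := Nat.cast_ne_zero.mpr a.den_nz
  refine ⟨a.num * a.den, mul_ne_zero (Rat.num_ne_zero.mpr ha)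
    (Int.natCast_ne_zero.mpr a.den_nz), ?_⟩
  rw [← isWittFun.mul_sq a _ hd]
  congr 1
  push_cast
  nth_rewrite 1 [← Rat.num_div_den a]
  field_simp

theorem exists_cls_mem_smoothPart (Q : QSpace ℚ) : ∃ k, cls Q ∈ smoothPart (k + 2) := by
  have : Invertible (2 : ℚ) := invertibleOfNonzero two_ne_zero
  obtain ⟨v, hv⟩ := LinearMap.BilinForm.exists_orthogonal_basis (B := Q.form) ⟨Q.symm⟩
  have hne : ∀ i, Q.form (v i) (v i) ≠ 0 := fun i hi => v.ne_zero i (Q.nondeg _ fun y => by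
    have : Q.form.flip (v i) = 0 := v.ext fun j => by
      rcases eq_or_ne j i with rfl | h
      · exact hi
      · exact hv h
    exact LinearMap.congr_fun this y)
  have h1 : cls Q = ∑ i, gen (Q.form (v i) (v i)) := by
    rw [← cls_diagonal _ hne]
    refine (cls_eq_of_isometry v.equivFun.symm fun (x y : Fin _ → ℚ) => ?_).symm
    refine Eq.trans ?_ (QSpace.diagonal_form _ hne x y).symm
    have hx (x : Fin _ → ℚ) : v.equivFun.symm x = ∑ i, x i • v i := v.equivFun_symm_apply x
    refine (congrArg₂ (fun s t => Q.form s t) (hx x) (hx y)).trans ?_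
    simp only [map_sum, LinearMap.sum_apply, map_smul, LinearMap.smul_apply, smul_eq_mul]
    refine Finset.sum_congr rfl fun i _ => ?_
    rw [Finset.sum_eq_single i (fun j _ hj => by simp [show Q.form (v j) (v i) = 0 from hv hj])
      (by simp)]
    ring
  choose a ha0 ha using fun i => gen_eq_gen_int (hne i)
  refine ⟨∑ i, (a i).natAbs, ?_⟩
  rw [h1]
  refine sum_mem fun i _ => ?_
  rw [ha i]
  refine gen_mem_smoothPart (IsSmooth.of_natAbs_lt (ha0 i) ?_)
  have := Finset.single_le_sum (f := fun i => (a i).natAbs) (fun _ _ => Nat.zero_le _)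
    (Finset.mem_univ i)
  refine Nat.lt_succ_of_le (this.trans (Nat.le_succ _))

theorem mem_smoothPart_two {A : IntForm} (hQ : NonDeg (A.bilin ℚ))
    (hA : ∀ (p : ℕ) [Fact p.Prime], NonDeg (A.bilin (ZMod p))) :
    cls (A.space hQ) ∈ smoothPart 2 := by
  obtain ⟨k, hk⟩ := exists_cls_mem_smoothPart (A.space hQ)
  induction k with
  | zero => exact hk
  | succ k ih =>
    by_cases hp : (k + 2).Prime
    · have := Fact.mk hp
      exact ih (mem_smoothPart_of_succ hQ (hA _) hk)
    · exact ih (smoothPart_succ_le hp hk)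

theorem IsSmooth.eq_one_or_of_two {u : ℤ} (hu : IsSmooth 2 u) : u = 1 ∨ u = -1 := by
  refine Int.natAbs_eq_natAbs_iff.mp (?_ : u.natAbs = 1)
  by_contra hne
  obtain ⟨q, hq, hqu⟩ := Nat.exists_prime_and_dvd hne
  exact absurd (hu.2 q hq (Int.natCast_dvd.mpr hqu)) (not_lt.mpr hq.two_le)

theorem exists_zsmul_of_mem_smoothPart_two {x : WittGroup ℚ} (hx : x ∈ smoothPart 2) :
    ∃ z : ℤ, x = z • gen 1 := by
  obtain ⟨l, hl, rfl⟩ := exists_list_of_mem_smoothPart hx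
  clear hx
  induction l with
  | nil => exact ⟨0, by simp⟩
  | cons a l ih =>
    obtain ⟨z, hz⟩ := ih fun b hb => hl b (List.mem_cons_of_mem _ hb)
    rw [List.map_cons, List.sum_cons, hz]
    rcases (hl a List.mem_cons_self).eq_one_or_of_two with rfl | rfl
    · exact ⟨1 + z, by rw [add_zsmul, one_zsmul, Int.cast_one]⟩
    · exact ⟨-1 + z, by rw [add_zsmul, neg_one_zsmul, Int.cast_neg, Int.cast_one, isWittFun.neg]⟩

theorem exists_metab_sum_diag {A : IntForm} (hQ : NonDeg (A.bilin ℚ))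
    (hA : ∀ (p : ℕ) [Fact p.Prime], NonDeg (A.bilin (ZMod p))) :
    ∃ (e : ℤ) (m : ℕ), (e = 1 ∨ e = -1) ∧
      Metab ((A.sum (IntForm.diag (List.replicate m e))).bilin ℚ) := by
  obtain ⟨z, hz⟩ := exists_zsmul_of_mem_smoothPart_two (mem_smoothPart_two hQ hA)
  have key : ∀ (e : ℤ) (m : ℕ), e ≠ 0 → cls (A.space hQ) + m • gen (e : ℚ) = 0 →
      Metab ((A.sum (IntForm.diag (List.replicate m e))).bilin ℚ) := by
    intro e m he h
    have hl : ∀ a ∈ List.replicate m e, (a : ℚ) ≠ 0 := fun a ha => by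
      rw [List.eq_of_mem_replicate ha]
      exact_mod_cast he
    refine cls_eq_zero_iff.mp
      (?_ : cls (IntForm.space _ (IntForm.nonDeg_sum hQ (IntForm.nonDeg_diag hl))) = 0)
    rw [IntForm.cls_space_sum hQ (IntForm.nonDeg_diag hl), IntForm.cls_diag hl,
      List.map_replicate, List.sum_replicate, h]
  obtain ⟨m, rfl | rfl⟩ := z.eq_nat_or_neg
  · refine ⟨-1, m, Or.inr rfl, key _ _ (by norm_num) ?_⟩
    rw [hz, Int.cast_neg, Int.cast_one, isWittFun.neg, natCast_zsmul, ← nsmul_add,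
      add_neg_cancel, nsmul_zero]
  · refine ⟨1, m, Or.inl rfl, key _ _ one_ne_zero ?_⟩
    rw [hz, Int.cast_one, neg_zsmul, natCast_zsmul, neg_add_cancel]

theorem IntForm.diag_replicate_pos {e : ℤ} (he : e = 1 ∨ e = -1) (m : ℕ)
    (x : (diag (List.replicate m e)).ι → ℚ) :
    0 ≤ e * (diag (List.replicate m e)).bilin ℚ x x ∧
      ((diag (List.replicate m e)).bilin ℚ x x = 0 → x = 0) := by
  induction m with
  | zero =>
    refine ⟨?_, fun _ => funext fun i => nomatch (i : Empty)⟩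
    have hx : x = 0 := funext fun i => nomatch (i : Empty)
    rw [hx, map_zero, mul_zero]
  | succ m ih =>
    have h1 : (diag (List.replicate (m + 1) e)).bilin ℚ x x = e * (x (Sum.inl ()) * x (Sum.inl ()))
        + (diag (List.replicate m e)).bilin ℚ (fun i => x (Sum.inr i)) (fun i => x (Sum.inr i)) :=
      (bilin_sum (line e) (diag (List.replicate m e)) x x).trans
        (congrArg (· + _) (line_bilin e _ _))
    obtain ⟨h2, h3⟩ := ih fun i => x (Sum.inr i)
    have hee : (e : ℚ) * e = 1 := by rcases he with rfl | rfl <;> norm_num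
    have h4 : (e : ℚ) * (diag (List.replicate (m + 1) e)).bilin ℚ x x =
        x (Sum.inl ()) * x (Sum.inl ()) + e * (diag (List.replicate m e)).bilin ℚ
          (fun i => x (Sum.inr i)) (fun i => x (Sum.inr i)) := by
      rw [h1, mul_add, ← mul_assoc, hee, one_mul]
    have h5 := mul_self_nonneg (x (Sum.inl ()))
    refine ⟨by rw [h4]; exact add_nonneg h5 h2, fun h0 => ?_⟩
    rw [h0, mul_zero] at h4
    have h6 : x (Sum.inl ()) = 0 := mul_self_eq_zero.mp (by linarith)
    rw [h0, h6, mul_zero, mul_zero, zero_add] at h1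
    have h7 := h3 h1.symm
    refine funext fun (i : Unit ⊕ (diag (List.replicate m e)).ι) => ?_
    exact i.rec (fun _ => h6) fun j => congrFun h7 j

/-- An indefinite form regular at every prime is isotropic. -/
theorem IntForm.exists_isotropic {A : IntForm} (hQ : NonDeg (A.bilin ℚ))
    (hA : ∀ (p : ℕ) [Fact p.Prime], NonDeg (A.bilin (ZMod p))) {v w : A.ι → ℚ}
    (hv : 0 < A.bilin ℚ v v) (hw : A.bilin ℚ w w < 0) : ∃ x, x ≠ 0 ∧ A.bilin ℚ x x = 0 := by
  by_contra! hani
  obtain ⟨e, m, he, hmet⟩ := exists_metab_sum_diag hQ hA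
  let D := diag (List.replicate m e)
  obtain ⟨W, hW, hd⟩ : ∃ W : Submodule ℚ (A.ι ⊕ D.ι → ℚ),
      (∀ x ∈ W, ∀ y ∈ W, (A.sum D).bilin ℚ x y = 0) ∧
        Module.finrank ℚ (A.ι ⊕ D.ι → ℚ) ≤ 2 * Module.finrank ℚ W := hmet
  let p₁ : (A.ι ⊕ D.ι → ℚ) →ₗ[ℚ] A.ι → ℚ := LinearMap.funLeft ℚ ℚ Sum.inl
  let p₂ : (A.ι ⊕ D.ι → ℚ) →ₗ[ℚ] D.ι → ℚ := LinearMap.funLeft ℚ ℚ Sum.inr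
  have hsum : ∀ x ∈ W, A.bilin ℚ (p₁ x) (p₁ x) + D.bilin ℚ (p₂ x) (p₂ x) = 0 := fun x hx =>
    (bilin_sum A D x x).symm.trans (hW x hx x hx)
  have hinj : ∀ x : A.ι ⊕ D.ι → ℚ, p₁ x = 0 → p₂ x = 0 → x = 0 := fun x h1 h2 =>
    funext fun i => i.rec (fun j => congrFun h1 j) fun j => congrFun h2 j
  have k₁ : W ⊓ LinearMap.ker p₁ = ⊥ := (Submodule.eq_bot_iff _).mpr fun x ⟨hx, h1⟩ => by
    have h1 : p₁ x = 0 := h1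
    have := hsum x hx
    rw [h1, map_zero, zero_add] at this
    exact hinj x h1 ((diag_replicate_pos he m _).2 this)
  have k₂ : W ⊓ LinearMap.ker p₂ = ⊥ := (Submodule.eq_bot_iff _).mpr fun x ⟨hx, h2⟩ => by
    have h2 : p₂ x = 0 := h2
    have := hsum x hx
    rw [h2, map_zero, add_zero] at this
    exact hinj x (by_contra fun h => hani _ h this) h2
  have e₁ := finrank_map_add_finrank_inf_ker W p₁
  have e₂ := finrank_map_add_finrank_inf_ker W p₂
  have b₁ := (W.map p₁).finrank_le
  have b₂ := (W.map p₂).finrank_le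
  rw [k₁, finrank_bot] at e₁
  rw [k₂, finrank_bot] at e₂
  rw [Module.finrank_fintype_fun_eq_card] at hd b₁ b₂
  rw [Fintype.card_sum] at hd
  have htop : W.map p₁ = ⊤ := Submodule.eq_top_of_finrank_eq (by
    rw [Module.finrank_fintype_fun_eq_card]
    omega)
  have hsign : ∀ u, (e : ℚ) * A.bilin ℚ u u ≤ 0 := by
    intro u
    obtain ⟨x, hx, rfl⟩ : u ∈ W.map p₁ := htop ▸ Submodule.mem_top
    have h1 := hsum x hx
    have h2 := (diag_replicate_pos he m (p₂ x)).1
    have h3 : A.bilin ℚ (p₁ x) (p₁ x) = -D.bilin ℚ (p₂ x) (p₂ x) := eq_neg_of_add_eq_zero_left h1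
    rw [h3, mul_neg]
    exact neg_nonpos.mpr h2
  have sv := hsign v
  have sw := hsign w
  rcases he with rfl | rfl
  · norm_num at sv
    linarith
  · norm_num at sw
    linarith

end Indefinite

section Isotropy

variable {V : Type} [AddCommGroup V] [Module ℚ V] {B : LinearMap.BilinForm ℚ V}
  {M : Submodule ℤ V}

theorem IntForm.bilin_apply_single (A : IntForm) {R : Type} [CommRing R] (i : A.ι) (x : A.ι → R) :
    A.bilin R (Pi.single i 1) x = (A.gram.map (Int.cast : ℤ → R)).mulVec x i := by
  rw [bilin, Matrix.toBilin'_apply', single_one_dotProduct]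

theorem IntForm.nonDeg_of_mul_eq_one (A : IntForm) {C : Matrix A.ι A.ι ℤ} (h : A.gram * C = 1)
    (F : Type) [Field F] : NonDeg (A.bilin F) := fun x hx => by
  have h1 : (A.gram.map (Int.cast : ℤ → F)).mulVec x = 0 :=
    funext fun i => (A.bilin_apply_single i x).symm.trans (hx _)
  have h2 : C.map (Int.cast : ℤ → F) * A.gram.map (Int.cast : ℤ → F) = 1 := by
    have := congrArg (fun N : Matrix A.ι A.ι ℤ => N.map (Int.castRingHom F))
      (mul_eq_one_comm.mp h)
    simp only [Matrix.map_mul, Matrix.map_one, map_zero, map_one] at this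
    exact this
  rw [← Matrix.one_mulVec x, ← h2, ← Matrix.mulVec_mulVec, h1, Matrix.mulVec_zero]

theorem Hyp.nonDeg (hyp : Hyp B) (hs : ∀ x y, B x y = B y x) : NonDeg B := fun x hx => by
  obtain ⟨h, hh, hneg⟩ := hyp
  by_contra hx0
  exact (hneg x ((hs x h).trans (hx h)) hx0).ne (hx x)

theorem Hyp.exists_neg [FiniteDimensional ℚ V] (hyp : Hyp B) (hn : 2 ≤ Module.finrank ℚ V) :
    ∃ w, B w w < 0 := by
  obtain ⟨h, hh, hneg⟩ := hyp
  have hk : LinearMap.ker (B.flip h) ≠ ⊥ := LinearMap.ker_ne_bot_of_finrank_lt (by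
    rw [Module.finrank_self]
    omega)
  obtain ⟨x, hx, hx0⟩ := Submodule.exists_mem_ne_zero_of_ne_bot hk
  exact ⟨x, hneg x hx hx0⟩

namespace IsEvenTwoElem

theorem isLattice (h : IsEvenTwoElem B M) : Submodule.IsLattice ℚ M := ⟨h.fg, h.span_eq⟩

theorem free (h : IsEvenTwoElem B M) : Module.Free ℤ M := by
  have := h.isLattice
  exact Submodule.IsLattice.free ℚ M

theorem exists_isotropic_of_le [FiniteDimensional ℚ V] (hM : IsEvenTwoElem B M)
    (hle : M ≤ twiceDual B M) (hyp : Hyp B) (hn : 2 ≤ Module.finrank ℚ V) :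
    ∃ x, x ≠ 0 ∧ B x x = 0 := by
  have := hM.isLattice
  have := hM.free
  have : Module.Finite ℤ M := Module.Finite.iff_fg.2 hM.fg
  let b₀ := Module.Free.chooseBasis ℤ M
  let b := b₀.extendOfIsLattice ℚ
  have hb : ∀ i, b i = b₀ i := b₀.extendOfIsLattice_apply ℚ
  have hbM : ∀ i, b i ∈ M := fun i => hb i ▸ (b₀ i).2
  have hrepr : ∀ (x : M) i, b.repr x i = b₀.repr x i := by
    intro x i
    have h1 : (x : V) = ∑ i, (b₀.repr x i : ℚ) • b i := by
      conv_lhs => rw [← b₀.sum_repr x]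
      simp only [hb, Submodule.coe_sum, Submodule.coe_smul, Int.cast_smul_eq_zsmul]
    rw [h1, b.repr_sum_self]
  have hB := (hyp.nonDeg hM.symm).nondegenerate hM.symm
  choose a ha using fun i j => hle (hbM j) (b i) (hbM i)
  have hd : ∀ j, (2 : ℚ) • B.dualBasis hB b j ∈ M := fun j => by
    refine hM.twiceDual_le fun x hx => ⟨b₀.repr ⟨x, hx⟩ j, ?_⟩
    rw [map_smul, smul_eq_mul, mul_div_cancel_left₀ _ two_ne_zero, hM.symm,
      ← hrepr ⟨x, hx⟩, hM.symm, ← LinearMap.BilinForm.dualBasis_repr_apply hB,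
      LinearMap.BilinForm.dualBasis_dualBasis hB ⟨hM.symm⟩]
  let A : IntForm :=
    { ι := Module.Free.ChooseBasisIndex ℤ M
      decEq := inferInstance
      gram := Matrix.of a
      symm := fun i j => by
        have := (ha i j).symm.trans ((congrArg (· / 2) (hM.symm _ _)).trans (ha j i))
        exact_mod_cast this }
  have hA : ∀ x y, A.bilin ℚ x y = B (b.equivFun.symm x) (b.equivFun.symm y) / 2 := by
    intro x y
    rw [IntForm.bilin_apply, b.equivFun_symm_apply, b.equivFun_symm_apply]
    simp only [map_sum, LinearMap.sum_apply, map_smul, LinearMap.smul_apply, smul_eq_mul]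
    rw [Finset.sum_comm, Finset.sum_div]
    refine Finset.sum_congr rfl fun j _ => ?_
    rw [Finset.mul_sum, Finset.sum_div]
    refine Finset.sum_congr rfl fun i _ => ?_
    change x i * (a i j : ℚ) * y j = _
    rw [← ha]
    ring
  have hinv : A.gram * Matrix.of (fun k j => b₀.repr ⟨_, hd j⟩ k) = 1 := by
    ext i j
    have h1 : ((∑ k, a i k * b₀.repr ⟨_, hd j⟩ k : ℤ) : ℚ) = if i = j then 1 else 0 := by
      have h2 := (congrArg (B (b i)) (b.sum_repr ((2 : ℚ) • B.dualBasis hB b j))).trans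
        (map_smul (B (b i)) _ _)
      rw [LinearMap.BilinForm.apply_dualBasis_right hB ⟨hM.symm⟩, map_sum, smul_eq_mul] at h2
      push_cast
      rw [← mul_right_inj' (two_ne_zero (α := ℚ)), ← h2, Finset.mul_sum]
      refine Finset.sum_congr rfl fun k _ => ?_
      rw [← ha, (B (b i)).map_smul, smul_eq_mul, hrepr ⟨_, hd j⟩]
      ring
    rw [Matrix.mul_apply, Matrix.one_apply]
    refine Int.cast_injective (α := ℚ) (h1.trans ?_)
    split_ifs <;> simp
  have hnd := A.nonDeg_of_mul_eq_one hinv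
  obtain ⟨w, hw⟩ := hyp.exists_neg hn
  obtain ⟨v, hv, -⟩ := hyp
  obtain ⟨x, hx0, hx⟩ := IntForm.exists_isotropic (A := A) (hnd ℚ) (fun p _ => hnd (ZMod p))
    (v := b.equivFun v) (w := b.equivFun w) (by simpa [hA] using hv) (by
      rw [hA, LinearEquiv.symm_apply_apply]
      linarith)
  refine ⟨b.equivFun.symm x, fun h => hx0 ((LinearEquiv.map_eq_zero_iff _).mp h), ?_⟩
  rw [hA] at hx
  linarith

/-- A hyperbolic even 2-elementary lattice of rank at least two has an isotropic vector. -/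
theorem exists_isotropic [FiniteDimensional ℚ V] (hM : IsEvenTwoElem B M) (hyp : Hyp B)
    (hc : coIndex B M ≠ 0) (hn : 2 ≤ Module.finrank ℚ V) : ∃ x, x ≠ 0 ∧ B x x = 0 := by
  induction h : coIndex B M using Nat.strong_induction_on generalizing M with
  | _ k ih =>
    by_cases h1 : coIndex B M = 1
    · exact hM.exists_isotropic_of_le (AddSubgroup.relIndex_eq_one.mp h1) hyp hn
    · obtain ⟨w, hw, hw'⟩ := exists_notMem_twiceDual h1
      have h4 := hM.coIndex_eq_four_mul hw hw'
      exact ih _ (by omega) (hM.evenPart_isEvenTwoElem hw hw') (by omega) rfl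

end IsEvenTwoElem

end Isotropy

section Split

variable {V : Type} [AddCommGroup V] [Module ℚ V] {B : LinearMap.BilinForm ℚ V}
  {M : Submodule ℤ V}

namespace IsEvenTwoElem

theorem exists_zsmul_mem (h : IsEvenTwoElem B M) (x : V) : ∃ n : ℤ, n ≠ 0 ∧ n • x ∈ M := by
  have hx : x ∈ Submodule.span ℚ (M : Set V) := by rw [h.span_eq]; trivial
  induction hx using Submodule.span_induction with
  | mem x hx => exact ⟨1, one_ne_zero, by simpa using hx⟩
  | zero => exact ⟨1, one_ne_zero, by simp⟩
  | add x y _ _ hx hy =>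
    obtain ⟨n, hn, hx⟩ := hx
    obtain ⟨m, hm, hy⟩ := hy
    refine ⟨m * n, mul_ne_zero hm hn, ?_⟩
    have e : (m * n) • (x + y) = m • (n • x) + n • (m • y) := by module
    rw [e]
    exact M.add_mem (M.smul_mem _ hx) (M.smul_mem _ hy)
  | smul q x _ hx =>
    obtain ⟨n, hn, hx⟩ := hx
    refine ⟨q.den * n, mul_ne_zero (by exact_mod_cast q.den_nz) hn, ?_⟩
    have e : ((q.den : ℤ) * n) • (q • x) = q.num • (n • x) := by
      rw [← Int.cast_smul_eq_zsmul ℚ, ← Int.cast_smul_eq_zsmul ℚ, ← Int.cast_smul_eq_zsmul ℚ,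
        smul_smul, smul_smul]
      congr 1
      have := Rat.mul_den_eq_num q
      push_cast
      linear_combination (n : ℚ) * this
    rw [e]
    exact M.smul_mem _ hx

theorem exists_primitive_isotropic (h : IsEvenTwoElem B M) (hyp : Hyp B) {e : V} (he : e ≠ 0)
    (hee : B e e = 0) :
    ∃ e₁ ∈ dualLat B M, B e₁ e₁ = 0 ∧ ∃ f ∈ M, B e₁ f = 1 := by
  obtain ⟨n, hn, hne⟩ := h.exists_zsmul_mem e
  let H : AddSubgroup ℤ :=
    { carrier := {k | ∃ x ∈ M, B (n • e) x = k}
      zero_mem' := ⟨0, M.zero_mem, by simp⟩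
      add_mem' := by
        rintro a b ⟨x, hx, hxa⟩ ⟨y, hy, hyb⟩
        exact ⟨x + y, M.add_mem hx hy, by rw [map_add, hxa, hyb]; push_cast; rfl⟩
      neg_mem' := by
        rintro a ⟨x, hx, hxa⟩
        exact ⟨-x, M.neg_mem hx, by rw [map_neg, hxa]; push_cast; rfl⟩ }
  obtain ⟨k, hk⟩ := Int.subgroup_cyclic H
  have hkH : k ∈ H := by rw [hk]; exact AddSubgroup.subset_closure rfl
  obtain ⟨f, hf, hfk⟩ := hkH
  have hdvd : ∀ x ∈ M, ∃ c : ℤ, B (n • e) x = c * k := by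
    intro x hx
    obtain ⟨m, hm⟩ := h.isInt hne hx
    have : m ∈ H := ⟨x, hx, hm⟩
    rw [hk, AddSubgroup.mem_closure_singleton] at this
    obtain ⟨c, rfl⟩ := this
    exact ⟨c, by rw [hm]; simp⟩
  have hk0 : (k : ℚ) ≠ 0 := by
    intro hk0
    have h0 : ∀ x, B e x = 0 := by
      intro x
      obtain ⟨m, hm, hmx⟩ := h.exists_zsmul_mem x
      obtain ⟨c, hc⟩ := hdvd _ hmx
      rw [hk0, mul_zero, map_zsmul, map_zsmul, LinearMap.smul_apply, zsmul_eq_mul,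
        zsmul_eq_mul] at hc
      have hm' : (m : ℚ) ≠ 0 := by exact_mod_cast hm
      have hn' : (n : ℚ) ≠ 0 := by exact_mod_cast hn
      simpa [hm', hn'] using hc
    obtain ⟨v, -, hv⟩ := hyp
    exact (hv e (h0 v) he).ne hee
  refine ⟨(k : ℚ)⁻¹ • n • e, ?_, ?_, f, hf, ?_⟩
  · intro x hx
    obtain ⟨c, hc⟩ := hdvd x hx
    refine ⟨c, ?_⟩
    rw [h.symm, map_smul, LinearMap.smul_apply, hc, smul_eq_mul]
    field_simp
  · simp [hee]
  · rw [map_smul, LinearMap.smul_apply, hfk, smul_eq_mul, inv_mul_cancel₀ hk0]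

end IsEvenTwoElem

/-- The lattice contains a unimodular hyperbolic plane. -/
def HasPlane (B : LinearMap.BilinForm ℚ V) (M : Submodule ℤ V) : Prop :=
  ∃ e ∈ M, ∃ f ∈ M, B e e = 0 ∧ B f f = 0 ∧ B e f = 1

namespace IsEvenTwoElem

theorem hasPlane_or (h : IsEvenTwoElem B M) (hyp : Hyp B) {e : V} (he : e ≠ 0)
    (hee : B e e = 0) : HasPlane B M ∨
      ∃ e ∈ dualLat B M, B e e = 0 ∧ ∃ y ∈ dualLat B M, B e y = 1 / 2 := by
  obtain ⟨e₁, he₁, hee₁, f, hf, hef⟩ := h.exists_primitive_isotropic hyp he hee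
  by_cases hm : e₁ ∈ M
  · obtain ⟨k, hk⟩ := h.even f hf
    refine Or.inl ⟨e₁, hm, f - k • e₁, M.sub_mem hf (M.smul_mem _ hm), hee₁, ?_, ?_⟩
    · simp only [map_sub, LinearMap.sub_apply, map_zsmul, LinearMap.smul_apply, zsmul_eq_mul, hee₁,
        hef, h.symm f e₁]
      linarith
    · simp [hef, hee₁]
  · obtain ⟨y, hy, hye⟩ : ∃ y ∈ dualLat B M, ¬ IsInt (B y e₁) := by
      by_contra! hc
      exact hm (h.mem_of_dual _ hc)
    obtain ⟨n, hn⟩ := IsInt.exists_half (h.isInt_two_mul hy he₁) hye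
    refine Or.inr ⟨e₁, he₁, hee₁, y - n • f, Submodule.sub_mem _ hy
      (Submodule.smul_mem _ _ (h.le_dual hf)), ?_⟩
    rw [map_sub, map_zsmul, hef, h.symm, hn]
    simp

theorem exists_half_vectors (h : IsEvenTwoElem B M) (hδ : ¬ DualIntegral B M) {e y : V}
    (he : e ∈ dualLat B M) (hee : B e e = 0) (hy : y ∈ dualLat B M) (hey : B e y = 1 / 2) :
    ∃ y ∈ dualLat B M, B y y = -1 / 2 ∧ ∃ u ∈ dualLat B M, B u u = 1 / 2 ∧ B y u = 0 := by
  obtain ⟨y₁, hy₁, hey₁, hyy₁⟩ : ∃ y ∈ dualLat B M, B e y = 1 / 2 ∧ ¬ IsInt (B y y) := by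
    by_cases hyy : IsInt (B y y)
    swap
    · exact ⟨y, hy, hey, hyy⟩
    obtain ⟨z, hz, hzz⟩ : ∃ z ∈ dualLat B M, ¬ IsInt (B z z) := by
      by_contra! hc
      exact hδ hc
    obtain ⟨c, hc⟩ := h.isInt_two_mul hz he
    have hzd : z - c • y ∈ dualLat B M := Submodule.sub_mem _ hz (Submodule.smul_mem _ _ hy)
    refine ⟨y + (z - c • y), Submodule.add_mem _ hy hzd, ?_, ?_⟩
    · rw [map_add, map_sub, map_zsmul, hey, h.symm e z, zsmul_eq_mul, ← hc]
      ring
    · intro hi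
      refine hzz ?_
      have h1 := (hi.sub ((IsInt.intCast ((1 - c) * (1 - c))).mul hyy)).sub
        ((IsInt.intCast (1 - c)).mul (h.isInt_two_mul hy hz))
      convert h1 using 1
      simp only [map_sub, map_add, LinearMap.sub_apply, LinearMap.add_apply, map_zsmul,
        LinearMap.smul_apply, zsmul_eq_mul, h.symm z y]
      push_cast
      ring
  obtain ⟨k, hk⟩ := IsInt.exists_half (h.isInt_two_mul hy₁ hy₁) hyy₁
  have hey' : B y₁ e = 1 / 2 := by rw [h.symm, hey₁]
  have hyd : y₁ - (k + 1) • e ∈ dualLat B M :=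
    Submodule.sub_mem _ hy₁ (Submodule.smul_mem _ _ he)
  refine ⟨_, hyd, ?_, _, Submodule.add_mem _ hyd he, ?_, ?_⟩ <;>
  · simp only [map_sub, map_add, LinearMap.sub_apply, LinearMap.add_apply, map_zsmul,
        LinearMap.smul_apply, zsmul_eq_mul, hk, hey', hey₁, hee]
    push_cast
    ring

end IsEvenTwoElem

/-- The lattice induced on the orthogonal complement of a vector. -/
def perpLat (B : LinearMap.BilinForm ℚ V) (M : Submodule ℤ V) (y : V) :
    Submodule ℤ (LinearMap.ker (B y)) :=
  M.comap ((LinearMap.ker (B y)).subtype.restrictScalars ℤ)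

theorem mem_perpLat {y : V} {x : LinearMap.ker (B y)} : x ∈ perpLat B M y ↔ (x : V) ∈ M := Iff.rfl

/-- Splitting off a vector of square `-1/2`. -/
noncomputable def splitEquiv (B : LinearMap.BilinForm ℚ V) (y : V) (hy : B y y = -1 / 2) :
    V ≃ₗ[ℚ] LinearMap.ker (B y) × ℚ where
  toFun v := (⟨v + (2 * B y v) • y, by simp [hy]; ring⟩, -2 * B y v)
  invFun p := p.1 + p.2 • y
  map_add' v w := by
    ext
    · simp only [map_add, Prod.fst_add, Submodule.coe_add]
      module
    · simp
      ring
  map_smul' c v := by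
    ext
    · simp only [map_smul, smul_eq_mul, RingHom.id_apply, Prod.smul_fst, Submodule.coe_smul]
      module
    · simp
      ring
  left_inv v := by
    simp only
    module
  right_inv p := by
    obtain ⟨⟨v, hv⟩, t⟩ := p
    have hv' : B y v = 0 := hv
    ext
    · simp only [map_add, map_smul, hv', hy, smul_eq_mul]
      module
    · simp only [map_add, map_smul, hv', hy, smul_eq_mul]
      ring

theorem splitEquiv_apply_fst (y : V) (hy : B y y = -1 / 2) (v : V) :
    ((splitEquiv B y hy v).1 : V) = v + (2 * B y v) • y := rfl
theorem splitEquiv_apply_snd (y : V) (hy : B y y = -1 / 2) (v : V) :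
    (splitEquiv B y hy v).2 = -2 * B y v := rfl

namespace IsEvenTwoElem

variable {y : V}

theorem splitEquiv_form (h : IsEvenTwoElem B M) (hy : B y y = -1 / 2) (v w : V) :
    B v w = B.restrict (LinearMap.ker (B y)) (splitEquiv B y hy v).1 (splitEquiv B y hy w).1
      - (splitEquiv B y hy v).2 * (splitEquiv B y hy w).2 / 2 := by
  rw [LinearMap.BilinForm.restrict_apply, LinearMap.domRestrict_apply, splitEquiv_apply_fst,
    splitEquiv_apply_fst, splitEquiv_apply_snd, splitEquiv_apply_snd]
  simp only [map_add, map_smul, LinearMap.add_apply, LinearMap.smul_apply, smul_eq_mul, hy,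
    h.symm v y]
  ring

theorem splitEquiv_dual (h : IsEvenTwoElem B M) (hyd : y ∈ dualLat B M) (hy : B y y = -1 / 2)
    {v : V} (hv : v ∈ dualLat B M) : ((splitEquiv B y hy v).1 : V) ∈ dualLat B M := by
  obtain ⟨n, hn⟩ := h.isInt_two_mul hyd hv
  rw [splitEquiv_apply_fst, hn, Int.cast_smul_eq_zsmul ℚ]
  exact Submodule.add_mem _ hv (Submodule.smul_mem _ _ hyd)

theorem mem_iff_splitEquiv (h : IsEvenTwoElem B M) (hyd : y ∈ dualLat B M) (hy : B y y = -1 / 2)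
    (v : V) : v ∈ M ↔ (splitEquiv B y hy v).1 ∈ perpLat B M y ∧
      IsInt ((splitEquiv B y hy v).2 / 2) := by
  rw [mem_perpLat, splitEquiv_apply_fst, splitEquiv_apply_snd]
  have e : -2 * B y v / 2 = - B y v := by ring
  rw [e]
  have key : ∀ n : ℤ, B y v = n → (v + (2 * B y v) • y ∈ M ↔ v ∈ M) := by
    intro n hn
    have e : v + (2 * B y v) • y = v + n • (y + y) := by
      rw [hn, ← Int.cast_smul_eq_zsmul ℚ]; module
    rw [e]
    exact M.add_mem_iff_left (M.smul_mem n (h.add_self_mem y hyd))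
  constructor
  · intro hv
    obtain ⟨n, hn⟩ := h.isInt_dual_left hv hyd
    exact ⟨(key n hn).2 hv, by rw [hn]; exact (IsInt.intCast n).neg⟩
  · rintro ⟨h1, n, hn⟩
    exact (key (-n) (by push_cast; linarith)).1 h1

theorem mem_dual_perpLat (h : IsEvenTwoElem B M) (hyd : y ∈ dualLat B M) (hy : B y y = -1 / 2)
    (v : LinearMap.ker (B y)) : v ∈ dualLat (B.restrict (LinearMap.ker (B y))) (perpLat B M y) ↔
      (v : V) ∈ dualLat B M := by
  constructor
  · intro hv x hx
    have h1 := hv _ ((h.mem_iff_splitEquiv hyd hy x).1 hx).1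
    rw [LinearMap.BilinForm.restrict_apply, LinearMap.domRestrict_apply, splitEquiv_apply_fst,
      map_add, map_smul, LinearMap.add_apply, LinearMap.smul_apply] at h1
    have h2 : B y v = 0 := v.2
    simpa [h2] using h1
  · intro hv x hx
    exact hv x hx

theorem perpLat_isEvenTwoElem (h : IsEvenTwoElem B M) (hyd : y ∈ dualLat B M)
    (hy : B y y = -1 / 2) :
    IsEvenTwoElem (B.restrict (LinearMap.ker (B y))) (perpLat B M y) where
  fg := by
    refine Submodule.fg_of_fg_map_injective ((LinearMap.ker (B y)).subtype.restrictScalars ℤ)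
      Subtype.val_injective ?_
    have := Module.Finite.iff_fg.2 h.fg
    have h1 := (inferInstance : IsNoetherian ℤ M)
    exact isNoetherian_submodule.1 h1 _ (Submodule.map_comap_le _ _)
  span_eq := by
    rw [eq_top_iff]
    intro v _
    obtain ⟨n, hn, hnv⟩ := h.exists_zsmul_mem (v : V)
    have h1 : n • v ∈ Submodule.span ℚ (perpLat B M y : Set _) := Submodule.subset_span hnv
    have h2 := Submodule.smul_mem _ (n : ℚ)⁻¹ h1
    rwa [← Int.cast_smul_eq_zsmul ℚ, smul_smul, inv_mul_cancel₀ (by exact_mod_cast hn),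
      one_smul] at h2
  symm := fun x y => h.symm _ _
  even := fun x hx => h.even x hx
  add_self_mem := fun v hv => h.add_self_mem _ ((h.mem_dual_perpLat hyd hy v).1 hv)
  mem_of_dual := fun v hv => by
    refine h.mem_of_dual _ fun z hz => ?_
    have h1 := hv _ ((h.mem_dual_perpLat hyd hy _).2 (h.splitEquiv_dual hyd hy hz))
    rw [LinearMap.BilinForm.restrict_apply, LinearMap.domRestrict_apply, splitEquiv_apply_fst,
      map_add, map_smul, LinearMap.add_apply, LinearMap.smul_apply] at h1
    have h2 : B y v = 0 := v.2
    simpa [h2] using h1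

theorem coIndex_perpLat (h : IsEvenTwoElem B M) (hyd : y ∈ dualLat B M)
    (hy : B y y = -1 / 2) :
    coIndex (B.restrict (LinearMap.ker (B y))) (perpLat B M y) = coIndex B M := by
  have e1 : (twiceDual (B.restrict (LinearMap.ker (B y))) (perpLat B M y)).toAddSubgroup =
      (twiceDual B M).toAddSubgroup.comap (LinearMap.ker (B y)).subtype.toAddMonoidHom := by
    ext v
    exact mem_twiceDual_iff.trans ((h.mem_dual_perpLat hyd hy _).trans mem_twiceDual_iff.symm)
  have e2 : M.toAddSubgroup = (perpLat B M y).toAddSubgroup.map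
      (LinearMap.ker (B y)).subtype.toAddMonoidHom ⊔ (twiceDual B M).toAddSubgroup := by
    apply le_antisymm
    · intro v hv
      have hv' : v = (splitEquiv B y hy v).1 + (-(2 * B y v)) • y := by
        rw [splitEquiv_apply_fst]; module
      obtain ⟨n, hn⟩ := h.isInt_dual_left hv hyd
      rw [hv']
      refine AddSubgroup.add_mem_sup ⟨_, ((h.mem_iff_splitEquiv hyd hy v).1 hv).1, rfl⟩ ?_
      have e : (-(2 * B y v)) • y = (-n) • (y + y) := by
        rw [hn, ← Int.cast_smul_eq_zsmul ℚ]; push_cast; module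
      rw [e]
      exact Submodule.smul_mem _ _ (add_self_mem_twiceDual.2 hyd)
    · refine sup_le ?_ h.twiceDual_le
      rintro _ ⟨v, hv, rfl⟩
      exact hv
  rw [coIndex, coIndex, e1, e2, AddSubgroup.relIndex_comap, AddSubgroup.relIndex_sup_right]

end IsEvenTwoElem

theorem latIsom_of_perpLat {V' : Type} [AddCommGroup V'] [Module ℚ V']
    {B' : LinearMap.BilinForm ℚ V'} {M' : Submodule ℤ V'} (h : IsEvenTwoElem B M)
    (h' : IsEvenTwoElem B' M') {y : V} {y' : V'} (hyd : y ∈ dualLat B M) (hy : B y y = -1 / 2)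
    (hyd' : y' ∈ dualLat B' M') (hy' : B' y' y' = -1 / 2)
    (hi : LatIsom (B.restrict (LinearMap.ker (B y))) (perpLat B M y)
      (B'.restrict (LinearMap.ker (B' y'))) (perpLat B' M' y')) : LatIsom B M B' M' := by
  obtain ⟨φ, h1, h2⟩ := hi
  refine ⟨(splitEquiv B y hy).trans ((φ.prodCongr (LinearEquiv.refl ℚ ℚ)).trans
    (splitEquiv B' y' hy').symm), fun v w => ?_, fun v => ?_⟩
  · rw [h'.splitEquiv_form hy', h.splitEquiv_form hy]
    simpa using h1 _ _
  · rw [h'.mem_iff_splitEquiv hyd' hy', h.mem_iff_splitEquiv hyd hy]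
    simp [h2]

end Split

section Odd

variable {V : Type} [AddCommGroup V] [Module ℚ V] {B : LinearMap.BilinForm ℚ V}
  {M : Submodule ℤ V}

theorem IsEvenTwoElem.hyp_perpLat (h : IsEvenTwoElem B M) (hyp : Hyp B) {y : V}
    (hy : B y y < 0) : Hyp (B.restrict (LinearMap.ker (B y))) := by
  obtain ⟨v, hv, hneg⟩ := hyp
  have hvy := h.symm v y
  refine ⟨⟨v - (B y v / B y y) • y, ?_⟩, ?_, fun x hx hx0 => ?_⟩
  · rw [LinearMap.mem_ker, map_sub, map_smul, smul_eq_mul, div_mul_cancel₀ _ hy.ne, sub_self]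
  · rw [LinearMap.BilinForm.restrict_apply, LinearMap.domRestrict_apply]
    simp only [map_sub, map_smul, LinearMap.sub_apply, LinearMap.smul_apply, smul_eq_mul, hvy]
    have : 0 ≤ (B y v) ^ 2 / (- B y y) := div_nonneg (sq_nonneg _) (by linarith)
    rw [div_neg] at this
    have e : B v v - B y v / B y y * B y v - B y v / B y y * (B y v - B y v / B y y * B y y)
        = B v v + -(B y v ^ 2 / B y y) := by
      rw [div_mul_cancel₀ _ hy.ne]
      ring
    rw [e]
    linarith
  · have h1 : B y x = 0 := x.2
    rw [LinearMap.BilinForm.restrict_apply, LinearMap.domRestrict_apply] at hx ⊢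
    rw [map_sub, map_smul, h.symm x y, h1, smul_zero, sub_zero] at hx
    exact hneg x hx fun hc => hx0 (Subtype.ext hc)

namespace IsEvenTwoElem

theorem exists_gen_of_finrank_eq_one (h : IsEvenTwoElem B M) (hyp : Hyp B)
    (hn : Module.finrank ℚ V = 1) :
    ∃ g ∈ M, B g g = 2 ∧ g ≠ 0 ∧ (∀ v : V, ∃ c : ℚ, v = c • g) ∧ ∀ v ∈ M, ∃ n : ℤ, v = n • g := by
  obtain ⟨v, hv, -⟩ := hyp
  have hv0 : v ≠ 0 := fun h0 => by simp [h0] at hv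
  have hspan : ∀ g : V, g ≠ 0 → ∀ x : V, ∃ c : ℚ, x = c • g := fun g hg x => by
    obtain ⟨c, hc⟩ := exists_smul_eq_of_finrank_eq_one hn hg x
    exact ⟨c, hc.symm⟩
  have hpos : ∀ g : V, g ≠ 0 → 0 < B g g := by
    intro g hg
    obtain ⟨c, rfl⟩ := hspan v hv0 g
    have hc : c ≠ 0 := fun h0 => hg (by rw [h0, zero_smul])
    simp only [map_smul, LinearMap.smul_apply, smul_eq_mul]
    rw [← mul_assoc]
    exact mul_pos (mul_self_pos.2 hc) hv
  obtain ⟨n, hn0, hnv⟩ := h.exists_zsmul_mem v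
  have hn0' : (n : ℚ) ≠ 0 := by exact_mod_cast hn0
  have hinj : ∀ x, B (n • v) x = 0 → x = 0 := by
    intro x hx
    obtain ⟨c, rfl⟩ := hspan v hv0 x
    simpa [hn0', hv.ne', hn0, or_iff_left hv0] using hx
  let H : AddSubgroup ℤ :=
    { carrier := {k | ∃ x ∈ M, B (n • v) x = k}
      zero_mem' := ⟨0, M.zero_mem, by simp⟩
      add_mem' := by
        rintro a b ⟨x, hx, hxa⟩ ⟨y, hy, hyb⟩
        exact ⟨x + y, M.add_mem hx hy, by rw [map_add, hxa, hyb]; push_cast; rfl⟩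
      neg_mem' := by
        rintro a ⟨x, hx, hxa⟩
        exact ⟨-x, M.neg_mem hx, by rw [map_neg, hxa]; push_cast; rfl⟩ }
  obtain ⟨k, hk⟩ := Int.subgroup_cyclic H
  have hkH : k ∈ H := by rw [hk]; exact AddSubgroup.subset_closure rfl
  obtain ⟨g, hg, hgk⟩ := hkH
  have hgen : ∀ x ∈ M, ∃ m : ℤ, x = m • g := by
    intro x hx
    obtain ⟨m, hm⟩ := h.isInt hnv hx
    have : m ∈ H := ⟨x, hx, hm⟩
    rw [hk, AddSubgroup.mem_closure_singleton] at this
    obtain ⟨c, rfl⟩ := this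
    refine ⟨c, sub_eq_zero.1 (hinj _ ?_)⟩
    rw [map_sub, hm, map_zsmul (B (n • v)) c g, hgk]
    simp
  have hg0 : g ≠ 0 := by
    rintro rfl
    obtain ⟨m, hm⟩ := hgen _ hnv
    rw [smul_zero, ← Int.cast_smul_eq_zsmul ℚ, smul_eq_zero] at hm
    exact hm.elim hn0' hv0
  refine ⟨g, hg, ?_, hg0, hspan g hg0, hgen⟩
  obtain ⟨l, hl⟩ := h.even g hg
  have hl' : B g g = 2 * l := by linarith
  have hl0 : (0 : ℚ) < l := by
    have := hpos g hg0
    linarith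
  have hd : (2 * l : ℚ)⁻¹ • g ∈ dualLat B M := by
    intro x hx
    obtain ⟨m, rfl⟩ := hgen x hx
    refine ⟨m, ?_⟩
    rw [map_smul, map_zsmul, LinearMap.smul_apply, hl', zsmul_eq_mul, smul_eq_mul]
    field_simp
  obtain ⟨m, hm⟩ := hgen _ (h.add_self_mem _ hd)
  rw [← add_smul, ← Int.cast_smul_eq_zsmul ℚ, ← sub_eq_zero, ← sub_smul, smul_eq_zero,
    or_iff_left hg0] at hm
  have h1 : (m * l : ℚ) = 1 := by
    field_simp at hm
    linarith
  have h2 : m * l = 1 := by exact_mod_cast h1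
  have hl0' : 0 < l := by exact_mod_cast hl0
  rcases Int.mul_eq_one_iff_eq_one_or_neg_one.1 h2 with ⟨-, rfl⟩ | ⟨-, rfl⟩
  · rw [hl']; norm_num
  · omega

/-- Two overlattices of the same lattice, one of which contains a hyperbolic plane. -/
theorem latIsom_of_hasPlane {M₂ : Submodule ℤ V} (h : IsEvenTwoElem B M)
    (h₂ : IsEvenTwoElem B M₂) {e f w : V} (he : e ∈ M) (hf : f ∈ M) (hee : B e e = 0)
    (hff : B f f = 0) (hef : B e f = 1) (hw : w ∈ M₂) (hwd : w ∉ twiceDual B M₂)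
    (hδ : ¬ DualIntegral B M₂) (hN : evenPart B M₂ w = evenPart B M e) : LatIsom B M B M₂ := by
  have hfe : B f e = 1 := by rw [h.symm, hef]
  have half1 : ¬ IsInt ((1 : ℚ) / 2) := by simpa using IsInt.not_half 0
  have hed : e ∉ twiceDual B M := fun hc => half1 (by simpa [hfe] using hc f hf)
  have hNE := h.evenPart_isEvenTwoElem he hed
  obtain ⟨z, hz, hzw⟩ : ∃ z ∈ M₂, ¬ IsInt (B z w / 2) := by
    by_contra! hc
    exact hwd hc
  have hzN : z ∉ evenPart B M e := by
    rw [← hN]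
    exact fun hc => hzw hc.2
  have hle : dualLat B M₂ ≤ dualLat B (evenPart B M e) := by
    rw [← hN]
    exact dual_le_dual_evenPart
  obtain ⟨t, ht, htt⟩ : ∃ t ∈ dualLat B M₂, ¬ IsInt (B t t) := by
    by_contra! hc
    exact hδ hc
  have hhalf : (2⁻¹ : ℚ) • (f + f) = f := by rw [smul_add, half_add_half]
  have hfN : f ∉ evenPart B M e := fun hc => half1 (by simpa [hfe] using hc.2)
  obtain ⟨s, hs, hsN, hsf⟩ := hNE.moves_half (p := e) (q := f + f) (z := z)
    ⟨he, by rw [hee, zero_div]; exact IsInt.zero⟩ hee half_mem_dual_evenPart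
    (h.add_self_mem_evenPart he hf) (by simp [hff])
    (by rw [hhalf]; exact dual_le_dual_evenPart (h.le_dual hf)) (by simp [hef]; norm_num)
    (hle (h₂.le_dual hz)) (h₂.even z hz) hzN
    ⟨t, hle ht, h₂.isInt_dual_left hz ht, htt⟩
  rw [hhalf] at hsf
  have add_odd : ∀ {x g a : V} {L : Submodule ℤ V}, IsEvenTwoElem B L → a ∈ L → x ∈ L → g ∈ L →
      x ∉ evenPart B L a → g ∉ evenPart B L a → x - g ∈ evenPart B L a := by
    intro x g a L hL ha hx hg hxa hga
    refine ⟨L.sub_mem hx hg, ?_⟩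
    have h1 : ¬ IsInt (B x a / 2) := fun hc => hxa ⟨hx, hc⟩
    have h2 : ¬ IsInt (B g a / 2) := fun hc => hga ⟨hg, hc⟩
    have h3 := (IsInt.add_of_half (by rw [mul_div_cancel₀ _ two_ne_zero]; exact hL.isInt hx ha) h1
      (by rw [mul_div_cancel₀ _ two_ne_zero]; exact hL.isInt hg ha) h2).sub (hL.isInt hg ha)
    convert h3 using 1
    rw [map_sub, LinearMap.sub_apply]
    ring
  have hNM : evenPart B M e ≤ M := evenPart_le
  have hNM₂ : evenPart B M e ≤ M₂ := by rw [← hN]; exact evenPart_le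
  refine ⟨s, hs, fun x => ⟨fun hx => ?_, fun hx => ?_⟩⟩
  · by_cases hxN : s x ∈ evenPart B M e
    · exact hNM ((hsN x).1 hxN)
    · have h1 := add_odd h₂ hw hx hz (by rwa [hN]) (by rwa [hN])
      rw [hN] at h1
      have h2 : s (x - f) ∈ evenPart B M e := by
        have := Submodule.sub_mem _ h1 hsf
        rwa [sub_sub_sub_cancel_right, ← map_sub] at this
      have h3 := M.add_mem (hNM ((hsN _).1 h2)) hf
      rwa [sub_add_cancel] at h3
  · by_cases hxN : x ∈ evenPart B M e
    · exact hNM₂ ((hsN x).2 hxN)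
    · have h1 := (hsN _).2 (add_odd h he hx hf hxN hfN)
      have h2 := M₂.add_mem (hNM₂ (Submodule.add_mem _ h1 hsf)) hz
      rwa [map_sub, sub_add_sub_cancel, sub_add_cancel] at h2

end IsEvenTwoElem

theorem IsEvenTwoElem.latIsom_rankOne (h : IsEvenTwoElem B M) (hyp : Hyp B)
    (hn : Module.finrank ℚ V = 1) :
    LatIsom ((2 : ℚ) • LinearMap.mul ℚ ℚ) (Submodule.span ℤ {(1 : ℚ)}) B M := by
  obtain ⟨g, hg, hgg, hg0, hV, hM⟩ := h.exists_gen_of_finrank_eq_one hyp hn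
  have hb : Function.Bijective (LinearMap.toSpanSingleton ℚ V g) := by
    refine ⟨LinearMap.ker_eq_bot.1 (LinearMap.ker_toSpanSingleton ℚ hg0), fun v => ?_⟩
    obtain ⟨c, rfl⟩ := hV v
    exact ⟨c, LinearMap.toSpanSingleton_apply ℚ V g c⟩
  have hφ : ∀ x, LinearEquiv.ofBijective _ hb x = x • g := LinearMap.toSpanSingleton_apply ℚ V g
  refine ⟨LinearEquiv.ofBijective _ hb, fun x y => ?_, fun x => ?_⟩
  · rw [hφ, hφ]
    simp [hgg]
    ring
  · rw [hφ, Submodule.mem_span_singleton]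
    constructor
    · intro hx
      obtain ⟨m, hm⟩ := hM _ hx
      rw [← Int.cast_smul_eq_zsmul ℚ, ← sub_eq_zero, ← sub_smul, smul_eq_zero,
        or_iff_left hg0] at hm
      exact ⟨m, by simp; linarith⟩
    · rintro ⟨m, rfl⟩
      simpa [Int.cast_smul_eq_zsmul] using M.smul_mem m hg

theorem latIsom_of_finrank_eq_one {V' : Type} [AddCommGroup V'] [Module ℚ V']
    {B' : LinearMap.BilinForm ℚ V'} {M' : Submodule ℤ V'}
    (h : IsEvenTwoElem B M) (h' : IsEvenTwoElem B' M') (hyp : Hyp B) (hyp' : Hyp B')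
    (hn : Module.finrank ℚ V = 1) (hn' : Module.finrank ℚ V' = 1) : LatIsom B M B' M' :=
  (h.latIsom_rankOne hyp hn).symm.trans (h'.latIsom_rankOne hyp' hn')

theorem latIsom_of_not_dualIntegral (n : ℕ) : ∀ (c : ℕ) {V : Type} [AddCommGroup V] [Module ℚ V]
    [FiniteDimensional ℚ V] {B : LinearMap.BilinForm ℚ V} {M : Submodule ℤ V}
    {V' : Type} [AddCommGroup V'] [Module ℚ V']
    [FiniteDimensional ℚ V'] {B' : LinearMap.BilinForm ℚ V'} {M' : Submodule ℤ V'}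
    (_ : IsEvenTwoElem B M) (_ : IsEvenTwoElem B' M') (_ : Hyp B) (_ : Hyp B')
    (_ : Module.finrank ℚ V = n) (_ : Module.finrank ℚ V' = n)
    (_ : coIndex B M = c) (_ : coIndex B' M' = c) (_ : c ≠ 0)
    (_ : ¬ DualIntegral B M) (_ : ¬ DualIntegral B' M'), LatIsom B M B' M' := by
  induction n with
  | zero =>
    intro c V _ _ _ B M V' _ _ _ B' M' h h' hyp hyp' hn hn' hc hc' hc0 hδ hδ'
    have := Module.finrank_zero_iff.1 hn
    exact absurd (fun y _ => by rw [Subsingleton.elim y 0]; simpa using IsInt.zero) hδ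
  | succ n ihn =>
    intro c
    induction c using Nat.strong_induction_on with
    | _ c ihc =>
    intro V _ _ _ B M V' _ _ _ B' M' h h' hyp hyp' hn hn' hc hc' hc0 hδ hδ'
    rcases Nat.eq_zero_or_pos n with rfl | hpos
    · exact latIsom_of_finrank_eq_one h h' hyp hyp' hn hn'
    have plane : ∀ {V : Type} [AddCommGroup V] [Module ℚ V]
        [FiniteDimensional ℚ V] {B : LinearMap.BilinForm ℚ V} {M : Submodule ℤ V}
        {V' : Type} [AddCommGroup V'] [Module ℚ V']
        [FiniteDimensional ℚ V'] {B' : LinearMap.BilinForm ℚ V'} {M' : Submodule ℤ V'}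
        (_ : IsEvenTwoElem B M) (_ : IsEvenTwoElem B' M') (_ : Hyp B) (_ : Hyp B')
        (_ : Module.finrank ℚ V = n + 1) (_ : Module.finrank ℚ V' = n + 1)
        (_ : coIndex B M = c) (_ : coIndex B' M' = c)
        (_ : ¬ DualIntegral B M) (_ : ¬ DualIntegral B' M'), HasPlane B M → LatIsom B M B' M' := by
      intro V _ _ _ B M V' _ _ _ B' M' h h' hyp hyp' hn hn' hc hc' hδ hδ' hp
      obtain ⟨e, he, f, hf, hee, hff, hef⟩ := hp
      have hed : e ∉ twiceDual B M := fun hd => IsInt.not_half 0 (by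
        have := hd f hf
        rw [h.symm, hef] at this
        simpa using this)
      have h4 := h.coIndex_eq_four_mul he hed
      obtain ⟨w', hw', hwd'⟩ := IsEvenTwoElem.exists_notMem_twiceDual (B := B') (M := M') (by omega)
      have h4' := h'.coIndex_eq_four_mul hw' hwd'
      have hi := ihc (coIndex B (evenPart B M e)) (by omega) (h.evenPart_isEvenTwoElem he hed)
        (h'.evenPart_isEvenTwoElem hw' hwd') hyp hyp' hn hn' rfl (by omega) (by omega)
        (IsEvenTwoElem.not_dualIntegral_evenPart hδ) (IsEvenTwoElem.not_dualIntegral_evenPart hδ')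
      obtain ⟨M₂, w₂, hM₂, hw₂, hwd₂, heq, hd, hl, -⟩ := exists_comap_evenPart hw' hwd' h' hi
      exact (h.latIsom_of_hasPlane hM₂ he hf hee hff hef hw₂ hwd₂ (by rwa [hd]) heq).trans hl
    obtain ⟨x, hx, hxx⟩ := h.exists_isotropic hyp (by omega) (by omega)
    obtain ⟨x', hx', hxx'⟩ := h'.exists_isotropic hyp' (by omega) (by omega)
    rcases h.hasPlane_or hyp hx hxx with hp | ⟨e, he, hee, y, hy, hey⟩
    · exact plane h h' hyp hyp' hn hn' hc hc' hδ hδ' hp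
    rcases h'.hasPlane_or hyp' hx' hxx' with hp | ⟨e', he', hee', y', hy', hey'⟩
    · exact (plane h' h hyp' hyp hn' hn hc' hc hδ' hδ hp).symm
    obtain ⟨y, hy, hyy, u, hu, huu, hyu⟩ := h.exists_half_vectors hδ he hee hy hey
    obtain ⟨y', hy', hyy', u', hu', huu', hyu'⟩ := h'.exists_half_vectors hδ' he' hee' hy' hey'
    have perp : ∀ {V : Type} [AddCommGroup V] [Module ℚ V]
        [FiniteDimensional ℚ V] {B : LinearMap.BilinForm ℚ V} {M : Submodule ℤ V} {y u : V},
        IsEvenTwoElem B M → Module.finrank ℚ V = n + 1 → y ∈ dualLat B M → B y y = -1 / 2 →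
        u ∈ dualLat B M → B u u = 1 / 2 → B y u = 0 →
        Module.finrank ℚ (LinearMap.ker (B y)) = n ∧
        ¬ DualIntegral (B.restrict (LinearMap.ker (B y))) (perpLat B M y) := by
      intro V _ _ _ B M y u h hn hy hyy hu huu hyu
      constructor
      · have hy0 : B y ≠ 0 := fun h0 => by simp [h0] at hyy; linarith
        have := Module.Dual.finrank_ker_add_one_of_ne_zero hy0
        omega
      · intro hd
        have := hd ⟨u, hyu⟩ ((h.mem_dual_perpLat hy hyy _).2 hu)
        rw [LinearMap.BilinForm.restrict_apply, LinearMap.domRestrict_apply, huu] at this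
        exact IsInt.not_half 0 (by simpa using this)
    obtain ⟨p1, p2⟩ := perp h hn hy hyy hu huu hyu
    obtain ⟨p1', p2'⟩ := perp h' hn' hy' hyy' hu' huu' hyu'
    refine latIsom_of_perpLat h h' hy hyy hy' hyy' ?_
    exact ihn c (h.perpLat_isEvenTwoElem hy hyy) (h'.perpLat_isEvenTwoElem hy' hyy')
      (h.hyp_perpLat hyp (by rw [hyy]; norm_num)) (h'.hyp_perpLat hyp' (by rw [hyy']; norm_num))
      p1 p1' (by rw [h.coIndex_perpLat hy hyy, hc]) (by rw [h'.coIndex_perpLat hy' hyy', hc'])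
      hc0 p2 p2'

end Odd

section EvenParity

variable {V : Type} [AddCommGroup V] [Module ℚ V] {B : LinearMap.BilinForm ℚ V}
  {M : Submodule ℤ V}

namespace IsEvenTwoElem

theorem relIndex_double (h : IsEvenTwoElem B M) :
    (M.toAddSubgroup.map (nsmulAddMonoidHom (α := V) 2)).relIndex M.toAddSubgroup
      = 2 ^ Module.finrank ℚ V := by
  have := h.isLattice
  have h1 : Module.Free ℤ M := h.free
  have h2 : Module.Finite ℤ M := Module.Finite.iff_fg.2 h.fg
  have h3 := @AddSubgroup.relIndex_map_nsmul V _ 2 M.toAddSubgroup h1 h2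
  rw [h3]
  congr 1
  exact congrArg Cardinal.toNat (Submodule.IsLattice.rank' ℚ M)

/-- In a lattice with integral dual squares, the even part for a vector of square not divisible by
four determines the dual lattice. -/
theorem mem_dual_iff_of_sq (h : IsEvenTwoElem B M) (hδ : DualIntegral B M) {w : V} (hw : w ∈ M)
    (hww : ¬ IsInt (B w w / 4)) (hwd : w ∉ twiceDual B M) (y : V) :
    y ∈ dualLat B M ↔ y ∈ dualLat B (evenPart B M w) ∧ IsInt (B y y) := by
  refine ⟨fun hy => ⟨dual_le_dual_evenPart hy, hδ y hy⟩, fun ⟨hy, hyy⟩ => ?_⟩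
  rcases h.mem_or_of_mem_dual_evenPart hw hwd hy with h1 | h1
  · exact h1
  · exfalso
    refine hww ?_
    have h2 := (hyy.sub (hδ _ h1)).add (h1 w hw)
    convert h2 using 1
    simp only [map_add, LinearMap.add_apply, map_smul, LinearMap.smul_apply, smul_eq_mul,
      h.symm y w]
    ring

theorem notMem_twiceDual_of_sq (hδ : DualIntegral B M) {w : V}
    (hww : ¬ IsInt (B w w / 4)) : w ∉ twiceDual B M := by
  intro hw
  have := hδ _ (mem_twiceDual_iff.1 hw)
  refine hww ?_
  convert this using 1
  simp only [map_smul, LinearMap.smul_apply, smul_eq_mul]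
  ring

end IsEvenTwoElem

/-- Lattices equal to the double of their dual become unimodular after halving the form. -/
theorem IsEvenTwoElem.half (h : IsEvenTwoElem B M) (hc : coIndex B M = 1)
    (hδ : DualIntegral B M) : IsEvenTwoElem ((2⁻¹ : ℚ) • B) M ∧
      DualIntegral ((2⁻¹ : ℚ) • B) M ∧ coIndex ((2⁻¹ : ℚ) • B) M = 2 ^ Module.finrank ℚ V := by
  have hM : twiceDual B M = M :=
    le_antisymm h.twiceDual_le (AddSubgroup.relIndex_eq_one.1 hc)
  have happ : ∀ x y, ((2⁻¹ : ℚ) • B) x y = B x y / 2 := fun x y => by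
    simp only [LinearMap.smul_apply, smul_eq_mul]
    ring
  have hdual : dualLat ((2⁻¹ : ℚ) • B) M = M := by
    refine Eq.trans ?_ hM
    ext y
    simp only [mem_dualLat, mem_twiceDual, happ]
  have hE : IsEvenTwoElem ((2⁻¹ : ℚ) • B) M :=
    { fg := h.fg
      span_eq := h.span_eq
      symm := fun x y => by rw [happ, happ, h.symm]
      even := fun x hx => by
        have h1 := hδ _ (mem_twiceDual_iff.1 (hM.ge hx))
        convert h1 using 1
        rw [happ]
        simp only [map_smul, LinearMap.smul_apply, smul_eq_mul]
        ring
      add_self_mem := fun y hy => by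
        rw [hdual] at hy
        exact M.add_mem hy hy
      mem_of_dual := fun x hx => by
        rw [hdual] at hx
        rw [← hM]
        intro y hy
        rw [← happ]
        exact hx y hy }
  refine ⟨hE, fun y hy => ?_, ?_⟩
  · rw [happ]
    exact h.even y (hdual.le hy)
  · rw [← hE.relIndex_double, coIndex]
    congr 1
    ext y
    rw [Submodule.mem_toAddSubgroup, mem_twiceDual_iff, hdual, AddSubgroup.mem_map]
    constructor
    · intro hy
      exact ⟨_, hy, by rw [nsmulAddMonoidHom_apply, two_nsmul, IsEvenTwoElem.half_add_half]⟩
    · rintro ⟨z, hz, rfl⟩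
      rw [nsmulAddMonoidHom_apply, two_nsmul, smul_add, IsEvenTwoElem.half_add_half]
      exact hz

theorem Hyp.half (h : Hyp B) : Hyp ((2⁻¹ : ℚ) • B) := by
  obtain ⟨v, hv, hn⟩ := h
  refine ⟨v, by simpa using hv, fun x hx hx0 => ?_⟩
  have := hn x (by simpa using hx) hx0
  simp only [LinearMap.smul_apply, smul_eq_mul]
  linarith

variable [FiniteDimensional ℚ V] {V' : Type} [AddCommGroup V'] [Module ℚ V']
  [FiniteDimensional ℚ V'] {B' : LinearMap.BilinForm ℚ V'} {M' : Submodule ℤ V'}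

theorem latIsom_of_dualIntegral_of_ne_one (h : IsEvenTwoElem B M) (h' : IsEvenTwoElem B' M')
    (hyp : Hyp B) (hyp' : Hyp B') (hn : Module.finrank ℚ V = Module.finrank ℚ V')
    (hc : coIndex B M = coIndex B' M') (hc0 : coIndex B M ≠ 0) (hc1 : coIndex B M ≠ 1)
    (hδ : DualIntegral B M) (hδ' : DualIntegral B' M') : LatIsom B M B' M' := by
  have key : ∀ {V : Type} [AddCommGroup V] [Module ℚ V] {B : LinearMap.BilinForm ℚ V}
      {M : Submodule ℤ V}, IsEvenTwoElem B M → coIndex B M ≠ 1 → DualIntegral B M →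
      ∃ w ∈ M, ¬ IsInt (B w w / 4) ∧ w ∉ twiceDual B M ∧
        ¬ DualIntegral B (evenPart B M w) := by
    intro V _ _ B M h hc hδ
    obtain ⟨w, hw, hww⟩ : ∃ w ∈ M, ¬ IsInt (B w w / 4) := by
      by_contra! hcon
      obtain ⟨w, hw, hwd⟩ := IsEvenTwoElem.exists_notMem_twiceDual hc
      refine hwd fun x hx => ?_
      have h1 := ((hcon _ (M.add_mem hx hw)).sub (hcon x hx)).sub (hcon w hw)
      convert h1 using 1
      simp only [map_add, LinearMap.add_apply, h.symm w x]
      ring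
    refine ⟨w, hw, hww, IsEvenTwoElem.notMem_twiceDual_of_sq hδ hww, fun hd => hww ?_⟩
    convert hd _ IsEvenTwoElem.half_mem_dual_evenPart using 1
    simp only [map_smul, LinearMap.smul_apply, smul_eq_mul]
    ring
  obtain ⟨w, hw, hww, hwd, hNδ⟩ := key h hc1 hδ
  obtain ⟨w', hw', hww', hwd', hNδ'⟩ := key h' (hc ▸ hc1) hδ'
  have h4 := h.coIndex_eq_four_mul hw hwd
  have h4' := h'.coIndex_eq_four_mul hw' hwd'
  have hi := latIsom_of_not_dualIntegral _ _ (h.evenPart_isEvenTwoElem hw hwd)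
    (h'.evenPart_isEvenTwoElem hw' hwd') hyp hyp' hn rfl rfl (by omega) (by omega) hNδ hNδ'
  obtain ⟨M₂, w₂, h₂, hw₂, hwd₂, heq, hd, hl, hsq⟩ := exists_comap_evenPart hw' hwd' h' hi
  have hdual : dualLat B M = dualLat B M₂ := by
    ext y
    rw [h.mem_dual_iff_of_sq hδ hw hww hwd, h₂.mem_dual_iff_of_sq (hd.2 hδ') hw₂ (by rwa [hsq])
      hwd₂, heq]
  have : M = M₂ := by
    apply le_antisymm
    · exact fun x hx => h₂.mem_of_dual x fun y hy => h.isInt_dual_left hx (hdual ▸ hy)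
    · exact fun x hx => h.mem_of_dual x fun y hy => h₂.isInt_dual_left hx (hdual ▸ hy)
  rw [this]
  exact hl

theorem latIsom_of_dualIntegral (h : IsEvenTwoElem B M) (h' : IsEvenTwoElem B' M')
    (hyp : Hyp B) (hyp' : Hyp B') (hn : Module.finrank ℚ V = Module.finrank ℚ V')
    (hc : coIndex B M = coIndex B' M') (hc0 : coIndex B M ≠ 0)
    (hδ : DualIntegral B M) (hδ' : DualIntegral B' M') : LatIsom B M B' M' := by
  by_cases hc1 : coIndex B M = 1
  swap
  · exact latIsom_of_dualIntegral_of_ne_one h h' hyp hyp' hn hc hc0 hc1 hδ hδ'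
  obtain ⟨h1, h2, h3⟩ := h.half hc1 hδ
  obtain ⟨h1', h2', h3'⟩ := h'.half (hc ▸ hc1) hδ'
  have hV : Module.finrank ℚ V ≠ 0 := by
    intro h0
    have := Module.finrank_zero_iff.1 h0
    obtain ⟨v, hv, -⟩ := hyp
    rw [Subsingleton.elim v 0] at hv
    simp at hv
  obtain ⟨φ, hφ, hm⟩ := latIsom_of_dualIntegral_of_ne_one h1 h1' hyp.half hyp'.half hn
    (by rw [h3, h3', hn]) (by rw [h3]; positivity)
    (by rw [h3]; exact fun h => hV (by simpa using h)) h2 h2'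
  refine ⟨φ, fun x y => ?_, hm⟩
  have := hφ x y
  simp only [LinearMap.smul_apply, smul_eq_mul] at this
  linarith

theorem latIsom_of_invariants (h : IsEvenTwoElem B M) (h' : IsEvenTwoElem B' M')
    (hyp : Hyp B) (hyp' : Hyp B') (hn : Module.finrank ℚ V = Module.finrank ℚ V')
    (hc : coIndex B M = coIndex B' M') (hc0 : coIndex B M ≠ 0)
    (hδ : DualIntegral B M ↔ DualIntegral B' M') : LatIsom B M B' M' := by
  by_cases hd : DualIntegral B M
  · exact latIsom_of_dualIntegral h h' hyp hyp' hn hc hc0 hd (hδ.1 hd)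
  · exact latIsom_of_not_dualIntegral _ _ h h' hyp hyp' hn rfl rfl hc.symm hc0 hd
      fun hd' => hd (hδ.2 hd')

end EvenParity

section Invariants

theorem card_eq_two_pow_minGen {A : Type} [AddCommGroup A] [Finite A]
    (h : ∀ a : A, 2 • a = 0) : Nat.card A = 2 ^ minGen A := by
  let _ : Module (ZMod 2) A := AddCommGroup.zmodModule h
  have hcl : ∀ s : Finset A, AddSubgroup.closure (s : Set A) = ⊤ ↔
      Submodule.span (ZMod 2) (s : Set A) = ⊤ := by
    refine fun s => ⟨fun h1 => ?_, fun h1 => ?_⟩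
    · have h2 : AddSubgroup.closure (s : Set A) ≤ (Submodule.span (ZMod 2) s).toAddSubgroup :=
        (AddSubgroup.closure_le _).mpr Submodule.subset_span
      exact top_le_iff.mp fun x _ => h2 (h1 ▸ AddSubgroup.mem_top x)
    · have h2 : Submodule.span (ZMod 2) (s : Set A) ≤
          AddSubgroup.toZModSubmodule 2 (AddSubgroup.closure (s : Set A)) :=
        Submodule.span_le.mpr AddSubgroup.subset_closure
      exact top_le_iff.mp fun x _ => h2 (h1 ▸ Submodule.mem_top)
  suffices hm : minGen A = Module.finrank (ZMod 2) A by
    rw [hm, Module.natCard_eq_pow_finrank (K := ZMod 2), Nat.card_zmod]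
  classical
  have hmem : ∃ s : Finset A, s.card = Module.finrank (ZMod 2) A ∧
      AddSubgroup.closure (s : Set A) = ⊤ := by
    let b := Module.finBasis (ZMod 2) A
    refine ⟨Finset.univ.image b, ?_, (hcl _).mpr ?_⟩
    · rw [Finset.card_image_of_injective _ b.injective, Finset.card_univ, Fintype.card_fin]
    · rw [Finset.coe_image, Finset.coe_univ, Set.image_univ, b.span_eq]
  refine le_antisymm (Nat.sInf_le hmem) (le_csInf ⟨_, hmem⟩ ?_)
  rintro n ⟨s, rfl, hs⟩
  refine le_trans ?_ (finrank_span_finset_le_card (R := ZMod 2) s)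
  rw [Set.finrank, (hcl s).mp hs, finrank_top]

theorem reverse_cauchy_schwarz {n : ℕ} {a b : Fin (n + 1) → ℝ}
    (ha : 0 < a 0 * a 0 - ∑ i : Fin n, a i.succ * a i.succ)
    (hab : a 0 * b 0 - ∑ i : Fin n, a i.succ * b i.succ = 0) (hb : b ≠ 0) :
    b 0 * b 0 - ∑ i : Fin n, b i.succ * b i.succ < 0 := by
  have hcs := Finset.sum_mul_sq_le_sq_mul_sq Finset.univ (fun i : Fin n => a i.succ)
    fun i => b i.succ
  simp only [sq] at hcs
  set sa := ∑ i : Fin n, a i.succ * a i.succ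
  set sb := ∑ i : Fin n, b i.succ * b i.succ with hsb
  rw [← sub_eq_zero.mp hab] at hcs
  have hsa : 0 ≤ sa := Finset.sum_nonneg fun i _ => mul_self_nonneg _
  have hsb0 : 0 ≤ sb := Finset.sum_nonneg fun i _ => mul_self_nonneg _
  by_contra! hle
  have h0 : b 0 * b 0 = 0 := by
    by_contra hne
    have : 0 < b 0 * b 0 := lt_of_le_of_ne (mul_self_nonneg _) (Ne.symm hne)
    nlinarith
  have hsb' : sb = 0 := by linarith
  refine hb (funext fun i => Fin.cases (mul_self_eq_zero.mp h0) (fun j => ?_) i)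
  exact mul_self_eq_zero.mp ((Finset.sum_eq_zero_iff_of_nonneg fun i _ => mul_self_nonneg _).mp
    hsb' j (Finset.mem_univ j))

end Invariants

section GramMatrix

variable {r : ℕ}

/-- The rational matrix with the same entries as an integral matrix. -/
abbrev ratMat (G : Matrix (Fin r) (Fin r) ℤ) : Matrix (Fin r) (Fin r) ℚ :=
  G.map fun a : ℤ => (a : ℚ)

/-- The rational bilinear form of a Gram matrix. -/
noncomputable def gramForm (G : Matrix (Fin r) (Fin r) ℤ) : LinearMap.BilinForm ℚ (Fin r → ℚ) :=
  Matrix.toBilin' (ratMat G)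

/-- The inclusion of the integral vectors. -/
def castVec (r : ℕ) : (Fin r → ℤ) →+ (Fin r → ℚ) := (Int.castAddHom ℚ).compLeft (Fin r)

/-- The standard lattice. -/
def stdLattice (r : ℕ) : Submodule ℤ (Fin r → ℚ) :=
  LinearMap.range (castVec r).toIntLinearMap

theorem castVec_apply (z : Fin r → ℤ) (i : Fin r) : castVec r z i = z i := rfl

theorem castVec_injective : Function.Injective (castVec r) := fun _ _ h =>
  funext fun i => Int.cast_injective (congrFun h i)

theorem castVec_single (i : Fin r) : castVec r (Pi.single i 1) = Pi.single i 1 := by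
  ext j
  rw [castVec_apply, Pi.single_apply, Pi.single_apply]
  split_ifs <;> simp

theorem mem_stdLattice {x : Fin r → ℚ} : x ∈ stdLattice r ↔ ∃ z, castVec r z = x := Iff.rfl

theorem mem_stdLattice_iff {x : Fin r → ℚ} : x ∈ stdLattice r ↔ ∀ i, IsInt (x i) := by
  refine ⟨?_, fun h => ?_⟩
  · rintro ⟨z, rfl⟩ i
    exact ⟨z i, rfl⟩
  · choose z hz using h
    exact ⟨z, funext fun i => (hz i).symm⟩

theorem ratMat_mulVec (G : Matrix (Fin r) (Fin r) ℤ) (z : Fin r → ℤ) :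
    ratMat G *ᵥ castVec r z = castVec r (G *ᵥ z) := by
  ext i
  simp [mulVec, dotProduct, castVec_apply]

theorem gramForm_apply (G : Matrix (Fin r) (Fin r) ℤ) (x y : Fin r → ℚ) :
    gramForm G x y = x ⬝ᵥ ratMat G *ᵥ y := Matrix.toBilin'_apply' _ _ _

theorem gramForm_castVec (G : Matrix (Fin r) (Fin r) ℤ) (z w : Fin r → ℤ) :
    gramForm G (castVec r z) (castVec r w) = (z ⬝ᵥ G *ᵥ w : ℤ) := by
  rw [gramForm_apply, ratMat_mulVec]
  simp [dotProduct, castVec_apply]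

theorem gramForm_single (G : Matrix (Fin r) (Fin r) ℤ) (i : Fin r) (y : Fin r → ℚ) :
    gramForm G (Pi.single i 1) y = (ratMat G *ᵥ y) i := by
  rw [gramForm_apply, single_one_dotProduct]

theorem gramForm_symm {G : Matrix (Fin r) (Fin r) ℤ} (hsym : ∀ i j, G i j = G j i)
    (x y : Fin r → ℚ) : gramForm G x y = gramForm G y x := by
  have hT : (ratMat G)ᵀ = ratMat G := by
    ext i j
    simp [hsym j i]
  rw [gramForm_apply, gramForm_apply, dotProduct_mulVec, ← mulVec_transpose, hT,
    dotProduct_comm]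

theorem mem_dualLat_stdLattice {G : Matrix (Fin r) (Fin r) ℤ} {y : Fin r → ℚ} :
    y ∈ dualLat (gramForm G) (stdLattice r) ↔ ∀ i, IsInt ((ratMat G *ᵥ y) i) := by
  refine ⟨fun h i => ?_, ?_⟩
  · rw [← gramForm_single]
    exact h _ ⟨_, castVec_single i⟩
  · rintro h _ ⟨z, rfl⟩
    rw [gramForm_apply]
    obtain ⟨w, hw⟩ := mem_stdLattice_iff.mpr h
    rw [← hw]
    exact ⟨z ⬝ᵥ w, by simp [dotProduct, castVec_apply]⟩

theorem dvd_gram_self {G : Matrix (Fin r) (Fin r) ℤ} (hsym : ∀ i j, G i j = G j i)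
    (heven : ∀ i, 2 ∣ G i i) (z : Fin r → ℤ) : 2 ∣ z ⬝ᵥ G *ᵥ z := by
  have hT : Gᵀ = G := by
    ext i j
    exact hsym j i
  rw [← Finset.univ_sum_single z]
  refine Finset.sum_induction _ (fun z : Fin r → ℤ => 2 ∣ z ⬝ᵥ G *ᵥ z) (fun x y hx hy => ?_)
    (by simp) fun i _ => ?_
  · have h : y ⬝ᵥ G *ᵥ x = x ⬝ᵥ G *ᵥ y := by
      rw [dotProduct_mulVec, ← mulVec_transpose, hT, dotProduct_comm]
    have e : (x + y) ⬝ᵥ G *ᵥ (x + y) = x ⬝ᵥ G *ᵥ x + y ⬝ᵥ G *ᵥ y + 2 * (x ⬝ᵥ G *ᵥ y) := by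
      rw [mulVec_add, add_dotProduct, dotProduct_add, dotProduct_add, h]
      ring
    rw [e]
    exact dvd_add (dvd_add hx hy) (dvd_mul_right _ _)
  · rw [single_dotProduct, mulVec_single]
    simp only [Pi.smul_apply, Matrix.col_apply]
    exact Dvd.dvd.mul_left (by simpa using (heven i).mul_right _) _

theorem isUnit_ratMat {G : Matrix (Fin r) (Fin r) ℤ} (hnd : G.det ≠ 0) :
    IsUnit (ratMat G).det := by
  have h : (ratMat G).det = (G.det : ℚ) := ((Int.castRingHom ℚ).map_det G).symm
  rw [h]
  exact (Int.cast_ne_zero.mpr hnd).isUnit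

theorem ratMat_injective {G : Matrix (Fin r) (Fin r) ℤ} (hnd : G.det ≠ 0) :
    Function.Injective (ratMat G).mulVec :=
  Matrix.mulVec_injective_iff_isUnit.mpr ((Matrix.isUnit_iff_isUnit_det _).mpr (isUnit_ratMat hnd))

theorem span_stdLattice : Submodule.span ℚ (stdLattice r : Set (Fin r → ℚ)) = ⊤ := by
  rw [eq_top_iff, ← (Pi.basisFun ℚ (Fin r)).span_eq]
  refine Submodule.span_mono ?_
  rintro _ ⟨i, rfl⟩
  rw [Pi.basisFun_apply]
  exact ⟨_, castVec_single i⟩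

theorem isEvenTwoElem_gramForm {G : Matrix (Fin r) (Fin r) ℤ} (hsym : ∀ i j, G i j = G j i)
    (heven : ∀ i, 2 ∣ G i i) (hnd : G.det ≠ 0) (h2 : TwoElem G) :
    IsEvenTwoElem (gramForm G) (stdLattice r) where
  fg := by
    rw [stdLattice, LinearMap.range_eq_map]
    exact Module.Finite.fg_top.map _
  span_eq := span_stdLattice
  symm := gramForm_symm hsym
  even := by
    rintro _ ⟨z, rfl⟩
    obtain ⟨k, hk⟩ := dvd_gram_self hsym heven z
    refine ⟨k, ?_⟩
    have := gramForm_castVec G z z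
    rw [hk] at this
    rw [AddMonoidHom.coe_toIntLinearMap, this]
    push_cast
    ring
  add_self_mem y hy := by
    obtain ⟨v, hv⟩ := mem_stdLattice_iff.mpr (mem_dualLat_stdLattice.mp hy)
    obtain ⟨w, hw⟩ := h2 v
    refine ⟨w, ratMat_injective hnd ?_⟩
    have hv : castVec r v = ratMat G *ᵥ y := hv
    rw [AddMonoidHom.coe_toIntLinearMap, ratMat_mulVec, hw, map_nsmul, hv, mulVec_add, two_nsmul]
  mem_of_dual x hx := by
    refine mem_stdLattice_iff.mpr fun i => ?_
    have hG : ratMat G *ᵥ ((ratMat G)⁻¹ *ᵥ Pi.single i 1) = Pi.single i 1 := by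
      rw [mulVec_mulVec, Matrix.mul_nonsing_inv _ (isUnit_ratMat hnd), one_mulVec]
    have := hx ((ratMat G)⁻¹ *ᵥ Pi.single i 1) (mem_dualLat_stdLattice.mpr (by
      rw [hG]
      exact mem_stdLattice_iff.mp ⟨_, castVec_single i⟩))
    rwa [gramForm_symm hsym, gramForm_apply, hG, dotProduct_single_one] at this

theorem dualIntegral_gramForm {G : Matrix (Fin r) (Fin r) ℤ} :
    DualIntegral (gramForm G) (stdLattice r) ↔ ParityZero G := by
  refine forall_congr' fun y => imp_congr mem_dualLat_stdLattice ?_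
  rw [gramForm_apply]
  rfl

end GramMatrix

section Congruence

variable {r : ℕ}

theorem card_quotient_mul_coIndex {G : Matrix (Fin r) (Fin r) ℤ} (hsym : ∀ i j, G i j = G j i)
    (heven : ∀ i, 2 ∣ G i i) (hnd : G.det ≠ 0) (h2 : TwoElem G) :
    Nat.card ((Fin r → ℤ) ⧸ LinearMap.range G.mulVecLin) * coIndex (gramForm G) (stdLattice r) =
      2 ^ r := by
  have hE := isEvenTwoElem_gramForm hsym heven hnd h2
  set M := (stdLattice r).toAddSubgroup with hM
  set T := (twiceDual (gramForm G) (stdLattice r)).toAddSubgroup with hT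
  set d : (Fin r → ℚ) →+ (Fin r → ℚ) := nsmulAddMonoidHom 2 with hd
  let g : (Fin r → ℚ) →+ (Fin r → ℚ) := (ratMat G).mulVecLin.toAddMonoidHom
  have hg : ∀ x, g x = ratMat G *ᵥ x := fun _ => rfl
  have hdi : Function.Injective d := fun x y h => by
    have h' : (2 : ℕ) • x = 2 • y := h
    exact nsmul_right_injective two_ne_zero h'
  have hTd : T.map g = M.map d := by
    ext x
    constructor
    · rintro ⟨y, hy, rfl⟩
      have h := mem_dualLat_stdLattice.mp (mem_twiceDual_iff.mp hy)
      obtain ⟨z, hz⟩ := mem_stdLattice_iff.mpr h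
      refine ⟨_, ⟨z, rfl⟩, ?_⟩
      rw [hz, hg, mulVec_smul]
      change (2 : ℕ) • ((2⁻¹ : ℚ) • ratMat G *ᵥ y) = _
      rw [← Nat.cast_smul_eq_nsmul ℚ, smul_smul]
      norm_num
    · rintro ⟨y, hy, rfl⟩
      have hG : ratMat G *ᵥ ((ratMat G)⁻¹ *ᵥ y) = y := by
        rw [mulVec_mulVec, Matrix.mul_nonsing_inv _ (isUnit_ratMat hnd), one_mulVec]
      refine ⟨(2 : ℕ) • ((ratMat G)⁻¹ *ᵥ y), ?_, ?_⟩
      · refine mem_twiceDual_iff.mpr (mem_dualLat_stdLattice.mpr ?_)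
        rw [← Nat.cast_smul_eq_nsmul ℚ, smul_smul, Nat.cast_two, inv_mul_cancel₀ two_ne_zero,
          one_smul, hG]
        exact mem_stdLattice_iff.mp hy
      · rw [map_nsmul, hg, hG]
        rfl
  have hMg : (M.map d).map g = (M.map g).map d := by
    rw [AddSubgroup.map_map, AddSubgroup.map_map]
    exact congrArg (fun f => M.map f) (AddMonoidHom.ext fun x => map_nsmul g 2 x)
  have hM' : M = (⊤ : AddSubgroup (Fin r → ℤ)).map (castVec r) := by
    ext x
    simp [M, mem_stdLattice]
  have hMg' : M.map g = (LinearMap.range G.mulVecLin).toAddSubgroup.map (castVec r) := by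
    ext x
    constructor
    · rintro ⟨_, ⟨z, rfl⟩, rfl⟩
      exact ⟨_, ⟨z, rfl⟩, (ratMat_mulVec G z).symm⟩
    · rintro ⟨_, ⟨z, rfl⟩, rfl⟩
      exact ⟨_, ⟨z, rfl⟩, ratMat_mulVec G z⟩
  have hcard : (M.map d).relIndex T =
      Nat.card ((Fin r → ℤ) ⧸ LinearMap.range G.mulVecLin) := by
    rw [← AddSubgroup.relIndex_map_map_of_injective (f := g) _ _ (ratMat_injective hnd), hTd, hMg,
      AddSubgroup.relIndex_map_map_of_injective _ _ hdi, hMg', hM',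
      AddSubgroup.relIndex_map_map_of_injective _ _ castVec_injective,
      AddSubgroup.relIndex_top_right, AddSubgroup.index_eq_card]
    rfl
  have hle : M.map d ≤ T := by
    rintro _ ⟨x, hx, rfl⟩
    refine mem_twiceDual_iff.mpr ?_
    change (2⁻¹ : ℚ) • ((2 : ℕ) • x) ∈ _
    rw [← Nat.cast_smul_eq_nsmul ℚ, smul_smul]
    norm_num
    exact fun y hy => hE.isInt hy hx
  have hle' : T ≤ M := hE.twiceDual_le
  have h := AddSubgroup.relIndex_mul_relIndex _ _ _ hle hle'
  rw [hE.relIndex_double, hcard, Module.finrank_fin_fun] at h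
  exact h

theorem card_quotient_eq {G : Matrix (Fin r) (Fin r) ℤ} (h2 : TwoElem G)
    (h0 : Nat.card ((Fin r → ℤ) ⧸ LinearMap.range G.mulVecLin) ≠ 0) :
    Nat.card ((Fin r → ℤ) ⧸ LinearMap.range G.mulVecLin) =
      2 ^ minGen ((Fin r → ℤ) ⧸ LinearMap.range G.mulVecLin) := by
  have := Nat.finite_of_card_ne_zero h0
  refine card_eq_two_pow_minGen fun a => ?_
  obtain ⟨v, rfl⟩ := Submodule.Quotient.mk_surjective _ a
  obtain ⟨w, hw⟩ := h2 v
  rw [← Submodule.Quotient.mk_smul, Submodule.Quotient.mk_eq_zero]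
  exact ⟨w, hw⟩

theorem hyp_gramForm {n : ℕ} {G : Matrix (Fin (n + 1)) (Fin (n + 1)) ℤ}
    (h : SignatureIs G 1) : Hyp (gramForm G) := by
  obtain ⟨P, hP, hD⟩ := h
  set R : Matrix (Fin (n + 1)) (Fin (n + 1)) ℝ := G.map fun a : ℤ => (a : ℝ) with hR
  let c : (Fin (n + 1) → ℚ) → (Fin (n + 1) → ℝ) := fun x i => (x i : ℝ)
  have hcast : ∀ x y, ((gramForm G x y : ℚ) : ℝ) = c x ⬝ᵥ R *ᵥ c y := fun x y => by
    rw [gramForm_apply]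
    simp [c, R, dotProduct, mulVec]
  have hdiag : ∀ a b, (P *ᵥ a) ⬝ᵥ R *ᵥ (P *ᵥ b) =
      a 0 * b 0 - ∑ i : Fin n, a i.succ * b i.succ := fun a b => by
    have e : (P *ᵥ a) ⬝ᵥ R *ᵥ (P *ᵥ b) = a ⬝ᵥ (Pᵀ * R * P) *ᵥ b := by
      rw [← mulVec_mulVec, ← mulVec_mulVec, dotProduct_mulVec a, vecMul_transpose]
    rw [e, hD, dotProduct, Fin.sum_univ_succ]
    simp [mulVec_diagonal, Finset.sum_neg_distrib, sub_eq_add_neg]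
  have hinv : ∀ x, P *ᵥ (P⁻¹ *ᵥ x) = x := fun x => by
    rw [mulVec_mulVec, Matrix.mul_nonsing_inv _ hP, one_mulVec]
  have hpos : ∃ x, 0 < c x ⬝ᵥ R *ᵥ c x := by
    have hdense : DenseRange c := DenseRange.piMap fun _ => Rat.denseRange_cast
    refine hdense.exists_mem_open (s := {x | 0 < x ⬝ᵥ R *ᵥ x}) ?_ ⟨P *ᵥ Pi.single 0 1, ?_⟩
    · exact isOpen_lt continuous_const (by fun_prop)
    · rw [Set.mem_ofPred_eq, hdiag]
      simp
  obtain ⟨x, hx⟩ := hpos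
  refine ⟨x, by exact_mod_cast (hcast x x).symm ▸ hx, fun y hxy hy => ?_⟩
  have hxy' : c y ⬝ᵥ R *ᵥ c x = 0 := by
    rw [← hcast, hxy, Rat.cast_zero]
  have hcy : P⁻¹ *ᵥ c y ≠ 0 := fun h0 => hy (funext fun i => by
    have h1 := hinv (c y)
    rw [h0, mulVec_zero] at h1
    exact Rat.cast_eq_zero.mp (congrFun h1 i).symm)
  rw [← hinv (c x), hdiag] at hx
  rw [← hinv (c x), ← hinv (c y), hdiag] at hxy'
  simp only [mul_comm ((P⁻¹ *ᵥ c y) _)] at hxy'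
  have h := reverse_cauchy_schwarz hx hxy' hcy
  rw [← hdiag, hinv, ← hcast] at h
  exact_mod_cast h

theorem exists_congruence {G G' : Matrix (Fin r) (Fin r) ℤ}
    (h : LatIsom (gramForm G') (stdLattice r) (gramForm G) (stdLattice r)) :
    ∃ P : Matrix (Fin r) (Fin r) ℤ, IsUnit P.det ∧ Pᵀ * G * P = G' := by
  obtain ⟨φ, hφ, hm⟩ := h
  have hP : ∀ j, ∃ z, castVec r z = φ (castVec r (Pi.single j 1)) := fun j =>
    (hm _).mpr ⟨_, rfl⟩
  have hQ : ∀ j, ∃ z, castVec r z = φ.symm (castVec r (Pi.single j 1)) := fun j =>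
    (hm _).mp (by rw [φ.apply_symm_apply]; exact ⟨_, rfl⟩)
  choose p hp using hP
  choose q hq using hQ
  have hPv : ∀ z, castVec r ((Matrix.of p)ᵀ *ᵥ z) = φ (castVec r z) := fun z => by
    have e : (Matrix.of p)ᵀ *ᵥ z = ∑ j, z j • p j := by
      ext i
      simp [mulVec, dotProduct, mul_comm]
    rw [e, map_sum]
    conv_rhs => rw [← Finset.univ_sum_single z, map_sum, map_sum]
    refine Finset.sum_congr rfl fun j _ => ?_
    have e' : (Pi.single j (z j) : Fin r → ℤ) = z j • Pi.single j 1 := by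
      rw [← Pi.single_smul, smul_eq_mul, mul_one]
    rw [e', map_zsmul, map_zsmul, map_zsmul, hp]
  refine ⟨(Matrix.of p)ᵀ, ?_, ?_⟩
  · refine Matrix.isUnit_det_of_right_inverse (B := (Matrix.of q)ᵀ) ?_
    ext i j
    have e : (Matrix.of p)ᵀ *ᵥ q j = Pi.single j 1 :=
      castVec_injective (by rw [hPv, hq, φ.apply_symm_apply])
    have e' := congrFun e i
    rw [Pi.single_apply] at e'
    rw [Matrix.one_apply, ← e']
    rfl
  · ext i j
    have h1 := hφ (castVec r (Pi.single i 1)) (castVec r (Pi.single j 1))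
    rw [← hp, ← hp, gramForm_castVec, gramForm_castVec, Int.cast_inj] at h1
    rw [single_one_dotProduct, mulVec_single_one] at h1
    rw [Matrix.mul_assoc]
    exact h1

end Congruence

/-- Nikulin's Theorem 3.6.2: An even hyperbolic 2-elementary lattice
is determined up to isometry by the invariants `(r, l, δ)`: two such lattices of the
same rank `r`, the same minimal number of generators `l` of the discriminant group,
and the same parity `δ` are isometric (their Gram matrices are integrally congruent). -/
theorem stmt_17 (r : ℕ) (G G' : Matrix (Fin r) (Fin r) ℤ)
    (hsym : ∀ i j, G i j = G j i) (hsym' : ∀ i j, G' i j = G' j i)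
    (heven : ∀ i, 2 ∣ G i i) (heven' : ∀ i, 2 ∣ G' i i)
    (hnd : G.det ≠ 0) (hnd' : G'.det ≠ 0)
    (hhyp : SignatureIs G 1) (hhyp' : SignatureIs G' 1)
    (h2 : TwoElem G) (h2' : TwoElem G')
    (hl : minGen ((Fin r → ℤ) ⧸ LinearMap.range G.mulVecLin) =
      minGen ((Fin r → ℤ) ⧸ LinearMap.range G'.mulVecLin))
    (hδ : ParityZero G ↔ ParityZero G') :
    ∃ P : Matrix (Fin r) (Fin r) ℤ, IsUnit P.det ∧ P.transpose * G * P = G' := by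
  have hc := card_quotient_mul_coIndex hsym heven hnd h2
  have hc' := card_quotient_mul_coIndex hsym' heven' hnd' h2'
  have hr : 2 ^ r ≠ 0 := pow_ne_zero r two_ne_zero
  have h0 := hc.trans_ne hr
  have h0' := hc'.trans_ne hr
  have hq := card_quotient_eq h2 (left_ne_zero_of_mul h0)
  have hq' := card_quotient_eq h2' (left_ne_zero_of_mul h0')
  have hco : coIndex (gramForm G') (stdLattice r) = coIndex (gramForm G) (stdLattice r) := by
    refine Nat.eq_of_mul_eq_mul_left (Nat.pos_of_ne_zero (left_ne_zero_of_mul h0)) ?_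
    rw [hc, ← hc', hq, hq', hl]
  cases r with
  | zero => exact ⟨1, by simp, Subsingleton.elim _ _⟩
  | succ n =>
    exact exists_congruence (latIsom_of_invariants
      (isEvenTwoElem_gramForm hsym' heven' hnd' h2') (isEvenTwoElem_gramForm hsym heven hnd h2)
      (hyp_gramForm hhyp') (hyp_gramForm hhyp) rfl hco (right_ne_zero_of_mul h0')
      (dualIntegral_gramForm.trans (hδ.symm.trans dualIntegral_gramForm.symm)))
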